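/- arXiv:1301.7077 — 2 statements merged into one kernel-verified Lean document; each statement's English description precedes it below -/
import Mathlib

section
/- Suppose p,q are coprime positive integers and θ ∈ (0,π/3) satisfies tan θ = √3·p/(2q+p). Then there is a constant β(θ), depending only on θ, such that for ν_θ-almost all a ∈ Δ_θ the box dimension and the Hausdorff dimension of the slice E_{θ,a} both exist, coincide, and equal β(θ), and moreover β(θ) > s − 1. -/
open Filter MeasureTheory Set Metric Topology
open scoped ENNReal Classical

noncomputable section

/-- The maps of the iterated function system of the usual Sierpiński gasket. -/
def gasketMap : Fin 3 → ℝ × ℝ → ℝ × ℝ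
  | 0 => fun z => (z.1 / 2, z.2 / 2)
  | 1 => fun z => (z.1 / 2 + 1 / 2, z.2 / 2)
  | 2 => fun z => (z.1 / 2 + 1 / 4, z.2 / 2 + Real.sqrt 3 / 4)

/-- `Δ` is the Sierpiński gasket: the unique nonempty compact set invariant under the IFS. -/
def IsSierpinskiGasket (Δ : Set (ℝ × ℝ)) : Prop :=
  Δ.Nonempty ∧ IsCompact Δ ∧
    Δ = gasketMap 0 '' Δ ∪ gasketMap 1 '' Δ ∪ gasketMap 2 '' Δ

/-- The orthogonal projection onto the line through the origin making angle `θ` with the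
`x`-axis, expressed as the real coordinate along that line. -/
def projAngle (θ : ℝ) (z : ℝ × ℝ) : ℝ := z.1 * Real.cos θ + z.2 * Real.sin θ

/-- The slice `E_{θ,a}`. -/
def sliceSet (Δ : Set (ℝ × ℝ)) (θ a : ℝ) : Set (ℝ × ℝ) :=
  {z ∈ Δ | projAngle θ z = a}

/-- Minimal number of `ε`-balls needed to cover `E` (junk value `0` if there is no
finite cover). -/
def coverNum {X : Type*} [PseudoMetricSpace X] (E : Set X) (ε : ℝ) : ℕ :=
  sInf {n : ℕ | ∃ F : Finset X, F.card = n ∧ E ⊆ ⋃ x ∈ F, Metric.ball x ε}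

/-- Lower box (Minkowski) dimension. -/
def lowerBoxDim {X : Type*} [PseudoMetricSpace X] (E : Set X) : ℝ :=
  liminf (fun ε : ℝ => Real.log (coverNum E ε) / Real.log (1 / ε)) (𝓝[>] 0)

/-- Upper box (Minkowski) dimension. -/
def upperBoxDim {X : Type*} [PseudoMetricSpace X] (E : Set X) : ℝ :=
  limsup (fun ε : ℝ => Real.log (coverNum E ε) / Real.log (1 / ε)) (𝓝[>] 0)

/-- Lower local dimension of a measure at a point. -/
def lowerLocalDim (η : Measure ℝ) (x : ℝ) : ℝ :=
  liminf (fun r : ℝ => Real.log (η (Metric.ball x r)).toReal / Real.log r) (𝓝[>] 0)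

/-- Upper local dimension of a measure at a point. -/
def upperLocalDim (η : Measure ℝ) (x : ℝ) : ℝ :=
  limsup (fun r : ℝ => Real.log (η (Metric.ball x r)).toReal / Real.log r) (𝓝[>] 0)

/-- `ν` is the natural self-similar measure on the Sierpiński gasket `Δ`, i.e. the unique
Borel probability measure with `ν = Σ_{i=0}^2 (1/3) ν ∘ S_i⁻¹` (supported on `Δ`). -/
def IsGasketMeasure (Δ : Set (ℝ × ℝ)) (ν : Measure (ℝ × ℝ)) : Prop :=
  IsProbabilityMeasure ν ∧ ν Δᶜ = 0 ∧
    ν = (3 : ℝ≥0∞)⁻¹ • (ν.map (gasketMap 0) + ν.map (gasketMap 1) + ν.map (gasketMap 2))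

/-- Hausdorff dimension of a measure: `inf {dim_H A : η A = 1}`. -/
def measureDimH (η : Measure ℝ) : ℝ≥0∞ :=
  sInf {d : ℝ≥0∞ | ∃ A : Set ℝ, η A = 1 ∧ dimH A = d}

/-- The matrices `A_0, A_1` of the paper (there rows and columns are indexed by
`1, …, p+q`; here `i : Fin (p+q)` corresponds to the row `i+1`). -/
def gmA (p q : ℕ) (n : ℕ) : Matrix (Fin (p + q)) (Fin (p + q)) ℝ :=
  Matrix.of fun i j =>
    if Int.ModEq ((p : ℤ) + (q : ℤ)) (2 * ((i : ℤ) + 1) + 1 - (n : ℤ)) ((j : ℤ) + 1) ∨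
        (((q : ℤ) + 1 ≤ 2 * ((i : ℤ) + 1) + (n : ℤ) - 1 ∧
            2 * ((i : ℤ) + 1) + (n : ℤ) - 1 ≤ 2 * (q : ℤ) + (p : ℤ)) ∧
          Int.ModEq ((p : ℤ) + (q : ℤ)) (2 * ((i : ℤ) + 1) + 1 - (n : ℤ) - (q : ℤ))
            ((j : ℤ) + 1))
    then 1 else 0

/-- The product `A_{ξ_1} ⋯ A_{ξ_n}` along a word `ξ ∈ {0,1}^n`. -/
def gmProd (p q : ℕ) {n : ℕ} (ξ : Fin n → Fin 2) : Matrix (Fin (p + q)) (Fin (p + q)) ℝ :=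
  (List.ofFn fun m => gmA p q (ξ m : ℕ)).prod

/-- `e ⬝ A_{ξ_1} ⋯ A_{ξ_n} ⬝ e` where `e = (1,…,1)`. -/
def eAe (p q : ℕ) {n : ℕ} (ξ : Fin n → Fin 2) : ℝ :=
  ∑ i : Fin (p + q), ∑ j : Fin (p + q), gmProd p q ξ i j

/-- `e_k ⬝ A_{ξ_1} ⋯ A_{ξ_n} ⬝ e` where `e_k` is the `k`-th standard basis vector. -/
def ekAe (p q : ℕ) {n : ℕ} (k : Fin (p + q)) (ξ : Fin n → Fin 2) : ℝ :=
  ∑ j : Fin (p + q), gmProd p q ξ k j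

/-- The maps of the IFS of the right-angle Sierpiński gasket. -/
def rgasketMap : Fin 3 → ℝ × ℝ → ℝ × ℝ
  | 0 => fun z => (z.1 / 2, z.2 / 2)
  | 1 => fun z => (z.1 / 2 + 1 / 2, z.2 / 2)
  | 2 => fun z => (z.1 / 2, z.2 / 2 + 1 / 2)

/-- `Λ` is the right-angle Sierpiński gasket. -/
def IsRightGasket (Λ : Set (ℝ × ℝ)) : Prop :=
  Λ.Nonempty ∧ IsCompact Λ ∧
    Λ = rgasketMap 0 '' Λ ∪ rgasketMap 1 '' Λ ∪ rgasketMap 2 '' Λ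

/-- The slice of the right-angle gasket by the line `y = a + (p/q) x`. -/
def rslice (Λ : Set (ℝ × ℝ)) (p q : ℕ) (a : ℝ) : Set (ℝ × ℝ) :=
  {z ∈ Λ | z.2 = a + ((p : ℝ) / (q : ℝ)) * z.1}

/-- The cylinder set `Δ_{i_1 ⋯ i_n} = S_{i_1} ∘ ⋯ ∘ S_{i_n}(Δ)`. -/
def cylSet (Δ : Set (ℝ × ℝ)) {n : ℕ} (w : Fin n → Fin 3) : Set (ℝ × ℝ) :=
  (List.ofFn fun m => gasketMap (w m)).foldr (fun f E => f '' E) Δ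


namespace GasketSlice

open ProbabilityTheory

/-! ### The Bernoulli shift on three symbols -/

/-- Infinite words over the alphabet `{0, 1, 2}`. -/
abbrev Code := ℕ → Fin 3

/-- The uniform probability measure on the alphabet. -/
def unif : Measure (Fin 3) := (3 : ℝ≥0∞)⁻¹ • Measure.count

instance : IsProbabilityMeasure unif :=
  ⟨by simp [unif, Measure.smul_apply]; exact ENNReal.inv_mul_cancel (by norm_num) (by norm_num)⟩

/-- The uniform Bernoulli measure. -/
def bern : Measure Code := Measure.infinitePi fun _ => unif

instance : IsProbabilityMeasure bern := by unfold bern; infer_instance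

/-- The `n`-th iterate of the left shift. -/
def shift (n : ℕ) (ω : Code) : Code := fun k => ω (k + n)

lemma shift_shift (n m : ℕ) (ω : Code) : shift m (shift n ω) = shift (n + m) ω := by
  funext k; simp only [shift]; congr 1; omega

lemma shift_zero (ω : Code) : shift 0 ω = ω := rfl

lemma measurable_shift (n : ℕ) : Measurable (shift n) := by unfold shift; fun_prop

lemma measurePreserving_shift (n : ℕ) : MeasurePreserving (shift n) bern bern :=
  ⟨measurable_shift n, Measure.map_infinitePi_infinitePi_of_inj (P := fun _ : ℕ => unif)
    (f := fun k => k + n) (add_left_injective n)⟩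

/-- The first `n` letters of a word. -/
def pre (n : ℕ) (ω : Code) : Fin n → Fin 3 := fun k => ω k

lemma measurable_pre (n : ℕ) : Measurable (pre n) := by unfold pre; fun_prop

/-- Extension of a finite word by zeros. -/
def extendWord {n : ℕ} (w : Fin n → Fin 3) : Code := fun k => if h : k < n then w ⟨k, h⟩ else 0

lemma extendWord_of_lt {n : ℕ} (w : Fin n → Fin 3) {k : ℕ} (h : k < n) :
    extendWord w k = w ⟨k, h⟩ := by simp [extendWord, h]

lemma pre_extendWord {n : ℕ} (w : Fin n → Fin 3) : pre n (extendWord w) = w := by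
  funext k; simp [pre, extendWord]

/-- `f` depends only on the first `n` letters. -/
def IsLocal {E : Type*} (n : ℕ) (f : Code → E) : Prop :=
  ∀ ω ω', (∀ k < n, ω k = ω' k) → f ω = f ω'

lemma IsLocal.comp {E F : Type*} {n : ℕ} {f : Code → E} (hf : IsLocal n f) (g : E → F) :
    IsLocal n (fun ω => g (f ω)) := fun ω ω' h => congrArg g (hf ω ω' h)

lemma IsLocal.mono {E : Type*} {n m : ℕ} {f : Code → E} (hf : IsLocal n f) (h : n ≤ m) :
    IsLocal m f := fun ω ω' hω => hf ω ω' fun k hk => hω k (hk.trans_le h)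

lemma IsLocal.eq_comp_pre {E : Type*} {n : ℕ} {f : Code → E} (hf : IsLocal n f) :
    f = (fun w => f (extendWord w)) ∘ pre n := by
  funext ω
  exact hf _ _ fun k hk => by simp [pre, extendWord, hk]

lemma IsLocal.measurable {E : Type*} [MeasurableSpace E] {n : ℕ} {f : Code → E}
    (hf : IsLocal n f) : Measurable f := by
  rw [hf.eq_comp_pre]
  exact (measurable_of_finite _).comp (measurable_pre n)

lemma IsLocal.exists_bound {n : ℕ} {f : Code → ℝ} (hf : IsLocal n f) : ∃ C, ∀ ω, |f ω| ≤ C := by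
  obtain ⟨C, hC⟩ := (Set.finite_range fun w : Fin n → Fin 3 => |f (extendWord w)|).bddAbove
  refine ⟨C, fun ω => ?_⟩
  rw [hf.eq_comp_pre]
  exact hC ⟨pre n ω, rfl⟩

lemma IsLocal.integrable {n : ℕ} {f : Code → ℝ} (hf : IsLocal n f) : Integrable f bern := by
  obtain ⟨C, hC⟩ := hf.exists_bound
  exact Integrable.of_bound hf.measurable.aestronglyMeasurable C (ae_of_all _ hC)

lemma indepFun_pre_shift (n : ℕ) : IndepFun (pre n) (shift n) bern := by
  have h0 : iIndepFun (fun (i : ℕ) (ω : Code) => ω i) bern :=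
    iIndepFun_infinitePi (P := fun _ : ℕ => unif) (X := fun _ x => x) fun _ => measurable_id
  have h := indep_iSup_of_disjoint (fun i => (measurable_pi_apply i).comap_le) h0
    (S := {i | i < n}) (T := {i | n ≤ i})
    (Set.disjoint_left.2 fun i hi hi' => (not_lt.2 (show n ≤ i from hi')) hi)
  refine indep_of_indep_of_le_left (indep_of_indep_of_le_right h ?_) ?_
  · refine Measurable.comap_le ?_
    refine (@measurable_pi_iff _ _ _ (_) _ _).2 fun k => ?_
    refine Measurable.mono (comap_measurable fun ω : Code => ω (k + n)) ?_ le_rfl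
    exact le_iSup₂_of_le (k + n) (by simp) le_rfl
  · refine Measurable.comap_le ?_
    refine (@measurable_pi_iff _ _ _ (_) _ _).2 fun k => ?_
    refine Measurable.mono (comap_measurable fun ω : Code => ω k) ?_ le_rfl
    exact le_iSup₂_of_le (k : ℕ) k.2 le_rfl

lemma IsLocal.indepFun {E F : Type*} [MeasurableSpace E] [MeasurableSpace F] {n : ℕ}
    {f : Code → E} (hf : IsLocal n f) {g : Code → F} (hg : Measurable g) :
    IndepFun f (fun ω => g (shift n ω)) bern := by
  rw [hf.eq_comp_pre]
  exact (indepFun_pre_shift n).comp (measurable_of_finite _) hg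

/-- The strong law of large numbers along blocks of length `k`. -/
lemma IsLocal.strong_law {k : ℕ} {f : Code → ℝ} (hf : IsLocal k f) :
    ∀ᵐ ω ∂bern, Tendsto (fun n : ℕ => (∑ j ∈ Finset.range n, f (shift (j * k) ω)) / n) atTop
      (𝓝 (∫ ω, f ω ∂bern)) := by
  have h := strong_law_ae_real (μ := bern) (fun j ω => f (shift (j * k) ω)) ?_ ?_ ?_
  · simpa [shift_zero] using h
  · simpa [shift_zero] using hf.integrable
  · have key : ∀ i j : ℕ, i < j →
        IndepFun (fun ω => f (shift (i * k) ω)) (fun ω => f (shift (j * k) ω)) bern := by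
      intro i j hij
      obtain ⟨l, rfl⟩ := Nat.exists_eq_add_of_lt hij
      have h1 : IndepFun f (fun ω => f (shift (l * k) (shift k ω))) bern :=
        hf.indepFun (hf.measurable.comp (measurable_shift _))
      have hmp := measurePreserving_shift (i * k)
      rw [indepFun_iff_measure_inter_preimage_eq_mul] at h1 ⊢
      intro s t hs ht
      have hs' := hf.measurable hs
      have ht' : MeasurableSet ((fun ω => f (shift (l * k) (shift k ω))) ⁻¹' t) :=
        (hf.measurable.comp ((measurable_shift _).comp (measurable_shift _))) ht
      have h2 := h1 s t hs ht
      rw [← hmp.measure_preimage (hs'.inter ht').nullMeasurableSet,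
        ← hmp.measure_preimage hs'.nullMeasurableSet,
        ← hmp.measure_preimage ht'.nullMeasurableSet] at h2
      have e : ∀ ω, shift ((i + l + 1) * k) ω = shift (l * k) (shift k (shift (i * k) ω)) := by
        intro ω
        rw [shift_shift, shift_shift, show i * k + (k + l * k) = (i + l + 1) * k by ring]
      simp only [e]
      exact h2
    intro i j hij
    rcases lt_or_gt_of_ne hij with h | h
    · exact key i j h
    · exact (key j i h).symm
  · intro j
    refine ⟨(hf.measurable.comp (measurable_shift _)).aemeasurable,
      (hf.measurable.comp (measurable_shift _)).aemeasurable, ?_⟩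
    have h1 := (measurePreserving_shift (j * k)).map_eq
    have h2 := (measurePreserving_shift (0 * k)).map_eq
    rw [show (fun ω => f (shift (j * k) ω)) = f ∘ shift (j * k) from rfl,
      show (fun ω => f (shift (0 * k) ω)) = f ∘ shift (0 * k) from rfl,
      ← Measure.map_map hf.measurable (measurable_shift _),
      ← Measure.map_map hf.measurable (measurable_shift _), h1, h2]

lemma bern_cylinder {n : ℕ} (w : Fin n → Fin 3) :
    bern {ω | pre n ω = w} = (3 : ℝ≥0∞)⁻¹ ^ n := by
  have h : {ω : Code | pre n ω = w}
      = Set.pi (Finset.range n : Set ℕ) (fun k => {extendWord w k}) := by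
    ext ω
    simp only [Set.mem_ofPred_eq, Set.mem_pi, Finset.coe_range, Set.mem_Iio, Set.mem_singleton_iff]
    constructor
    · rintro rfl k hk
      simp [extendWord, hk, pre]
    · intro h
      funext k
      rw [pre, h k k.2, extendWord_of_lt w k.2]
  rw [h, bern, Measure.infinitePi_pi _ fun i _ => measurableSet_singleton _]
  simp [unif]

/-! ### Binary expansions with digits given by a code -/

/-- The integer with binary digits `c (ω 0), …, c (ω (n - 1))`, most significant first. -/
def val (c : Fin 3 → ℤ) : ℕ → Code → ℤ
  | 0, _ => 0
  | n + 1, ω => 2 * val c n ω + c (ω n)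

lemma isLocal_val (c : Fin 3 → ℤ) (n : ℕ) : IsLocal n (val c n) := by
  induction n with
  | zero => exact fun _ _ _ => rfl
  | succ n ih =>
    intro ω ω' h
    simp only [val]
    rw [ih ω ω' fun k hk => h k (hk.trans n.lt_succ_self), h n n.lt_succ_self]

lemma val_add (c : Fin 3 → ℤ) (n m : ℕ) (ω : Code) :
    val c (n + m) ω = 2 ^ m * val c n ω + val c m (shift n ω) := by
  induction m with
  | zero => simp [val]
  | succ m ih =>
    rw [← add_assoc]
    simp only [val, ih, shift]
    rw [add_comm m n]; ring

lemma val_nonneg {c : Fin 3 → ℤ} (hc : ∀ i, 0 ≤ c i) (n : ℕ) (ω : Code) : 0 ≤ val c n ω := by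
  induction n with
  | zero => simp [val]
  | succ n ih => simp only [val]; linarith [hc (ω n)]

lemma val_le {c : Fin 3 → ℤ} {M : ℤ} (hc : ∀ i, c i ≤ M) (n : ℕ) (ω : Code) :
    val c n ω ≤ (2 ^ n - 1) * M := by
  induction n with
  | zero => simp [val]
  | succ n ih => simp only [val, pow_succ]; linarith [hc (ω n)]

/-- The real number with binary digits `c (ω 0), c (ω 1), …` after the binary point. -/
def code (c : Fin 3 → ℤ) (ω : Code) : ℝ := ∑' k, (c (ω k) : ℝ) / 2 ^ (k + 1)

lemma summable_code (c : Fin 3 → ℤ) (ω : Code) :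
    Summable fun k => (c (ω k) : ℝ) / 2 ^ (k + 1) := by
  obtain ⟨C, hC⟩ := (Set.finite_range fun i => |(c i : ℝ)|).bddAbove
  refine Summable.of_norm_bounded (g := fun k => C / 2 * (1 / 2) ^ k)
    ((summable_geometric_of_lt_one (by norm_num) (by norm_num)).mul_left _) fun k => ?_
  rw [norm_div, Real.norm_eq_abs, Real.norm_of_nonneg (by positivity), pow_succ, one_div, inv_pow]
  have : |(c (ω k) : ℝ)| ≤ C := hC ⟨ω k, rfl⟩
  rw [div_mul_eq_mul_div, div_le_div_iff₀ (by positivity) (by positivity)]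
  field_simp
  nlinarith [pow_pos (two_pos : (0:ℝ) < 2) k]

lemma code_succ (c : Fin 3 → ℤ) (ω : Code) :
    code c ω = (c (ω 0) + code c (shift 1 ω)) / 2 := by
  have h := (summable_code c ω).tsum_eq_zero_add
  rw [code, h, code, add_div, ← tsum_div_const]
  congr 1
  · simp
  · refine tsum_congr fun k => ?_
    simp only [shift]
    rw [div_div, ← pow_succ]

lemma code_shift (c : Fin 3 → ℤ) (n : ℕ) (ω : Code) :
    2 ^ n * code c ω = val c n ω + code c (shift n ω) := by
  induction n with
  | zero => simp [val, shift_zero]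
  | succ n ih =>
    have h := code_succ c (shift n ω)
    rw [shift_shift] at h
    simp only [shift, zero_add] at h
    rw [pow_succ, mul_right_comm, ih, val]
    push_cast
    linarith

lemma code_nonneg {c : Fin 3 → ℤ} (hc : ∀ i, 0 ≤ c i) (ω : Code) : 0 ≤ code c ω :=
  tsum_nonneg fun k => div_nonneg (by exact_mod_cast hc _) (by positivity)

lemma code_le {c : Fin 3 → ℤ} {M : ℤ} (hc : ∀ i, c i ≤ M) (ω : Code) : code c ω ≤ M := by
  have h : HasSum (fun k : ℕ => (M : ℝ) / 2 ^ (k + 1)) M := by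
    have := (hasSum_geometric_two).mul_left ((M : ℝ) / 2)
    rw [div_mul_cancel₀ _ (two_ne_zero)] at this
    have e : (fun k : ℕ => (M : ℝ) / 2 ^ (k + 1)) = fun k => (M : ℝ) / 2 * (1 / 2) ^ k := by
      funext k
      rw [pow_succ, one_div, inv_pow]; field_simp
    rwa [e]
  rw [code, ← h.tsum_eq]
  refine (summable_code c ω).tsum_le_tsum (fun k => ?_) h.summable
  gcongr
  exact hc _

lemma measurable_code (c : Fin 3 → ℤ) : Measurable (code c) := by
  refine Measurable.tsum fun k => ?_
  exact ((measurable_of_finite fun i : Fin 3 => (c i : ℝ)).comp (measurable_pi_apply k)).div_const _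

lemma code_combination (c₁ c₂ : Fin 3 → ℤ) (a b : ℤ) (ω : Code) :
    code (fun i => a * c₁ i + b * c₂ i) ω = a * code c₁ ω + b * code c₂ ω := by
  simp only [code]
  rw [← tsum_mul_left, ← tsum_mul_left,
    ← ((summable_code c₁ ω).mul_left _).tsum_add ((summable_code c₂ ω).mul_left _)]
  refine tsum_congr fun k => ?_
  push_cast; ring

/-! ### A subadditive ergodic theorem for local functions -/

lemma subadditive_le_sum {f : ℕ → Code → ℝ}
    (hsub : ∀ n m ω, f (n + m) ω ≤ f n ω + f m (shift n ω)) (k q r : ℕ) (ω : Code) :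
    f (q * k + r) ω ≤ ∑ j ∈ Finset.range q, f k (shift (j * k) ω) + f r (shift (q * k) ω) := by
  induction q generalizing r with
  | zero => simp [shift_zero]
  | succ q ih =>
    have h1 := ih (k + r)
    have h2 := hsub k r (shift (q * k) ω)
    rw [shift_shift] at h2
    rw [Finset.sum_range_succ, show (q + 1) * k = q * k + k by ring]
    rw [show q * k + (k + r) = q * k + k + r by ring] at h1
    linarith

lemma subadditive_limsup_le {f : ℕ → Code → ℝ} (hloc : ∀ n, IsLocal n (f n))
    (hsub : ∀ n m ω, f (n + m) ω ≤ f n ω + f m (shift n ω)) {k : ℕ} (hk : 0 < k) :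
    ∀ᵐ ω ∂bern, ∀ ε > 0, ∀ᶠ n : ℕ in atTop, f n ω / n ≤ (∫ ω, f k ω ∂bern) / k + ε := by
  choose C hC using fun n => (hloc n).exists_bound
  obtain ⟨D, hD⟩ := ((Finset.range k).image C).bddAbove
  filter_upwards [(hloc k).strong_law] with ω hω ε hε
  have hdiv : Tendsto (fun n : ℕ => n / k) atTop atTop := Nat.tendsto_div_const_atTop hk.ne'
  have h1 := hω.comp hdiv
  have h2 : Tendsto (fun n : ℕ => ((n / k : ℕ) : ℝ) / n) atTop (𝓝 (1 / k)) := by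
    have h := (tendsto_nat_floor_mul_div_atTop (R := ℝ) (a := 1 / k) (by positivity)).comp
      tendsto_natCast_atTop_atTop
    refine h.congr fun n => ?_
    simp only [Function.comp]
    rw [one_div_mul_eq_div, Nat.floor_div_eq_div]
  have h3 : Tendsto (fun n : ℕ => D / (n : ℝ)) atTop (𝓝 0) :=
    tendsto_const_div_atTop_nhds_zero_nat D
  have h4 := (h2.mul h1).add h3
  have h5 := h4.eventually_lt_const (u := (∫ ω, f k ω ∂bern) / k + ε) (by
    rw [add_zero, one_div_mul_eq_div]; linarith)
  filter_upwards [h5, eventually_ge_atTop k] with n hn hkn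
  refine le_trans ?_ (le_of_lt hn)
  have hq : 0 < n / k := Nat.div_pos hkn hk
  have hn0 : 0 < n := hk.trans_le hkn
  have h6 := subadditive_le_sum hsub k (n / k) (n % k) ω
  rw [Nat.div_add_mod'] at h6
  have h7 : f (n % k) (shift (n / k * k) ω) ≤ D :=
    (le_abs_self _).trans ((hC _ _).trans (hD (by
      exact_mod_cast Finset.mem_image_of_mem C (Finset.mem_range.2 (Nat.mod_lt n hk)))))
  have hq' : ((n / k : ℕ) : ℝ) ≠ 0 := by exact_mod_cast hq.ne'
  have hn' : (0 : ℝ) < n := by exact_mod_cast hn0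
  simp only [Function.comp]
  rw [div_mul_div_comm, mul_comm (n : ℝ), mul_div_mul_left _ _ hq', ← add_div]
  gcongr
  linarith

/-! ### Entropy of the digit sums -/

/-- The distribution of `val c n` under the Bernoulli measure. -/
def mass (c : Fin 3 → ℤ) (n : ℕ) (v : ℤ) : ℝ := bern.real {ω | val c n ω = v}

lemma measurableSet_val (c : Fin 3 → ℤ) (n : ℕ) (v : ℤ) : MeasurableSet {ω | val c n ω = v} :=
  (isLocal_val c n).measurable (measurableSet_singleton v)

lemma mass_nonneg (c : Fin 3 → ℤ) (n : ℕ) (v : ℤ) : 0 ≤ mass c n v := measureReal_nonneg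

lemma mass_le_one (c : Fin 3 → ℤ) (n : ℕ) (v : ℤ) : mass c n v ≤ 1 := measureReal_le_one

lemma mass_val_ge (c : Fin 3 → ℤ) (n : ℕ) (ω : Code) : (3⁻¹ : ℝ) ^ n ≤ mass c n (val c n ω) := by
  have h : bern.real {ω' | pre n ω' = pre n ω} = (3⁻¹ : ℝ) ^ n := by
    simp [measureReal_def, bern_cylinder]
  rw [← h]
  refine measureReal_mono fun ω' (hω' : pre n ω' = pre n ω) => ?_
  exact isLocal_val c n _ _ fun k hk => congrFun hω' ⟨k, hk⟩

lemma mass_val_pos (c : Fin 3 → ℤ) (n : ℕ) (ω : Code) : 0 < mass c n (val c n ω) :=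
  lt_of_lt_of_le (by positivity) (mass_val_ge c n ω)

lemma bern_real_val_inter (c : Fin 3 → ℤ) (n m : ℕ) (v w : ℤ) :
    bern.real ({ω | val c n ω = v} ∩ {ω | val c m (shift n ω) = w})
      = mass c n v * mass c m w := by
  have h := (isLocal_val c n).indepFun (isLocal_val c m).measurable
  rw [indepFun_iff_measure_inter_preimage_eq_mul] at h
  have h1 := h {v} {w} (measurableSet_singleton v) (measurableSet_singleton w)
  have h2 := (measurePreserving_shift n).measure_preimage
    (measurableSet_val c m w).nullMeasurableSet
  change bern ((fun ω => val c m (shift n ω)) ⁻¹' {w}) = _ at h2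
  rw [h2] at h1
  simp only [mass, measureReal_def]
  rw [← ENNReal.toReal_mul]
  exact congrArg ENNReal.toReal h1

lemma mass_mul_le (c : Fin 3 → ℤ) (n m : ℕ) (v w : ℤ) :
    mass c n v * mass c m w ≤ mass c (n + m) (2 ^ m * v + w) := by
  rw [← bern_real_val_inter]
  refine measureReal_mono ?_
  rintro ω ⟨h1, h2⟩
  simp only [Set.mem_ofPred_eq] at h1 h2 ⊢
  rw [val_add, h1, h2]

lemma mass_add_le {c : Fin 3 → ℤ} {M : ℤ} (hc : ∀ i, 0 ≤ c i) (hM : ∀ i, c i ≤ M) (n m : ℕ)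
    {x y t : ℤ} (hx : 0 ≤ x) (hx' : x ≤ (2 ^ m - 1) * M) (ht : t ∈ Finset.Icc (-M) M) :
    mass c (n + m) (2 ^ m * y + x + t) ≤
      ∑ r ∈ Finset.Icc (-M) M, mass c n (y + r) * mass c m (x + 2 ^ m * (-r) + t) := by
  simp only [← bern_real_val_inter]
  refine (measureReal_mono ?_ (measure_ne_top _ _)).trans (measureReal_biUnion_finset_le _ _)
  intro ω hω
  simp only [Set.mem_ofPred_eq] at hω
  rw [val_add] at hω
  have h0 := val_nonneg hc m (shift n ω)
  have h1 := val_le hM m (shift n ω)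
  rw [Finset.mem_Icc] at ht
  have h2 : (0 : ℤ) < 2 ^ m := by positivity
  simp only [Set.mem_iUnion]
  refine ⟨val c n ω - y, ?_, ?_⟩
  · rw [Finset.mem_Icc]
    constructor
    · refine le_of_mul_le_mul_left ?_ h2
      nlinarith
    · refine le_of_mul_le_mul_left ?_ h2
      nlinarith
  · simp only [Set.mem_inter_iff, Set.mem_ofPred_eq]
    constructor
    · ring
    · linear_combination hω

lemma sum_mass_le_one (c : Fin 3 → ℤ) (n : ℕ) (a : ℤ) (F : Finset ℤ) :
    ∑ v ∈ F, mass c n (v + a) ≤ 1 := by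
  simp only [mass]
  rw [← measureReal_biUnion_finset]
  · exact measureReal_le_one
  · intro v _ w _ hvw
    refine Set.disjoint_left.2 fun ω h1 h2 => hvw ?_
    simp only [Set.mem_ofPred_eq] at h1 h2
    linarith
  · exact fun v _ => measurableSet_val c n _

lemma integral_div_mass_le {c : Fin 3 → ℤ} {M : ℤ} (hc : ∀ i, 0 ≤ c i) (hM : ∀ i, c i ≤ M)
    (n : ℕ) {g : ℤ → ℝ} (hg : ∀ v, 0 ≤ g v) {S : ℝ} (hS : ∀ F : Finset ℤ, ∑ v ∈ F, g v ≤ S) :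
    ∫ ω, g (val c n ω) / mass c n (val c n ω) ∂bern ≤ S := by
  set F := Finset.Icc (0 : ℤ) ((2 ^ n - 1) * M)
  have h : ∀ ω, g (val c n ω) / mass c n (val c n ω) =
      ∑ v ∈ F, {ω | val c n ω = v}.indicator (fun _ => g v / mass c n v) ω := by
    intro ω
    rw [Finset.sum_eq_single_of_mem (val c n ω)
      (Finset.mem_Icc.2 ⟨val_nonneg hc n ω, val_le hM n ω⟩)]
    · simp
    · intro v _ hv
      simp [hv.symm]
  simp only [h]
  rw [integral_finsetSum]
  · refine le_trans (Finset.sum_le_sum fun v _ => ?_) (hS F)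
    rw [integral_indicator_const _ (measurableSet_val c n v)]
    change mass c n v * (g v / mass c n v) ≤ g v
    by_cases h0 : mass c n v = 0
    · simpa [h0] using hg v
    · exact (mul_div_cancel₀ _ h0).le
  · intro v _
    exact (integrable_const _).indicator (measurableSet_val c n v)

/-- The information content of the first `n` digits. -/
def info (c : Fin 3 → ℤ) (n : ℕ) (ω : Code) : ℝ := -Real.log (mass c n (val c n ω))

/-- The total mass near a digit sum, up to carries on both sides. -/
def wideMass (c : Fin 3 → ℤ) (M : ℤ) (n : ℕ) (ω : Code) : ℝ :=
  ∑ s ∈ Finset.Icc (-M) M, ∑ t ∈ Finset.Icc (-M) M, mass c n (val c n ω + 2 ^ n * s + t)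

lemma isLocal_info (c : Fin 3 → ℤ) (n : ℕ) : IsLocal n (info c n) :=
  (isLocal_val c n).comp fun v => -Real.log (mass c n v)

lemma isLocal_wideMass (c : Fin 3 → ℤ) (M : ℤ) (n : ℕ) : IsLocal n (wideMass c M n) :=
  (isLocal_val c n).comp fun v => ∑ s ∈ Finset.Icc (-M) M, ∑ t ∈ Finset.Icc (-M) M,
    mass c n (v + 2 ^ n * s + t)

lemma info_nonneg (c : Fin 3 → ℤ) (n : ℕ) (ω : Code) : 0 ≤ info c n ω :=
  neg_nonneg.2 (Real.log_nonpos (mass_nonneg _ _ _) (mass_le_one _ _ _))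

lemma info_add_le (c : Fin 3 → ℤ) (n m : ℕ) (ω : Code) :
    info c (n + m) ω ≤ info c n ω + info c m (shift n ω) := by
  have h := mass_mul_le c n m (val c n ω) (val c m (shift n ω))
  rw [← val_add] at h
  have h1 := mass_val_pos c n ω
  have h2 := mass_val_pos c m (shift n ω)
  have h3 := Real.log_le_log (mul_pos h1 h2) h
  rw [Real.log_mul h1.ne' h2.ne'] at h3
  simp only [info]
  linarith

lemma sum_near_le_wideMass {c : Fin 3 → ℤ} {M : ℤ} (hM0 : 0 ≤ M) (n : ℕ) (ω : Code) :
    ∑ t ∈ Finset.Icc (-M) M, mass c n (val c n ω + t) ≤ wideMass c M n ω := by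
  have h := Finset.single_le_sum (s := Finset.Icc (-M) M)
    (f := fun s => ∑ t ∈ Finset.Icc (-M) M, mass c n (val c n ω + 2 ^ n * s + t))
    (fun s _ => Finset.sum_nonneg fun t _ => mass_nonneg _ _ _) (a := 0) (by simp [hM0])
  simpa [wideMass] using h

lemma mass_val_le_wideMass {c : Fin 3 → ℤ} {M : ℤ} (hM0 : 0 ≤ M) (n : ℕ) (ω : Code) :
    mass c n (val c n ω) ≤ wideMass c M n ω := by
  refine le_trans ?_ (sum_near_le_wideMass hM0 n ω)
  have h := Finset.single_le_sum (s := Finset.Icc (-M) M)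
    (f := fun t => mass c n (val c n ω + t))
    (fun t _ => mass_nonneg _ _ _) (a := 0) (by simp [hM0])
  simpa using h

lemma wideMass_pos {c : Fin 3 → ℤ} {M : ℤ} (hM0 : 0 ≤ M) (n : ℕ) (ω : Code) :
    0 < wideMass c M n ω := (mass_val_pos c n ω).trans_le (mass_val_le_wideMass hM0 n ω)

lemma wideMass_add_le {c : Fin 3 → ℤ} {M : ℤ} (hc : ∀ i, 0 ≤ c i) (hM : ∀ i, c i ≤ M)
    (n m : ℕ) (ω : Code) :
    wideMass c M (n + m) ω ≤ wideMass c M n ω * wideMass c M m (shift n ω) := by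
  set I := Finset.Icc (-M) M with hI
  set x := val c m (shift n ω)
  set a : ℤ → ℤ → ℝ := fun s r => mass c n (val c n ω + 2 ^ n * s + r)
  set b : ℤ → ℤ → ℝ := fun r t => mass c m (x + 2 ^ m * r + t)
  have ha : ∀ s r, 0 ≤ a s r := fun _ _ => mass_nonneg _ _ _
  have hb : ∀ s r, 0 ≤ b s r := fun _ _ => mass_nonneg _ _ _
  calc wideMass c M (n + m) ω
      ≤ ∑ s ∈ I, ∑ t ∈ I, ∑ r ∈ I, a s r * b (-r) t := by
        refine Finset.sum_le_sum fun s _ => Finset.sum_le_sum fun t ht => ?_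
        have h := mass_add_le hc hM n m (y := val c n ω + 2 ^ n * s)
          (val_nonneg hc m (shift n ω)) (val_le hM m (shift n ω)) ht
        refine le_trans (le_of_eq ?_) h
        congr 1
        rw [val_add, pow_add]; ring
    _ = ∑ s ∈ I, ∑ r ∈ I, a s r * ∑ t ∈ I, b (-r) t := by
        refine Finset.sum_congr rfl fun s _ => ?_
        rw [Finset.sum_comm]
        simp only [Finset.mul_sum]
    _ ≤ ∑ s ∈ I, ∑ r ∈ I, a s r * ∑ r' ∈ I, ∑ t ∈ I, b r' t := by
        refine Finset.sum_le_sum fun s _ => Finset.sum_le_sum fun r hr => ?_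
        refine mul_le_mul_of_nonneg_left ?_ (ha _ _)
        refine Finset.single_le_sum (f := fun r' => ∑ t ∈ I, b r' t)
          (fun _ _ => Finset.sum_nonneg fun _ _ => hb _ _) ?_
        rw [hI, Finset.mem_Icc] at hr ⊢
        omega
    _ = wideMass c M n ω * wideMass c M m (shift n ω) := by
        simp only [← Finset.sum_mul]
        rfl

lemma integral_log_wideMass_le {c : Fin 3 → ℤ} {M : ℤ} (hc : ∀ i, 0 ≤ c i) (hM : ∀ i, c i ≤ M)
    (hM0 : 0 ≤ M) (n : ℕ) :
    ∫ ω, Real.log (wideMass c M n ω) ∂bern ≤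
      -(∫ ω, info c n ω ∂bern) + ∑ _s ∈ Finset.Icc (-M) M, ∑ _t ∈ Finset.Icc (-M) M, (1 : ℝ) := by
  have hloc : ∀ a : ℤ, IsLocal n fun ω => mass c n (val c n ω + a) / mass c n (val c n ω) :=
    fun a => (isLocal_val c n).comp fun v => mass c n (v + a) / mass c n v
  have h1 : ∀ ω, Real.log (wideMass c M n ω) ≤ -info c n ω +
      ∑ s ∈ Finset.Icc (-M) M, ∑ t ∈ Finset.Icc (-M) M,
        mass c n (val c n ω + (2 ^ n * s + t)) / mass c n (val c n ω) := by
    intro ω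
    have hp := mass_val_pos c n ω
    have hw := wideMass_pos (c := c) hM0 n ω
    have h2 := Real.log_le_sub_one_of_pos (div_pos hw hp)
    rw [Real.log_div hw.ne' hp.ne'] at h2
    have h3 : wideMass c M n ω / mass c n (val c n ω) =
      ∑ s ∈ Finset.Icc (-M) M, ∑ t ∈ Finset.Icc (-M) M,
        mass c n (val c n ω + (2 ^ n * s + t)) / mass c n (val c n ω) := by
      simp only [wideMass, Finset.sum_div, add_assoc]
    rw [← h3, info]
    linarith
  have hint : ∀ s ∈ Finset.Icc (-M) M, Integrable (fun ω => ∑ t ∈ Finset.Icc (-M) M,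
      mass c n (val c n ω + (2 ^ n * s + t)) / mass c n (val c n ω)) bern :=
    fun s _ => integrable_finsetSum _ fun t _ => (hloc _).integrable
  have hinfo := (isLocal_info c n).integrable
  refine (integral_mono ((isLocal_wideMass c M n).comp Real.log).integrable
    (hinfo.neg.add (integrable_finsetSum _ hint)) h1).trans ?_
  change ∫ ω, (-info c n ω + ∑ s ∈ Finset.Icc (-M) M, ∑ t ∈ Finset.Icc (-M) M,
    mass c n (val c n ω + (2 ^ n * s + t)) / mass c n (val c n ω)) ∂bern ≤ _
  rw [integral_add (f := fun ω => -info c n ω) hinfo.neg (integrable_finsetSum _ hint), integral_neg,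
    integral_finsetSum _ hint]
  gcongr with s hs
  rw [integral_finsetSum _ fun t _ => (hloc _).integrable]
  gcongr with t ht
  exact integral_div_mass_le hc hM n (g := fun v => mass c n (v + (2 ^ n * s + t)))
    (fun v => mass_nonneg _ _ _) fun F => sum_mass_le_one c n _ F

/-- The entropy of the digit sums. -/
def entropy (c : Fin 3 → ℤ) : ℝ := ⨅ k : ℕ, (∫ ω, info c (k + 1) ω ∂bern) / (k + 1 : ℕ)

lemma entropy_le (c : Fin 3 → ℤ) {n : ℕ} (hn : 0 < n) :
    entropy c ≤ (∫ ω, info c n ω ∂bern) / n := by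
  obtain ⟨k, rfl⟩ := Nat.exists_eq_succ_of_ne_zero hn.ne'
  refine ciInf_le ⟨0, ?_⟩ k
  rintro _ ⟨k, rfl⟩
  exact div_nonneg (integral_nonneg fun ω => info_nonneg _ _ _) (by positivity)

lemma ae_eventually_info_le (c : Fin 3 → ℤ) :
    ∀ᵐ ω ∂bern, ∀ ε > 0, ∀ᶠ n : ℕ in atTop, info c n ω / n ≤ entropy c + ε := by
  have h : ∀ᵐ ω ∂bern, ∀ k : ℕ, ∀ ε > 0, ∀ᶠ n : ℕ in atTop,
      info c n ω / n ≤ (∫ ω, info c (k + 1) ω ∂bern) / (k + 1 : ℕ) + ε :=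
    ae_all_iff.2 fun k => subadditive_limsup_le (isLocal_info c) (info_add_le c) k.succ_pos
  filter_upwards [h] with ω hω ε hε
  obtain ⟨k, hk⟩ := exists_lt_of_ciInf_lt
    (show entropy c < entropy c + ε / 2 by linarith)
  filter_upwards [hω k (ε / 2) (by linarith)] with n hn
  linarith

lemma ae_eventually_log_wideMass_le {c : Fin 3 → ℤ} {M : ℤ} (hc : ∀ i, 0 ≤ c i)
    (hM : ∀ i, c i ≤ M) (hM0 : 0 ≤ M) :
    ∀ᵐ ω ∂bern, ∀ ε > 0, ∀ᶠ n : ℕ in atTop,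
      Real.log (wideMass c M n ω) / n ≤ -entropy c + ε := by
  have h : ∀ᵐ ω ∂bern, ∀ k : ℕ, ∀ ε > 0, ∀ᶠ n : ℕ in atTop, Real.log (wideMass c M n ω) / n ≤
      (∫ ω, Real.log (wideMass c M (k + 1) ω) ∂bern) / (k + 1 : ℕ) + ε := by
    refine ae_all_iff.2 fun k => subadditive_limsup_le
      (f := fun n ω => Real.log (wideMass c M n ω))
      (fun n => (isLocal_wideMass c M n).comp Real.log) (fun n m ω => ?_) k.succ_pos
    rw [← Real.log_mul (wideMass_pos hM0 _ _).ne' (wideMass_pos hM0 _ _).ne']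
    exact Real.log_le_log (wideMass_pos hM0 _ _) (wideMass_add_le hc hM n m ω)
  filter_upwards [h] with ω hω ε hε
  set K : ℝ := ∑ _s ∈ Finset.Icc (-M) M, ∑ _t ∈ Finset.Icc (-M) M, (1 : ℝ)
  have hlim : Tendsto (fun k : ℕ => K / ((k + 1 : ℕ) : ℝ)) atTop (𝓝 0) :=
    (tendsto_const_div_atTop_nhds_zero_nat K).comp (tendsto_add_atTop_nat 1)
  obtain ⟨k, hk⟩ := (hlim.eventually_lt_const (u := ε / 2) (by linarith)).exists
  filter_upwards [hω k (ε / 2) (by linarith)] with n hn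
  have h1 := entropy_le c k.succ_pos
  have h2 := integral_log_wideMass_le hc hM hM0 (k + 1)
  have h3 : (∫ ω, Real.log (wideMass c M (k + 1) ω) ∂bern) / (k + 1 : ℕ) ≤
      -((∫ ω, info c (k + 1) ω ∂bern) / (k + 1 : ℕ)) + K / (k + 1 : ℕ) := by
    rw [← neg_div, ← add_div]
    gcongr
  simp only [Nat.succ_eq_add_one] at h1
  linarith

/-! ### Fourier transform of the law of a random code -/

/-- The Fourier transform of the law of a single digit. -/
def digitFourier (c : Fin 3 → ℤ) (t : ℝ) : ℂ :=
  3⁻¹ * ∑ i, Complex.exp (t * c i * Complex.I)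

/-- The Fourier transform of the law of `code c`. -/
def codeFourier (c : Fin 3 → ℤ) (t : ℝ) : ℂ :=
  ∫ ω, Complex.exp (t * code c ω * Complex.I) ∂bern

lemma norm_exp_mul_mul_I (t x : ℝ) : ‖Complex.exp (t * x * Complex.I)‖ = 1 := by
  rw [← Complex.ofReal_mul, Complex.norm_exp_ofReal_mul_I]

lemma norm_digitFourier_le (c : Fin 3 → ℤ) (t : ℝ) : ‖digitFourier c t‖ ≤ 1 := by
  have h : ∀ i, ‖Complex.exp (t * c i * Complex.I)‖ = 1 := fun i => by
    simpa using norm_exp_mul_mul_I t (c i)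
  rw [digitFourier, norm_mul]
  have h1 := norm_sum_le Finset.univ fun i => Complex.exp (t * c i * Complex.I)
  simp only [h] at h1
  norm_num at h1 ⊢
  linarith

lemma integral_first_letter (f : Fin 3 → ℂ) : ∫ ω : Code, f (ω 0) ∂bern = 3⁻¹ * ∑ i, f i := by
  have h : MeasurePreserving (fun ω : Code => ω 0) bern unif :=
    measurePreserving_eval_infinitePi (fun _ : ℕ => unif) 0
  rw [← integral_map (μ := bern) (φ := fun ω : Code => ω 0) (f := f)
    (measurable_pi_apply 0).aemeasurable (measurable_of_finite f).aestronglyMeasurable, h.map_eq,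
    unif, integral_smul_measure, integral_fintype]
  · simp [Measure.real]
  · exact Integrable.of_finite

lemma codeFourier_eq (c : Fin 3 → ℤ) (t : ℝ) :
    codeFourier c t = digitFourier c (t / 2) * codeFourier c (t / 2) := by
  have hloc : IsLocal 1 fun ω : Code => Complex.exp ((t / 2 : ℝ) * c (ω 0) * Complex.I) :=
    fun ω ω' h => by simp only [h 0 one_pos]
  have hmeas : Measurable fun ω : Code => Complex.exp ((t / 2 : ℝ) * code c ω * Complex.I) := by
    have := measurable_code c
    fun_prop
  have hind := hloc.indepFun hmeas
  have h1 : codeFourier c t = ∫ ω, Complex.exp ((t / 2 : ℝ) * c (ω 0) * Complex.I) *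
      Complex.exp ((t / 2 : ℝ) * code c (shift 1 ω) * Complex.I) ∂bern := by
    refine integral_congr_ae (ae_of_all _ fun ω => ?_)
    simp only
    rw [← Complex.exp_add, code_succ]
    congr 1
    push_cast
    ring
  rw [h1, hind.integral_fun_mul_eq_mul_integral hloc.measurable.aestronglyMeasurable
    (hmeas.comp (measurable_shift 1)).aestronglyMeasurable]
  congr 1
  · rw [integral_first_letter fun i => Complex.exp ((t / 2 : ℝ) * c i * Complex.I), digitFourier]
  · have h := (measurePreserving_shift 1).map_eq
    rw [codeFourier]
    conv_rhs => rw [← h]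
    rw [integral_map (measurable_shift 1).aemeasurable hmeas.aestronglyMeasurable]

lemma continuous_codeFourier (c : Fin 3 → ℤ) : Continuous (codeFourier c) := by
  have hm := measurable_code c
  refine continuous_of_dominated (bound := fun _ => 1) (fun t => ?_) (fun t => ?_)
    (integrable_const _) (ae_of_all _ fun ω => ?_)
  · exact Measurable.aestronglyMeasurable (by fun_prop)
  · exact ae_of_all _ fun ω => (norm_exp_mul_mul_I t _).le
  · fun_prop

lemma codeFourier_zero (c : Fin 3 → ℤ) : codeFourier c 0 = 1 := by simp [codeFourier]

/-- Three complex roots of unity of order a power of two never sum to zero. -/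
lemma add_add_ne_zero_of_pow_eq_one {x y z : ℂ} {j : ℕ} (hx : x ^ 2 ^ j = 1) (hy : y ^ 2 ^ j = 1)
    (hz : z ^ 2 ^ j = 1) : x + y + z ≠ 0 := by
  intro h
  have hn : ∀ w : ℂ, w ^ 2 ^ j = 1 → w * starRingEnd ℂ w = 1 := by
    intro w hw
    have : ‖w‖ = 1 := Complex.norm_eq_one_of_pow_eq_one hw (by positivity)
    rw [Complex.mul_conj, Complex.normSq_eq_norm_sq, this]
    simp
  have hx1 := hn x hx
  have hy1 := hn y hy
  have hz1 := hn z hz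
  have h' : starRingEnd ℂ x + starRingEnd ℂ y + starRingEnd ℂ z = 0 := by
    rw [← map_add, ← map_add, h, map_zero]
  have h2 : x * y + y * z + z * x = 0 := by
    linear_combination x * y * z * h' - y * z * hx1 - x * z * hy1 - x * y * hz1
  have h3 : x ^ 3 = y ^ 3 := by
    linear_combination (x - y) * ((x + y) * h - h2)
  have hy0 : y ≠ 0 := by rintro rfl; simp at hy1
  have h4 : (x / y) ^ 3 = 1 := by rw [div_pow, h3, div_self (pow_ne_zero _ hy0)]
  have h5 : (x / y) ^ 2 ^ j = 1 := by rw [div_pow, hx, hy, div_one]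
  have h6 : orderOf (x / y) ∣ 1 := by
    have hco : Nat.Coprime 3 (2 ^ j) := Nat.Coprime.pow_right j (by norm_num)
    rw [← hco.gcd_eq_one]
    exact Nat.dvd_gcd (orderOf_dvd_of_pow_eq_one h4) (orderOf_dvd_of_pow_eq_one h5)
  rw [Nat.dvd_one, orderOf_eq_one_iff, div_eq_one_iff_eq hy0] at h6
  subst h6
  have h7 : x ^ 2 = 0 := by linear_combination ((2 * x) * h - h2) / 3
  exact hy0 (pow_eq_zero_iff (by norm_num) |>.1 h7)

lemma digitFourier_ne_zero (c : Fin 3 → ℤ) (j : ℕ) :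
    digitFourier c (2 * Real.pi / 2 ^ j) ≠ 0 := by
  have h : ∀ i, Complex.exp ((2 * Real.pi / 2 ^ j : ℝ) * c i * Complex.I) ^ 2 ^ j = 1 := by
    intro i
    rw [← Complex.exp_nat_mul, Complex.exp_eq_one_iff]
    refine ⟨c i, ?_⟩
    push_cast
    field_simp
  have h1 := add_add_ne_zero_of_pow_eq_one (h 0) (h 1) (h 2)
  rw [digitFourier, Fin.sum_univ_three]
  exact mul_ne_zero (by norm_num) h1

lemma tendsto_div_two_pow (C : ℝ) : Tendsto (fun n : ℕ => C / 2 ^ n) atTop (𝓝 0) := by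
  have := (tendsto_pow_atTop_nhds_zero_of_lt_one (r := (2⁻¹ : ℝ)) (by norm_num)
    (by norm_num)).const_mul C
  simpa [div_eq_mul_inv] using this

lemma codeFourier_two_pi_ne_zero (c : Fin 3 → ℤ) : codeFourier c (2 * Real.pi) ≠ 0 := by
  intro h0
  have h : ∀ j : ℕ, codeFourier c (2 * Real.pi / 2 ^ j) = 0 := by
    intro j
    induction j with
    | zero => simpa using h0
    | succ j ih =>
      rw [codeFourier_eq, div_div, ← pow_succ] at ih
      exact (mul_eq_zero.1 ih).resolve_left (digitFourier_ne_zero c _)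
  have hlim : Tendsto (fun j : ℕ => 2 * Real.pi / 2 ^ j) atTop (𝓝 0) :=
    tendsto_div_two_pow _
  have h1 := ((continuous_codeFourier c).tendsto 0).comp hlim
  simp only [Function.comp_def, h, codeFourier_zero] at h1
  exact zero_ne_one (tendsto_nhds_unique tendsto_const_nhds h1)

/-! ### Binary digits of a random code -/

/-- The first `k` binary digits of the fractional part of `code c ω`, as an integer. -/
def block (c : Fin 3 → ℤ) (k : ℕ) (ω : Code) : ℤ := ⌊2 ^ k * code c ω⌋ % 2 ^ k

/-- The law of the first `k` binary digits of the fractional part. -/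
def blockMass (c : Fin 3 → ℤ) (k : ℕ) (u : ℤ) : ℝ := bern.real {ω | block c k ω = u}

lemma measurable_block (c : Fin 3 → ℤ) (k : ℕ) : Measurable (block c k) :=
  (measurable_of_countable (fun z : ℤ => z % 2 ^ k)).comp
    (Int.measurable_floor.comp ((measurable_code c).const_mul _))

lemma measurableSet_block (c : Fin 3 → ℤ) (k : ℕ) (u : ℤ) :
    MeasurableSet {ω | block c k ω = u} := measurable_block c k (measurableSet_singleton u)

lemma block_mem (c : Fin 3 → ℤ) (k : ℕ) (ω : Code) :
    block c k ω ∈ Finset.Ico (0 : ℤ) (2 ^ k) :=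
  Finset.mem_Ico.2 ⟨Int.emod_nonneg _ (by positivity), Int.emod_lt_of_pos _ (by positivity)⟩

lemma blockMass_nonneg (c : Fin 3 → ℤ) (k : ℕ) (u : ℤ) : 0 ≤ blockMass c k u := measureReal_nonneg

lemma integral_comp_block {E : Type*} [NormedAddCommGroup E] [NormedSpace ℝ E] [CompleteSpace E]
    (c : Fin 3 → ℤ) (k : ℕ) (f : ℤ → E) :
    ∫ ω, f (block c k ω) ∂bern = ∑ u ∈ Finset.Ico (0 : ℤ) (2 ^ k), blockMass c k u • f u := by
  have h : ∀ ω, f (block c k ω) = ∑ u ∈ Finset.Ico (0 : ℤ) (2 ^ k),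
      {ω | block c k ω = u}.indicator (fun _ => f u) ω := by
    intro ω
    rw [Finset.sum_eq_single_of_mem _ (block_mem c k ω)]
    · simp
    · intro v _ hv
      simp [hv.symm]
  simp only [h]
  rw [integral_finsetSum]
  · exact Finset.sum_congr rfl fun u _ => integral_indicator_const _ (measurableSet_block c k u)
  · exact fun u _ => (integrable_const _).indicator (measurableSet_block c k u)

lemma sum_blockMass (c : Fin 3 → ℤ) (k : ℕ) :
    ∑ u ∈ Finset.Ico (0 : ℤ) (2 ^ k), blockMass c k u = 1 := by
  simpa using (integral_comp_block c k fun _ => (1 : ℝ)).symm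

lemma exp_block (c : Fin 3 → ℤ) (k : ℕ) (ω : Code) :
    Complex.exp ((2 * Real.pi : ℝ) * (⌊2 ^ k * code c ω⌋ / 2 ^ k : ℝ) * Complex.I) =
      Complex.exp (2 * Real.pi * Complex.I / (2 ^ k : ℕ)) ^ (block c k ω).toNat := by
  have h0 : (((block c k ω).toNat : ℤ)) = block c k ω :=
    Int.toNat_of_nonneg (Finset.mem_Ico.1 (block_mem c k ω)).1
  have h1 : ⌊2 ^ k * code c ω⌋ = block c k ω + 2 ^ k * (⌊2 ^ k * code c ω⌋ / 2 ^ k) :=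
    (Int.emod_add_mul_ediv _ _).symm
  rw [← Complex.exp_nat_mul, Complex.exp_eq_exp_iff_exists_int]
  refine ⟨⌊2 ^ k * code c ω⌋ / 2 ^ k, ?_⟩
  have h2 : ((block c k ω).toNat : ℂ) = block c k ω := by exact_mod_cast h0
  rw [h2]
  have h3 : ((⌊2 ^ k * code c ω⌋ : ℤ) : ℂ) =
      block c k ω + 2 ^ k * (⌊2 ^ k * code c ω⌋ / 2 ^ k : ℤ) := by exact_mod_cast h1
  push_cast
  rw [h3]
  field_simp

/-- Some block of binary digits is not uniformly distributed. -/
lemma exists_blockMass_ne (c : Fin 3 → ℤ) :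
    ∃ k, 0 < k ∧ ∃ u ∈ Finset.Ico (0 : ℤ) (2 ^ k), blockMass c k u ≠ (2 ^ k)⁻¹ := by
  by_contra! h
  refine codeFourier_two_pi_ne_zero c ?_
  have hb : ∀ k : ℕ, 0 < k → ‖codeFourier c (2 * Real.pi)‖ ≤ 2 * Real.pi / 2 ^ k := by
    intro k hk
    set ζ := Complex.exp (2 * Real.pi * Complex.I / (2 ^ k : ℕ)) with hζ
    have hprim : IsPrimitiveRoot ζ (2 ^ k) := Complex.isPrimitiveRoot_exp _ (by positivity)
    have h0 : ∫ ω, ζ ^ (block c k ω).toNat ∂bern = 0 := by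
      rw [integral_comp_block c k fun u => ζ ^ u.toNat]
      rw [Finset.sum_congr rfl fun u hu => by rw [h k hk u hu], ← Finset.smul_sum]
      have : ∑ u ∈ Finset.Ico (0 : ℤ) (2 ^ k), ζ ^ u.toNat = ∑ i ∈ Finset.range (2 ^ k), ζ ^ i := by
        refine Finset.sum_nbij' (fun u => u.toNat) (fun i => (i : ℤ)) ?_ ?_ ?_ ?_ ?_
        · intro u hu
          have := Finset.mem_Ico.1 hu
          rw [Finset.mem_range]
          zify
          omega
        · intro i hi
          have := Finset.mem_range.1 hi
          zify at this
          rw [Finset.mem_Ico]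
          omega
        · intro u hu
          have := Finset.mem_Ico.1 hu
          omega
        · intro i _
          simp
        · intro u _
          rfl
      rw [this, hprim.geom_sum_eq_zero (Nat.one_lt_two_pow hk.ne'), smul_zero]
    have hm := measurable_code c
    have hmb := measurable_block c k
    have hi1 : Integrable (fun ω => Complex.exp ((2 * Real.pi : ℝ) * code c ω * Complex.I)) bern :=
      Integrable.of_bound (Measurable.aestronglyMeasurable (by fun_prop)) 1
        (ae_of_all _ fun ω => (norm_exp_mul_mul_I _ _).le)
    have hi2 : Integrable (fun ω => ζ ^ (block c k ω).toNat) bern := by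
      refine Integrable.of_bound (Measurable.aestronglyMeasurable
        ((measurable_of_countable fun u : ℤ => ζ ^ u.toNat).comp hmb)) 1
        (ae_of_all _ fun ω => ?_)
      rw [norm_pow, Complex.norm_eq_one_of_pow_eq_one hprim.pow_eq_one (by positivity), one_pow]
    have h1 : codeFourier c (2 * Real.pi) = ∫ ω, (Complex.exp ((2 * Real.pi : ℝ) * code c ω *
        Complex.I) - ζ ^ (block c k ω).toNat) ∂bern := by
      rw [integral_sub hi1 hi2, h0, sub_zero, codeFourier]
    rw [h1]
    refine (norm_integral_le_of_norm_le_const (C := 2 * Real.pi / 2 ^ k)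
      (ae_of_all _ fun ω => ?_)).trans (by simp)
    rw [hζ, ← exp_block]
    set a : ℝ := ⌊2 ^ k * code c ω⌋ / 2 ^ k with ha
    have h2 : Complex.exp ((2 * Real.pi : ℝ) * code c ω * Complex.I) -
        Complex.exp ((2 * Real.pi : ℝ) * a * Complex.I) =
        Complex.exp ((2 * Real.pi : ℝ) * a * Complex.I) *
          (Complex.exp (Complex.I * (2 * Real.pi * (code c ω - a) : ℝ)) - 1) := by
      rw [mul_sub, ← Complex.exp_add, mul_one]
      congr 2
      push_cast
      ring
    rw [h2, norm_mul, norm_exp_mul_mul_I, one_mul]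
    refine (Real.norm_exp_I_mul_ofReal_sub_one_le).trans ?_
    have h3 := Int.floor_le (2 ^ k * code c ω)
    have h4 := (Int.lt_floor_add_one (2 ^ k * code c ω)).le
    have hp : (0 : ℝ) < 2 ^ k := by positivity
    have h5 : 0 ≤ code c ω - a := by
      rw [ha, sub_nonneg, div_le_iff₀ hp]; linarith
    have h6 : code c ω - a ≤ 1 / 2 ^ k := by
      rw [ha, sub_le_iff_le_add, ← add_div, le_div_iff₀ hp]; linarith
    rw [Real.norm_of_nonneg (by positivity), mul_div_assoc, div_eq_mul_one_div Real.pi, ← mul_assoc]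
    gcongr
  have hlim : Tendsto (fun k : ℕ => 2 * Real.pi / 2 ^ k) atTop (𝓝 0) :=
    tendsto_div_two_pow _
  have := ge_of_tendsto hlim (eventually_atTop.2 ⟨1, fun k hk => hb k hk⟩)
  exact norm_le_zero_iff.1 this

/-- Gibbs' inequality against the uniform distribution, with strictness. -/
lemma sum_negMulLog_lt {ι : Type*} {s : Finset ι} {N : ℝ} (hN : (s.card : ℝ) = N) (hN0 : 0 < N)
    {f : ι → ℝ} (hf : ∀ i ∈ s, 0 ≤ f i) (hsum : ∑ i ∈ s, f i = 1) (h : ∃ i ∈ s, f i ≠ N⁻¹) :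
    ∑ i ∈ s, f i * -Real.log (f i) < Real.log N := by
  have hle : ∀ i ∈ s, f i ≠ N⁻¹ → f i * -Real.log (f i) < f i * Real.log N + (N⁻¹ - f i) := by
    intro i hi hne
    rcases (hf i hi).eq_or_lt with h0 | h0
    · rw [← h0]; simp [hN0]
    · have h1 : (f i * N)⁻¹ ≠ 1 := by
        intro h1
        rw [inv_eq_one] at h1
        exact hne (eq_inv_of_mul_eq_one_left h1)
      have h2 := Real.log_lt_sub_one_of_pos (by positivity) h1
      rw [Real.log_inv, Real.log_mul h0.ne' hN0.ne'] at h2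
      have h3 := mul_lt_mul_of_pos_left h2 h0
      have h4 : f i * ((f i * N)⁻¹ - 1) = N⁻¹ - f i := by field_simp
      rw [h4] at h3
      linarith
  have hle' : ∀ i ∈ s, f i * -Real.log (f i) ≤ f i * Real.log N + (N⁻¹ - f i) := by
    intro i hi
    by_cases hne : f i = N⁻¹
    · rw [hne, Real.log_inv]; simp
    · exact (hle i hi hne).le
  obtain ⟨i, hi, hne⟩ := h
  refine (Finset.sum_lt_sum hle' ⟨i, hi, hle i hi hne⟩).trans_le ?_
  rw [Finset.sum_add_distrib, ← Finset.sum_mul, Finset.sum_sub_distrib, hsum, Finset.sum_const,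
    nsmul_eq_mul, hN, mul_inv_cancel₀ hN0.ne']
  simp

/-! ### The entropy of the digit sums is less than that of a uniform binary digit -/

/-- The product weight of an integer written in base `2 ^ k`, with leading part in `[0, M]`. -/
def blockWeight (c : Fin 3 → ℤ) (M : ℤ) (k : ℕ) : ℕ → ℤ → ℝ
  | 0, v => if v ∈ Finset.Icc 0 M then 1 else 0
  | n + 1, v => blockWeight c M k n (v / 2 ^ k) * blockMass c k (v % 2 ^ k)

lemma blockWeight_nonneg (c : Fin 3 → ℤ) (M : ℤ) (k n : ℕ) (v : ℤ) :
    0 ≤ blockWeight c M k n v := by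
  induction n generalizing v with
  | zero => rw [blockWeight]; split_ifs <;> norm_num
  | succ n ih => exact mul_nonneg (ih _) (blockMass_nonneg _ _ _)

lemma sum_blockWeight_le (c : Fin 3 → ℤ) (M : ℤ) (k n : ℕ) (F : Finset ℤ) :
    ∑ v ∈ F, blockWeight c M k n v ≤ (Finset.Icc 0 M).card := by
  induction n generalizing F with
  | zero =>
    simp only [blockWeight]
    rw [Finset.sum_ite_mem, Finset.sum_const, nsmul_eq_mul, mul_one]
    exact_mod_cast Finset.card_le_card Finset.inter_subset_right
  | succ n ih =>
    set φ : ℤ → ℤ × ℤ := fun v => (v / 2 ^ k, v % 2 ^ k) with hφ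
    have hinj : Function.Injective φ := by
      intro v w h
      simp only [hφ, Prod.mk.injEq] at h
      rw [← Int.emod_add_mul_ediv v (2 ^ k), ← Int.emod_add_mul_ediv w (2 ^ k), h.1, h.2]
    calc ∑ v ∈ F, blockWeight c M k (n + 1) v
        = ∑ x ∈ F.image φ, blockWeight c M k n x.1 * blockMass c k x.2 := by
          rw [Finset.sum_image hinj.injOn]; rfl
      _ ≤ ∑ x ∈ (F.image fun v => v / 2 ^ k) ×ˢ Finset.Ico (0 : ℤ) (2 ^ k),
            blockWeight c M k n x.1 * blockMass c k x.2 := by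
          refine Finset.sum_le_sum_of_subset_of_nonneg ?_ fun x _ _ =>
            mul_nonneg (blockWeight_nonneg _ _ _ _ _) (blockMass_nonneg _ _ _)
          intro x hx
          obtain ⟨v, hv, rfl⟩ := Finset.mem_image.1 hx
          refine Finset.mem_product.2 ⟨Finset.mem_image_of_mem _ hv, Finset.mem_Ico.2
            ⟨Int.emod_nonneg _ (by positivity), Int.emod_lt_of_pos _ (by positivity)⟩⟩
      _ = ∑ v ∈ F.image fun v => v / 2 ^ k, blockWeight c M k n v := by
          rw [Finset.sum_product]
          simp only [← Finset.mul_sum, sum_blockMass, mul_one]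
      _ ≤ _ := ih _

lemma floor_mul_div_eq (x : ℝ) (k : ℕ) : ⌊2 ^ k * x⌋ / 2 ^ k = ⌊x⌋ := by
  have hp : (0 : ℝ) < 2 ^ k := by positivity
  refine (Int.floor_eq_iff.2 ⟨?_, ?_⟩).symm
  · have h := Int.floor_le (2 ^ k * x)
    have h2 : (2 : ℤ) ^ k * (⌊2 ^ k * x⌋ / 2 ^ k) ≤ ⌊2 ^ k * x⌋ :=
      Int.mul_ediv_self_le (by positivity)
    have h3 : (2 : ℝ) ^ k * (⌊2 ^ k * x⌋ / 2 ^ k : ℤ) ≤ ⌊2 ^ k * x⌋ := by exact_mod_cast h2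
    exact le_of_mul_le_mul_left (h3.trans h) hp
  · have h2 : ⌊2 ^ k * x⌋ < 2 ^ k * (⌊2 ^ k * x⌋ / 2 ^ k + 1) := by
      have := Int.lt_mul_ediv_self_add (x := ⌊2 ^ k * x⌋) (k := (2 : ℤ) ^ k) (by positivity)
      linarith
    have h3 : 2 ^ k * x < (2 ^ k * (⌊2 ^ k * x⌋ / 2 ^ k + 1) : ℤ) := by
      rw [← Int.floor_lt]; exact h2
    push_cast at h3
    exact lt_of_mul_lt_mul_left h3 hp.le

lemma floor_mul_emod_eq (c : Fin 3 → ℤ) (k n : ℕ) (ω : Code) :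
    ⌊2 ^ k * (2 ^ n * code c ω)⌋ % 2 ^ k = block c k (shift n ω) := by
  have h : (2 : ℝ) ^ k * (2 ^ n * code c ω) =
      (2 ^ k * val c n ω : ℤ) + 2 ^ k * code c (shift n ω) := by
    rw [code_shift]; push_cast; ring
  rw [h, Int.floor_intCast_add, Int.mul_add_emod_self_left, block]

lemma blockWeight_floor {c : Fin 3 → ℤ} {M : ℤ} (hc : ∀ i, 0 ≤ c i) (hM : ∀ i, c i ≤ M)
    (k n : ℕ) (ω : Code) :
    blockWeight c M k n ⌊2 ^ (n * k) * code c ω⌋ =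
      ∏ j ∈ Finset.range n, blockMass c k (block c k (shift (j * k) ω)) := by
  induction n with
  | zero =>
    have h1 : 0 ≤ ⌊code c ω⌋ := Int.floor_nonneg.2 (code_nonneg hc ω)
    have h2 : ⌊code c ω⌋ ≤ M := Int.floor_le_iff.2 ((code_le hM ω).trans_lt (by simp))
    simp [blockWeight, h1, h2]
  | succ n ih =>
    rw [Finset.prod_range_succ, ← ih, blockWeight]
    have h : (2 : ℝ) ^ ((n + 1) * k) * code c ω = 2 ^ k * (2 ^ (n * k) * code c ω) := by
      rw [add_mul, one_mul, pow_add]; ring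
    rw [h, floor_mul_div_eq, floor_mul_emod_eq]

lemma ae_blockMass_pos (c : Fin 3 → ℤ) (k : ℕ) :
    ∀ᵐ ω ∂bern, ∀ j : ℕ, 0 < blockMass c k (block c k (shift j ω)) := by
  have h : ∀ᵐ ω ∂bern, 0 < blockMass c k (block c k ω) := by
    have h1 : ∀ u : ℤ, ∀ᵐ ω ∂bern, blockMass c k u = 0 → block c k ω ≠ u := by
      intro u
      by_cases hu : blockMass c k u = 0
      · have : bern {ω | block c k ω = u} = 0 :=
          (measureReal_eq_zero_iff (measure_ne_top _ _)).1 hu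
        filter_upwards [measure_eq_zero_iff_ae_notMem.1 this] with ω hω _
        exact hω
      · exact ae_of_all _ fun ω h => absurd h hu
    filter_upwards [ae_all_iff.2 h1] with ω hω
    exact (blockMass_nonneg _ _ _).lt_of_ne fun h => hω _ h.symm rfl
  exact ae_all_iff.2 fun j => (measurePreserving_shift j).quasiMeasurePreserving.ae h

lemma integral_info_le {c : Fin 3 → ℤ} {M : ℤ} (hc : ∀ i, 0 ≤ c i) (hM : ∀ i, c i ≤ M)
    (k n : ℕ) :
    ∫ ω, info c (n * k) ω ∂bern ≤
      n * ∑ u ∈ Finset.Ico (0 : ℤ) (2 ^ k), blockMass c k u * -Real.log (blockMass c k u) +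
        ∑ _t ∈ Finset.Icc 0 M, ((Finset.Icc 0 M).card : ℝ) := by
  set L := n * k
  set f : Code → ℝ := fun ω => Real.log (blockMass c k (block c k ω)) with hf
  have hfm : Measurable f :=
    (measurable_of_countable fun u : ℤ => Real.log (blockMass c k u)).comp (measurable_block c k)
  have hfi : Integrable f bern := by
    obtain ⟨C, hC⟩ := ((Finset.Ico (0 : ℤ) (2 ^ k)).finite_toSet.image
      fun u => |Real.log (blockMass c k u)|).bddAbove
    exact Integrable.of_bound hfm.aestronglyMeasurable C
      (ae_of_all _ fun ω => hC ⟨_, block_mem c k ω, rfl⟩)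
  have hfj : ∀ j, Integrable (fun ω => f (shift (j * k) ω)) bern := fun j =>
    (measurePreserving_shift (j * k)).integrable_comp_of_integrable hfi
  have hfs : ∀ j, ∫ ω, f (shift (j * k) ω) ∂bern = ∫ ω, f ω ∂bern := by
    intro j
    conv_rhs => rw [← (measurePreserving_shift (j * k)).map_eq]
    rw [integral_map (measurable_shift _).aemeasurable hfm.aestronglyMeasurable]
  have hloc : ∀ t : ℤ, IsLocal L fun ω =>
      blockWeight c M k n (val c L ω + t) / mass c L (val c L ω) :=
    fun t => (isLocal_val c L).comp fun v => blockWeight c M k n (v + t) / mass c L v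
  have hinfo := (isLocal_info c L).integrable
  have key : ∀ᵐ ω ∂bern, info c L ω ≤ -∑ j ∈ Finset.range n, f (shift (j * k) ω) +
      ∑ t ∈ Finset.Icc 0 M, blockWeight c M k n (val c L ω + t) / mass c L (val c L ω) := by
    filter_upwards [ae_blockMass_pos c k] with ω hω
    have h1 := blockWeight_floor hc hM k n ω
    have hprod : 0 < blockWeight c M k n ⌊2 ^ L * code c ω⌋ := by
      rw [h1]; exact Finset.prod_pos fun j _ => hω _
    have hp := mass_val_pos c L ω
    have h2 : Real.log (blockWeight c M k n ⌊2 ^ L * code c ω⌋) =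
        ∑ j ∈ Finset.range n, f (shift (j * k) ω) := by
      rw [h1, Real.log_prod fun j _ => (hω _).ne']
    have h3 := Real.log_le_sub_one_of_pos (div_pos hprod hp)
    rw [Real.log_div hprod.ne' hp.ne', h2] at h3
    have h4 : ⌊2 ^ L * code c ω⌋ = val c L ω + ⌊code c (shift L ω)⌋ := by
      rw [code_shift, Int.floor_intCast_add]
    have h5 : blockWeight c M k n ⌊2 ^ L * code c ω⌋ / mass c L (val c L ω) ≤
        ∑ t ∈ Finset.Icc 0 M, blockWeight c M k n (val c L ω + t) / mass c L (val c L ω) := by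
      rw [h4]
      refine Finset.single_le_sum (f := fun t => blockWeight c M k n (val c L ω + t) /
        mass c L (val c L ω)) (fun t _ => div_nonneg (blockWeight_nonneg _ _ _ _ _) hp.le) ?_
      exact Finset.mem_Icc.2 ⟨Int.floor_nonneg.2 (code_nonneg hc _),
        Int.floor_le_iff.2 ((code_le hM _).trans_lt (by simp))⟩
    rw [info]
    linarith
  have hi1 : Integrable (fun ω => ∑ j ∈ Finset.range n, f (shift (j * k) ω)) bern :=
    integrable_finsetSum _ fun j _ => hfj j
  have hi2 : Integrable (fun ω => ∑ t ∈ Finset.Icc 0 M,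
      blockWeight c M k n (val c L ω + t) / mass c L (val c L ω)) bern :=
    integrable_finsetSum _ fun t _ => (hloc t).integrable
  refine (integral_mono_ae hinfo (hi1.neg.add hi2) key).trans ?_
  change ∫ ω, (-(∑ j ∈ Finset.range n, f (shift (j * k) ω)) + ∑ t ∈ Finset.Icc 0 M,
    blockWeight c M k n (val c L ω + t) / mass c L (val c L ω)) ∂bern ≤ _
  rw [integral_add (f := fun ω => -(∑ j ∈ Finset.range n, f (shift (j * k) ω))) hi1.neg hi2,
    integral_neg, integral_finsetSum _ fun j _ => hfj j,
    integral_finsetSum _ fun t _ => (hloc t).integrable]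
  refine add_le_add (le_of_eq ?_) (Finset.sum_le_sum fun t _ => ?_)
  · simp only [hfs, Finset.sum_const, Finset.card_range, nsmul_eq_mul]
    rw [hf, integral_comp_block c k fun u => Real.log (blockMass c k u)]
    simp only [smul_eq_mul, mul_neg, Finset.sum_neg_distrib]
  · refine integral_div_mass_le hc hM L (g := fun v => blockWeight c M k n (v + t))
      (fun v => blockWeight_nonneg _ _ _ _ _) fun F => ?_
    rw [← Finset.sum_image (f := fun v => blockWeight c M k n v) (g := fun v => v + t)
      (add_left_injective t).injOn]
    exact sum_blockWeight_le _ _ _ _ _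

theorem entropy_lt_log_two {c : Fin 3 → ℤ} {M : ℤ} (hc : ∀ i, 0 ≤ c i) (hM : ∀ i, c i ≤ M) :
    entropy c < Real.log 2 := by
  obtain ⟨k, hk, hne⟩ := exists_blockMass_ne c
  set H := ∑ u ∈ Finset.Ico (0 : ℤ) (2 ^ k), blockMass c k u * -Real.log (blockMass c k u)
  set K := ∑ _t ∈ Finset.Icc 0 M, ((Finset.Icc 0 M).card : ℝ)
  have hH : H < k * Real.log 2 := by
    rw [← Real.log_pow]
    have hcard : ((Finset.Ico (0 : ℤ) (2 ^ k)).card : ℝ) = 2 ^ k := by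
      rw [Int.card_Ico, sub_zero, show (2 : ℤ) ^ k = ((2 ^ k : ℕ) : ℤ) by push_cast; rfl,
        Int.toNat_natCast]
      push_cast; rfl
    exact sum_negMulLog_lt hcard (by positivity) (fun u _ => blockMass_nonneg c k u)
      (sum_blockMass c k) hne
  have hk' : (0 : ℝ) < k := by exact_mod_cast hk
  have hlim : Tendsto (fun n : ℕ => H / k + K / k / (n : ℝ)) atTop (𝓝 (H / k + 0)) :=
    (tendsto_const_div_atTop_nhds_zero_nat (K / k)).const_add _
  have hlt : H / k + 0 < Real.log 2 := by rw [add_zero, div_lt_iff₀ hk']; linarith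
  obtain ⟨n, hn, hn0⟩ := ((hlim.eventually_lt_const hlt).and (eventually_gt_atTop 0)).exists
  have hn' : (0 : ℝ) < n := by exact_mod_cast hn0
  refine lt_of_le_of_lt ((entropy_le c (Nat.mul_pos hn0 hk)).trans ?_) hn
  refine (div_le_div_of_nonneg_right (integral_info_le hc hM k n) (by positivity)).trans
    (le_of_eq ?_)
  change (n * H + K) / (n * k : ℕ) = _
  push_cast
  field_simp

/-! ### Coding of the gasket -/

/-- The digit function counting the symbol `1`. -/
def digitOne : Fin 3 → ℤ := ![0, 1, 0]

/-- The digit function counting the symbol `2`. -/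
def digitTwo : Fin 3 → ℤ := ![0, 0, 1]

lemma digitOne_nonneg (i : Fin 3) : 0 ≤ digitOne i := by fin_cases i <;> simp [digitOne]

lemma digitTwo_nonneg (i : Fin 3) : 0 ≤ digitTwo i := by fin_cases i <;> simp [digitTwo]

lemma digitOne_le (i : Fin 3) : digitOne i ≤ 1 := by fin_cases i <;> simp [digitOne]

lemma digitTwo_le (i : Fin 3) : digitTwo i ≤ 1 := by fin_cases i <;> simp [digitTwo]

/-- The point of the gasket with a given address. -/
def point (ω : Code) : ℝ × ℝ :=
  (code digitOne ω + code digitTwo ω / 2, Real.sqrt 3 / 2 * code digitTwo ω)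

lemma measurable_point : Measurable point := by
  have h1 := measurable_code digitOne
  have h2 := measurable_code digitTwo
  unfold point
  fun_prop

lemma point_eq (ω : Code) : point ω = gasketMap (ω 0) (point (shift 1 ω)) := by
  rw [point, code_succ digitOne, code_succ digitTwo, point]
  generalize ω 0 = i
  fin_cases i <;> simp [gasketMap, digitOne, digitTwo] <;> constructor <;> ring

lemma dist_gasketMap (i : Fin 3) (z w : ℝ × ℝ) :
    dist (gasketMap i z) (gasketMap i w) = dist z w / 2 := by
  have h : ∀ a b c : ℝ, dist (a / 2 + c) (b / 2 + c) = dist a b / 2 := by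
    intro a b c
    rw [dist_add_right, Real.dist_eq, Real.dist_eq, ← sub_div, abs_div, abs_two]
  have h0 : ∀ a b : ℝ, dist (a / 2) (b / 2) = dist a b / 2 := by
    intro a b
    simpa using h a b 0
  have hm : ∀ a b : ℝ, max (a / 2) (b / 2) = max a b / 2 := fun a b =>
    (max_div_div_right (by norm_num) a b)
  fin_cases i <;> simp [gasketMap, Prod.dist_eq, h0, hm]

lemma exists_dist_point_le (z : ℝ × ℝ) : ∃ C, ∀ ω, dist z (point ω) ≤ C := by
  refine ⟨dist z 0 + 2, fun ω => (dist_triangle z 0 _).trans ?_⟩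
  gcongr
  have h1 := code_nonneg digitOne_nonneg ω
  have h2 := code_nonneg digitTwo_nonneg ω
  have h3 := code_le digitOne_le ω
  have h4 := code_le digitTwo_le ω
  have h5 : Real.sqrt 3 ≤ 2 := Real.sqrt_le_iff.2 ⟨by norm_num, by norm_num⟩
  have h6 := Real.sqrt_nonneg 3
  push_cast at h3 h4
  rw [dist_comm, dist_zero_right, Prod.norm_def]
  refine max_le ?_ ?_
  · rw [Real.norm_of_nonneg (by simp only [point]; positivity)]
    simp only [point]; linarith
  · rw [Real.norm_of_nonneg (by simp only [point]; positivity)]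
    simp only [point]; nlinarith

/-- The gasket is the set of points with an address. -/
theorem gasket_eq_range {Δ : Set (ℝ × ℝ)} (hΔ : IsSierpinskiGasket Δ) :
    Δ = Set.range point := by
  obtain ⟨⟨z₀, hz₀⟩, hcomp, heq⟩ := hΔ
  have hmaps : ∀ i, ∀ z ∈ Δ, gasketMap i z ∈ Δ := by
    intro i z hz
    rw [heq]
    fin_cases i
    · exact Or.inl (Or.inl ⟨z, hz, rfl⟩)
    · exact Or.inl (Or.inr ⟨z, hz, rfl⟩)
    · exact Or.inr ⟨z, hz, rfl⟩
  refine Set.Subset.antisymm ?_ ?_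
  · have hpre : ∀ z : Δ, ∃ x : Fin 3 × Δ, (z : ℝ × ℝ) = gasketMap x.1 x.2 := by
      rintro ⟨z, hz⟩
      have hz' := hz
      rw [heq] at hz'
      rcases hz' with (⟨w, hw, h⟩ | ⟨w, hw, h⟩) | ⟨w, hw, h⟩
      · exact ⟨(0, ⟨w, hw⟩), h.symm⟩
      · exact ⟨(1, ⟨w, hw⟩), h.symm⟩
      · exact ⟨(2, ⟨w, hw⟩), h.symm⟩
    choose φ hφ using hpre
    set T : Δ → Δ := fun z => (φ z).2
    intro z hz
    set ω : Code := fun k => (φ (T^[k] ⟨z, hz⟩)).1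
    have hn : ∀ n, dist z (point ω) = dist (T^[n] ⟨z, hz⟩ : ℝ × ℝ) (point (shift n ω)) / 2 ^ n := by
      intro n
      induction n with
      | zero => simp [shift_zero]
      | succ n ih =>
        have h1 : (shift n ω) 0 = (φ (T^[n] ⟨z, hz⟩)).1 := by simp [shift, ω]
        rw [ih, point_eq (shift n ω), h1, hφ (T^[n] ⟨z, hz⟩), dist_gasketMap, shift_shift,
          Function.iterate_succ_apply', div_div, pow_succ, mul_comm (2 ^ n)]
    obtain ⟨R, hR⟩ := hcomp.isBounded.subset_closedBall z₀
    obtain ⟨C, hC⟩ := exists_dist_point_le z₀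
    have hle : ∀ n : ℕ, dist z (point ω) ≤ (R + C) / 2 ^ n := by
      intro n
      rw [hn n]
      gcongr
      exact (dist_triangle _ z₀ _).trans (add_le_add (hR (T^[n] ⟨z, hz⟩).2) (hC _))
    have h0 := ge_of_tendsto' (tendsto_div_two_pow (R + C)) hle
    exact ⟨ω, (dist_le_zero.1 h0).symm⟩
  · rintro _ ⟨ω, rfl⟩
    obtain ⟨C, hC⟩ := exists_dist_point_le z₀
    have h : ∀ n : ℕ, ∀ ω, ∃ z ∈ Δ, dist z (point ω) ≤ C / 2 ^ n := by
      intro n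
      induction n with
      | zero => exact fun ω => ⟨z₀, hz₀, by simpa using hC ω⟩
      | succ n ih =>
        intro ω
        obtain ⟨z, hz, hd⟩ := ih (shift 1 ω)
        refine ⟨_, hmaps (ω 0) z hz, ?_⟩
        rw [point_eq ω, dist_gasketMap, pow_succ, ← div_div]
        gcongr
    choose z hz hd using fun n => h n ω
    have hlim : Tendsto z atTop (𝓝 (point ω)) :=
      tendsto_iff_dist_tendsto_zero.2 (squeeze_zero (fun _ => dist_nonneg) hd
        (tendsto_div_two_pow C))
    exact hcomp.isClosed.mem_of_tendsto hlim (Eventually.of_forall hz)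

/-! ### Projections of the gasket measure -/

/-- The integer digits describing the projection in the direction with
`tan θ = √3 p / (2 q + p)`. -/
def slopeDigits (p q : ℕ) : Fin 3 → ℤ := ![0, 2 * q + p, q + 2 * p]

/-- The scale of the projection in the direction with `tan θ = √3 p / (2 q + p)`. -/
def slopeScale (p q : ℕ) (θ : ℝ) : ℝ := Real.cos θ / (2 * q + p)

lemma slopeDigits_nonneg (p q : ℕ) (i : Fin 3) : 0 ≤ slopeDigits p q i := by
  fin_cases i <;> simp [slopeDigits] <;> positivity

lemma slopeDigits_le (p q : ℕ) (i : Fin 3) : slopeDigits p q i ≤ 2 * p + 2 * q := by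
  fin_cases i <;> simp [slopeDigits] <;> linarith

lemma code_slopeDigits (p q : ℕ) (ω : Code) :
    code (slopeDigits p q) ω = (2 * q + p) * code digitOne ω + (q + 2 * p) * code digitTwo ω := by
  have h := code_combination digitOne digitTwo (2 * q + p) (q + 2 * p) ω
  have h1 : (fun i => ((2 * q + p : ℤ)) * digitOne i + (q + 2 * p) * digitTwo i) =
      slopeDigits p q := by
    funext i
    fin_cases i <;> simp [slopeDigits, digitOne, digitTwo]
  rw [h1] at h
  rw [h]
  push_cast
  ring

lemma measurable_projAngle (θ : ℝ) : Measurable (projAngle θ) := by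
  unfold projAngle
  fun_prop

section Slope

variable {p q : ℕ} {θ : ℝ}

lemma sin_mul_sqrt_three (hq : 0 < q) (hcos : Real.cos θ ≠ 0)
    (hθtan : Real.tan θ = Real.sqrt 3 * p / (2 * q + p)) :
    Real.sqrt 3 * Real.sin θ = 3 * p * slopeScale p q θ := by
  have hq' : (0 : ℝ) < q := by exact_mod_cast hq
  have hp' : (0 : ℝ) ≤ p := p.cast_nonneg
  have hs : Real.sqrt 3 * Real.sqrt 3 = 3 := Real.mul_self_sqrt (by norm_num)
  rw [Real.tan_eq_sin_div_cos, div_eq_div_iff hcos (by positivity)] at hθtan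
  rw [slopeScale, mul_div_assoc', eq_div_iff (by positivity)]
  linear_combination Real.sqrt 3 * hθtan + p * Real.cos θ * hs

lemma cos_eq_slopeScale (hq : 0 < q) :
    Real.cos θ = (2 * q + p) * slopeScale p q θ := by
  have hq' : (0 : ℝ) < q := by exact_mod_cast hq
  have hp' : (0 : ℝ) ≤ p := p.cast_nonneg
  rw [slopeScale]
  field_simp

lemma projAngle_point (hq : 0 < q) (hcos : Real.cos θ ≠ 0)
    (hθtan : Real.tan θ = Real.sqrt 3 * p / (2 * q + p)) (ω : Code) :
    projAngle θ (point ω) = slopeScale p q θ * code (slopeDigits p q) ω := by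
  have h1 := sin_mul_sqrt_three hq hcos hθtan
  have h2 := cos_eq_slopeScale (p := p) (θ := θ) hq
  rw [code_slopeDigits, projAngle, point]
  simp only
  linear_combination code digitTwo ω / 2 * h1 + (code digitOne ω + code digitTwo ω / 2) * h2

lemma projAngle_gasketMap (hq : 0 < q) (hcos : Real.cos θ ≠ 0)
    (hθtan : Real.tan θ = Real.sqrt 3 * p / (2 * q + p)) (i : Fin 3) (z : ℝ × ℝ) :
    projAngle θ (gasketMap i z) =
      slopeScale p q θ * slopeDigits p q i / 2 + projAngle θ z / 2 := by
  have h1 := sin_mul_sqrt_three hq hcos hθtan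
  have h2 := cos_eq_slopeScale (p := p) (θ := θ) hq
  fin_cases i <;> simp [gasketMap, slopeDigits, projAngle]
  · ring
  · linear_combination h2 / 2
  · linear_combination h2 / 4 + h1 / 4

lemma measurable_gasketMap (i : Fin 3) : Measurable (gasketMap i) := by
  fin_cases i <;> simp only [gasketMap] <;> fun_prop

lemma integral_gasketMeasure {Δ : Set (ℝ × ℝ)} {ν : Measure (ℝ × ℝ)}
    (hν : IsGasketMeasure Δ ν) {f : ℝ × ℝ → ℂ} (hf : Measurable f) {C : ℝ}
    (hC : ∀ z, ‖f z‖ ≤ C) :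
    ∫ z, f z ∂ν = 3⁻¹ * ∑ i, ∫ z, f (gasketMap i z) ∂ν := by
  have := hν.1
  have hi : ∀ i, Integrable f (ν.map (gasketMap i)) := fun i => by
    have := Measure.isProbabilityMeasure_map (μ := ν) (measurable_gasketMap i).aemeasurable
    exact Integrable.of_bound hf.aestronglyMeasurable C (ae_of_all _ hC)
  conv_lhs => rw [hν.2.2]
  rw [integral_smul_measure, integral_add_measure ((hi 0).add_measure (hi 1)) (hi 2),
    integral_add_measure (hi 0) (hi 1), Fin.sum_univ_three]
  simp only [integral_map (measurable_gasketMap _).aemeasurable hf.aestronglyMeasurable]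
  simp
  ring

/-- The projection of the gasket measure is the law of a random code. -/
theorem gasketMeasure_map_projAngle {Δ : Set (ℝ × ℝ)} {ν : Measure (ℝ × ℝ)}
    (hν : IsGasketMeasure Δ ν) (hq : 0 < q) (hcos : Real.cos θ ≠ 0)
    (hθtan : Real.tan θ = Real.sqrt 3 * p / (2 * q + p)) :
    ν.map (projAngle θ) = bern.map fun ω => slopeScale p q θ * code (slopeDigits p q) ω := by
  have := hν.1
  set κ := slopeScale p q θ
  set d := slopeDigits p q
  have hpm := measurable_projAngle θ
  have hcm := (measurable_code d).const_mul κ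
  have := Measure.isProbabilityMeasure_map (μ := ν) hpm.aemeasurable
  have := Measure.isProbabilityMeasure_map (μ := bern) hcm.aemeasurable
  have h1 : ∀ t, charFun (ν.map (projAngle θ)) t = digitFourier d (κ * t / 2) *
      charFun (ν.map (projAngle θ)) (t / 2) := by
    intro t
    have hm : ∀ s : ℝ, Measurable fun x : ℝ => Complex.exp (s * x * Complex.I) := fun s => by
      fun_prop
    rw [charFun_apply_real, charFun_apply_real,
      integral_map hpm.aemeasurable (hm _).aestronglyMeasurable,
      integral_map hpm.aemeasurable (hm _).aestronglyMeasurable,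
      integral_gasketMeasure hν (f := fun z => Complex.exp (t * projAngle θ z * Complex.I))
        ((hm t).comp hpm) (fun z => (norm_exp_mul_mul_I t _).le), digitFourier,
      mul_assoc, Finset.sum_mul]
    congr 1
    refine Finset.sum_congr rfl fun i _ => ?_
    rw [← integral_const_mul]
    refine integral_congr_ae (ae_of_all _ fun z => ?_)
    simp only
    rw [projAngle_gasketMap hq hcos hθtan, ← Complex.exp_add]
    congr 1
    push_cast
    ring
  have h2 : ∀ t, charFun (bern.map fun ω => κ * code d ω) t = codeFourier d (κ * t) := by
    intro t
    rw [charFun_apply_real, integral_map hcm.aemeasurable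
      (Measurable.aestronglyMeasurable (by fun_prop)), codeFourier]
    refine integral_congr_ae (ae_of_all _ fun ω => ?_)
    simp only
    congr 1
    push_cast
    ring
  set D : ℝ → ℂ := fun t => charFun (ν.map (projAngle θ)) t - codeFourier d (κ * t) with hD
  have h3 : ∀ t, ‖D t‖ ≤ ‖D (t / 2)‖ := by
    intro t
    have : D t = digitFourier d (κ * t / 2) * D (t / 2) := by
      simp only [hD]
      rw [h1 t, codeFourier_eq, mul_sub, mul_div_assoc]
    rw [this, norm_mul]
    exact mul_le_of_le_one_left (norm_nonneg _) (norm_digitFourier_le _ _)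
  have hDc : Continuous D :=
    continuous_charFun.sub ((continuous_codeFourier d).comp (continuous_const.mul continuous_id))
  refine Measure.ext_of_charFun (funext fun t => ?_)
  rw [h2, ← sub_eq_zero]
  change D t = 0
  have h4 : ∀ n : ℕ, ‖D t‖ ≤ ‖D (t / 2 ^ n)‖ := by
    intro n
    induction n with
    | zero => simp
    | succ n ih =>
      refine ih.trans ?_
      rw [pow_succ, ← div_div]
      exact h3 _
  have h5 := (hDc.norm.tendsto 0).comp (tendsto_div_two_pow t)
  have h6 : D 0 = 0 := by simp [hD, codeFourier_zero]
  rw [h6, norm_zero] at h5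
  exact norm_le_zero_iff.1 (ge_of_tendsto' h5 h4)

end Slope

/-! ### Bounds for box and Hausdorff dimension -/

section Dimension

variable {X : Type*} [MetricSpace X] {E : Set X}

lemma tendsto_log_one_div : Tendsto (fun ε : ℝ => Real.log (1 / ε)) (𝓝[>] 0) atTop := by
  simp only [one_div]
  exact Real.tendsto_log_atTop.comp tendsto_inv_nhdsGT_zero

lemma tendsto_div_log_one_div (c : ℝ) :
    Tendsto (fun ε : ℝ => c / Real.log (1 / ε)) (𝓝[>] 0) (𝓝 0) :=
  tendsto_log_one_div.const_div_atTop c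

lemma coverNum_le {ε : ℝ} {F : Finset X} (hF : E ⊆ ⋃ x ∈ F, ball x ε) : coverNum E ε ≤ F.card :=
  Nat.sInf_le ⟨F, rfl, hF⟩

lemma exists_card_eq_coverNum {ε : ℝ} (h : ∃ F : Finset X, E ⊆ ⋃ x ∈ F, ball x ε) :
    ∃ F : Finset X, F.card = coverNum E ε ∧ E ⊆ ⋃ x ∈ F, ball x ε := by
  obtain ⟨F, hF⟩ := h
  exact Nat.sInf_mem (s := {n : ℕ | ∃ F : Finset X, F.card = n ∧ E ⊆ ⋃ x ∈ F, ball x ε})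
    ⟨F.card, F, rfl, hF⟩

lemma eventually_log_coverNum_le {t C δ : ℝ} (ht : 0 ≤ t) (hC : 0 < C) (hδ : 0 < δ)
    (h : ∀ᶠ ε : ℝ in 𝓝[>] 0, ∃ F : Finset X, (F.card : ℝ) ≤ C * ε ^ (-t) ∧
      E ⊆ ⋃ x ∈ F, ball x ε) :
    ∀ᶠ ε : ℝ in 𝓝[>] 0, Real.log (coverNum E ε) / Real.log (1 / ε) ≤ t + δ := by
  filter_upwards [h, tendsto_log_one_div.eventually_gt_atTop 0,
    (tendsto_div_log_one_div (Real.log C)).eventually_lt_const hδ, self_mem_nhdsWithin]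
    with ε ⟨F, hF, hE⟩ hlog hlt (hε : 0 < ε)
  rcases Nat.eq_zero_or_pos (coverNum E ε) with h0 | h0
  · rw [h0]
    simp only [Nat.cast_zero, Real.log_zero, zero_div]
    positivity
  · have h1 : (coverNum E ε : ℝ) ≤ C * ε ^ (-t) :=
      (Nat.cast_le.2 (coverNum_le hE)).trans hF
    have h2 := Real.log_le_log (by exact_mod_cast h0) h1
    rw [Real.log_mul hC.ne' (by positivity), Real.log_rpow hε] at h2
    rw [div_le_iff₀ hlog]
    rw [div_lt_iff₀ hlog] at hlt
    have h3 : Real.log (1 / ε) = -Real.log ε := by rw [one_div, Real.log_inv]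
    rw [h3] at hlt ⊢
    nlinarith

lemma dimH_le_of_eventually_cover [MeasurableSpace X] [BorelSpace X] {t C : ℝ} (ht : 0 ≤ t)
    (h : ∀ᶠ ε : ℝ in 𝓝[>] 0, ∃ F : Finset X, (F.card : ℝ) ≤ C * ε ^ (-t) ∧
      E ⊆ ⋃ x ∈ F, ball x ε) :
    dimH E ≤ ENNReal.ofReal t := by
  set G : ℝ → Finset X := fun ε => if h : ∃ F : Finset X, (F.card : ℝ) ≤ C * ε ^ (-t) ∧
      E ⊆ ⋃ x ∈ F, ball x ε then h.choose else ∅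
  have hG : ∀ᶠ ε : ℝ in 𝓝[>] 0, ((G ε).card : ℝ) ≤ C * ε ^ (-t) ∧ E ⊆ ⋃ x ∈ G ε, ball x ε := by
    filter_upwards [h] with ε hε
    simp only [G, hε, dite_true]
    exact hε.choose_spec
  have hlim : Tendsto (fun ε : ℝ => 2 * ENNReal.ofReal ε) (𝓝[>] 0) (𝓝 0) := by
    have h1 : Tendsto (fun ε : ℝ => ENNReal.ofReal ε) (𝓝[>] 0) (𝓝 (ENNReal.ofReal 0)) :=
      (ENNReal.continuous_ofReal.tendsto 0).mono_left nhdsWithin_le_nhds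
    have h2 := ENNReal.Tendsto.const_mul (a := 2) h1 (Or.inr ENNReal.ofNat_ne_top)
    simpa using h2
  have hdiam : ∀ (ε : ℝ) (x : X), ediam (ball x ε) ≤ 2 * ENNReal.ofReal ε := by
    intro ε x
    rw [← Metric.eball_ofReal]
    exact ediam_eball_le
  have hμ := Measure.hausdorffMeasure_le_liminf_sum (ι := fun ε : ℝ => G ε) t E
    (fun ε : ℝ => 2 * ENNReal.ofReal ε) hlim (fun ε x => ball (x : X) ε)
    (Eventually.of_forall fun ε x => hdiam ε x)
    (by
      filter_upwards [hG] with ε hε z hz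
      obtain ⟨x, hx, hzx⟩ := Set.mem_iUnion₂.1 (hε.2 hz)
      exact Set.mem_iUnion.2 ⟨⟨x, hx⟩, hzx⟩)
  have hfin : μH[t] E ≤ ENNReal.ofReal (C * 2 ^ t) := by
    refine hμ.trans (liminf_le_of_frequently_le' (Eventually.frequently ?_))
    filter_upwards [hG, self_mem_nhdsWithin] with ε hε (hε0 : 0 < ε)
    calc ∑ x : G ε, ediam (ball (x : X) ε) ^ t
        ≤ ∑ _x : G ε, (ENNReal.ofReal (2 * ε)) ^ t := by
          gcongr with x
          refine (hdiam ε x).trans (le_of_eq ?_)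
          rw [ENNReal.ofReal_mul (by norm_num), ENNReal.ofReal_ofNat]
      _ = ENNReal.ofReal ((G ε).card * (2 * ε) ^ t) := by
          rw [Finset.sum_const, ENNReal.ofReal_rpow_of_pos (show 0 < 2 * ε by linarith), nsmul_eq_mul,
            ENNReal.ofReal_mul (Nat.cast_nonneg _), ENNReal.ofReal_natCast]
          simp
      _ ≤ ENNReal.ofReal (C * ε ^ (-t) * (2 * ε) ^ t) := by
          gcongr
          exact hε.1
      _ = ENNReal.ofReal (C * 2 ^ t) := by
          rw [Real.mul_rpow (by norm_num) hε0.le, Real.rpow_neg hε0.le]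
          congr 1
          have hne : ε ^ t ≠ 0 := (Real.rpow_pos_of_pos hε0 t).ne'
          rw [mul_mul_mul_comm, inv_mul_cancel₀ hne, mul_one]
  exact dimH_le_of_hausdorffMeasure_ne_top (d := t.toNNReal)
    (by rw [Real.coe_toNNReal t ht]; exact ne_top_of_le_ne_top ENNReal.ofReal_ne_top hfin)

variable [MeasurableSpace X] {m : Measure X} {t C r₀ : ℝ}

/-- The mass distribution principle for Hausdorff dimension. -/
lemma le_dimH_of_measure_le [BorelSpace X] (ht : 0 < t) (hC : 0 < C) (hr₀ : 0 < r₀) (hE : m E ≠ 0)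
    (h : ∀ r, 0 < r → r ≤ r₀ → ∀ U, ediam U ≤ ENNReal.ofReal r →
      m U ≤ ENNReal.ofReal (C * r ^ t)) :
    ENNReal.ofReal t ≤ dimH E := by
  have hle : (ENNReal.ofReal C)⁻¹ • m ≤ μH[t] := by
    refine Measure.le_hausdorffMeasure t _ (ENNReal.ofReal r₀) (by simpa using hr₀) fun s hs => ?_
    have hCtop : ENNReal.ofReal C ≠ 0 := by simpa using hC
    have hbound : m s ≤ ENNReal.ofReal C * ediam s ^ t := by
      by_cases h0 : ediam s = 0
      · have hlim : Tendsto (fun r : ℝ => ENNReal.ofReal (C * r ^ t)) (𝓝[>] 0) (𝓝 0) := by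
          have h1 : Tendsto (fun r : ℝ => ENNReal.ofReal (C * r ^ t)) (𝓝[>] 0)
              (𝓝 (ENNReal.ofReal (C * 0 ^ t))) :=
            ((ENNReal.continuous_ofReal.comp
              (continuous_const.mul (Real.continuous_rpow_const ht.le))).tendsto 0).mono_left
                nhdsWithin_le_nhds
          simpa [Real.zero_rpow ht.ne'] using h1
        have h2 : m s ≤ 0 := by
          refine ge_of_tendsto hlim ?_
          filter_upwards [Ioc_mem_nhdsGT hr₀] with r hr
          exact h r hr.1 hr.2 s (by rw [h0]; exact zero_le)
        exact h2.trans zero_le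
      · have htop : ediam s ≠ ⊤ := ne_top_of_le_ne_top ENNReal.ofReal_ne_top hs
        have hpos : 0 < (ediam s).toReal := ENNReal.toReal_pos h0 htop
        have h1 := h (ediam s).toReal hpos (ENNReal.toReal_le_of_le_ofReal hr₀.le hs) s
          (ENNReal.ofReal_toReal htop).ge
        rwa [ENNReal.ofReal_mul hC.le, ← ENNReal.ofReal_rpow_of_pos hpos,
          ENNReal.ofReal_toReal htop] at h1
    rw [Measure.smul_apply, smul_eq_mul]
    calc (ENNReal.ofReal C)⁻¹ * m s ≤ (ENNReal.ofReal C)⁻¹ * (ENNReal.ofReal C * ediam s ^ t) := by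
          gcongr
      _ = ediam s ^ t := by
          rw [← mul_assoc, ENNReal.inv_mul_cancel hCtop ENNReal.ofReal_ne_top, one_mul]
  refine le_dimH_of_hausdorffMeasure_ne_zero (d := t.toNNReal) ?_
  rw [Real.coe_toNNReal t ht.le]
  intro h0
  have h1 := hle E
  rw [h0, Measure.smul_apply, smul_eq_mul, nonpos_iff_eq_zero, mul_eq_zero] at h1
  rcases h1 with h1 | h1
  · exact ENNReal.ofReal_ne_top (ENNReal.inv_eq_zero.1 h1)
  · exact hE h1

/-- The mass distribution principle for covering numbers. -/
lemma eventually_le_log_coverNum [IsFiniteMeasure m] {δ : ℝ} (hC : 0 < C) (hr₀ : 0 < r₀)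
    (hδ : 0 < δ) (hE : m E ≠ 0)
    (hcov : ∀ ε > 0, ∃ F : Finset X, E ⊆ ⋃ x ∈ F, ball x ε)
    (h : ∀ r, 0 < r → r ≤ r₀ → ∀ U, ediam U ≤ ENNReal.ofReal r →
      m U ≤ ENNReal.ofReal (C * r ^ t)) :
    ∀ᶠ ε : ℝ in 𝓝[>] 0, t - δ ≤ Real.log (coverNum E ε) / Real.log (1 / ε) := by
  have hpos : 0 < m.real E := ENNReal.toReal_pos hE (measure_ne_top _ _)
  set K := m.real E / (C * 2 ^ t) with hK
  have hK0 : 0 < K := by positivity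
  filter_upwards [tendsto_log_one_div.eventually_gt_atTop 0,
    (tendsto_div_log_one_div (Real.log K)).eventually_const_lt (neg_lt_zero.2 hδ),
    Ioc_mem_nhdsGT (show 0 < r₀ / 2 by positivity)] with ε hlog hlt hε
  obtain ⟨F, hF, hEF⟩ := exists_card_eq_coverNum (hcov ε hε.1)
  have h1 : m.real E ≤ coverNum E ε * (C * (2 * ε) ^ t) := by
    refine (measureReal_mono hEF (measure_ne_top _ _)).trans
      ((measureReal_biUnion_finset_le _ _).trans ?_)
    rw [← hF, ← nsmul_eq_mul]
    refine Finset.sum_le_card_nsmul _ _ _ fun x _ => ?_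
    refine ENNReal.toReal_le_of_le_ofReal (by have := hε.1; positivity)
      (h (2 * ε) (by linarith [hε.1]) (by linarith [hε.2]) _ ?_)
    rw [← Metric.eball_ofReal, ENNReal.ofReal_mul (by norm_num), ENNReal.ofReal_ofNat]
    exact ediam_eball_le
  have h2 : K * ε ^ (-t) ≤ coverNum E ε := by
    rw [Real.mul_rpow (by norm_num) hε.1.le] at h1
    rw [hK, Real.rpow_neg hε.1.le, ← div_eq_mul_inv, div_div,
      div_le_iff₀ (by have := hε.1; positivity)]
    linarith
  have hε0 : 0 < ε := hε.1
  have h3 := Real.log_le_log (by positivity) h2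
  rw [Real.log_mul hK0.ne' (by positivity), Real.log_rpow hε.1] at h3
  rw [le_div_iff₀ hlog]
  rw [lt_div_iff₀ hlog] at hlt
  have h4 : Real.log (1 / ε) = -Real.log ε := by rw [one_div, Real.log_inv]
  rw [h4] at hlt ⊢
  nlinarith

end Dimension

/-! ### Cylinders and Euclidean geometry -/

lemma eq_of_val_eq {n : ℕ} {ω ω' : Code} (h1 : val digitOne n ω = val digitOne n ω')
    (h2 : val digitTwo n ω = val digitTwo n ω') : pre n ω = pre n ω' := by
  suffices h : ∀ k < n, ω k = ω' k from funext fun k => h k k.2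
  induction n with
  | zero => exact fun k hk => absurd hk (Nat.not_lt_zero k)
  | succ n ih =>
    simp only [val] at h1 h2
    have a1 := digitOne_nonneg (ω n)
    have a2 := digitOne_le (ω n)
    have a3 := digitOne_nonneg (ω' n)
    have a4 := digitOne_le (ω' n)
    have b1 := digitTwo_nonneg (ω n)
    have b2 := digitTwo_le (ω n)
    have b3 := digitTwo_nonneg (ω' n)
    have b4 := digitTwo_le (ω' n)
    have h3 : digitOne (ω n) = digitOne (ω' n) := by omega
    have h4 : digitTwo (ω n) = digitTwo (ω' n) := by omega
    have h5 : ω n = ω' n := by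
      revert h3 h4
      generalize ω n = i
      generalize ω' n = j
      fin_cases i <;> fin_cases j <;> simp [digitOne, digitTwo]
    intro k hk
    rcases Nat.lt_succ_iff_lt_or_eq.1 hk with hk | rfl
    · exact ih (by omega) (by omega) k hk
    · exact h5

lemma abs_code_sub_le {c : Fin 3 → ℤ} (h0 : ∀ i, 0 ≤ c i) (h1 : ∀ i, c i ≤ 1) {n : ℕ}
    {ω ω' : Code} (h : pre n ω = pre n ω') : |code c ω - code c ω'| ≤ 1 / 2 ^ n := by
  have hv : val c n ω = val c n ω' := isLocal_val c n _ _ fun k hk => congrFun h ⟨k, hk⟩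
  have e1 := code_shift c n ω
  have e2 := code_shift c n ω'
  have a1 := code_nonneg h0 (shift n ω)
  have a2 := code_le h1 (shift n ω)
  have b1 := code_nonneg h0 (shift n ω')
  have b2 := code_le h1 (shift n ω')
  rw [hv] at e1
  push_cast at a2 b2
  rw [le_div_iff₀ (by positivity), ← abs_of_pos (show (0 : ℝ) < 2 ^ n by positivity), ← abs_mul,
    abs_le]
  constructor <;> linarith

lemma dist_point_le {n : ℕ} {ω ω' : Code} (h : pre n ω = pre n ω') :
    dist (point ω) (point ω') ≤ 2 / 2 ^ n := by
  have h1 := abs_le.1 (abs_code_sub_le digitOne_nonneg digitOne_le h)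
  have h2 := abs_le.1 (abs_code_sub_le digitTwo_nonneg digitTwo_le h)
  have h5 : Real.sqrt 3 ≤ 2 := Real.sqrt_le_iff.2 ⟨by norm_num, by norm_num⟩
  have h6 := Real.sqrt_nonneg 3
  have h7 : (2 : ℝ) / 2 ^ n = 2 * (1 / 2 ^ n) := by ring
  have h8 : (0 : ℝ) < 1 / 2 ^ n := by positivity
  rw [Prod.dist_eq, h7]
  refine max_le ?_ ?_
  · simp only [point, Real.dist_eq]
    rw [abs_le]
    constructor <;> linarith
  · simp only [point, Real.dist_eq]
    rw [← mul_sub, abs_mul, abs_of_nonneg (by positivity)]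
    have := abs_le.2 h2
    have h9 := abs_nonneg (code digitTwo ω - code digitTwo ω')
    nlinarith

lemma abs_val_sub_le {c : Fin 3 → ℤ} {M : ℤ} (h0 : ∀ i, 0 ≤ c i) (hM : ∀ i, c i ≤ M) {n : ℕ}
    {ω ω' : Code} {K : ℤ} (h : |code c ω - code c ω'| ≤ K / 2 ^ n) :
    |val c n ω - val c n ω'| ≤ K + M := by
  have e1 := code_shift c n ω
  have e2 := code_shift c n ω'
  have a1 := code_nonneg h0 (shift n ω)
  have a2 := code_le hM (shift n ω)
  have b1 := code_nonneg h0 (shift n ω')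
  have b2 := code_le hM (shift n ω')
  rw [le_div_iff₀ (by positivity), ← abs_of_pos (show (0 : ℝ) < 2 ^ n by positivity), ← abs_mul,
    abs_le] at h
  have h2 : |(val c n ω : ℝ) - val c n ω'| ≤ K + M := by
    rw [abs_le]
    constructor <;> linarith
  exact_mod_cast h2

/-- A set of diameter at most `2 ^ (-n)` meets boundedly many cylinders of length `n`. -/
lemma measure_inter_point_preimage_le (m : Measure Code) {F : Set Code} {b : ℝ≥0∞} {n : ℕ}
    (hF : ∀ ω ∈ F, m {ω' | pre n ω' = pre n ω} ≤ b) {U : Set (ℝ × ℝ)}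
    (hU : ediam U ≤ ENNReal.ofReal (1 / 2 ^ n)) : m (F ∩ point ⁻¹' U) ≤ 49 * b := by
  rcases (F ∩ point ⁻¹' U).eq_empty_or_nonempty with h0 | ⟨ω₀, hω₀⟩
  · simp [h0]
  set x := val digitOne n ω₀
  set y := val digitTwo n ω₀
  set B := Finset.Icc (x - 3) (x + 3) ×ˢ Finset.Icc (y - 3) (y + 3) with hB
  have hcard : B.card = 49 := by
    rw [hB, Finset.card_product, Int.card_Icc, Int.card_Icc,
      show x + 3 + 1 - (x - 3) = 7 by ring, show y + 3 + 1 - (y - 3) = 7 by ring]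
    rfl
  have hsub : F ∩ point ⁻¹' U ⊆ ⋃ z ∈ B,
      (F ∩ {ω | val digitOne n ω = z.1 ∧ val digitTwo n ω = z.2}) := by
    intro ω hω
    have hd : dist (point ω) (point ω₀) ≤ 1 / 2 ^ n := by
      have := (edist_le_ediam_of_mem (show point ω ∈ U from hω.2)
        (show point ω₀ ∈ U from hω₀.2)).trans hU
      rwa [edist_dist, ENNReal.ofReal_le_ofReal_iff (by positivity)] at this
    rw [Prod.dist_eq, max_le_iff, Real.dist_eq, Real.dist_eq] at hd
    simp only [point] at hd
    have h5 : (1 : ℝ) ≤ Real.sqrt 3 := Real.one_le_sqrt.2 (by norm_num)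
    have h1 : |code digitTwo ω - code digitTwo ω₀| ≤ (2 : ℤ) / 2 ^ n := by
      have h2 := hd.2
      rw [← mul_sub, abs_mul, abs_of_nonneg (by positivity)] at h2
      have h9 := abs_nonneg (code digitTwo ω - code digitTwo ω₀)
      have h7 : ((2 : ℤ) : ℝ) / 2 ^ n = 2 * (1 / 2 ^ n) := by push_cast; ring
      rw [h7]
      nlinarith
    have h2 : |code digitOne ω - code digitOne ω₀| ≤ (2 : ℤ) / 2 ^ n := by
      have h7 : ((2 : ℤ) : ℝ) / 2 ^ n = 2 * (1 / 2 ^ n) := by push_cast; ring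
      rw [h7, abs_le] at h1 ⊢
      have h3 := abs_le.1 hd.1
      constructor <;> linarith
    have h3 := abs_le.1 (abs_val_sub_le digitOne_nonneg digitOne_le h2)
    have h4 := abs_le.1 (abs_val_sub_le digitTwo_nonneg digitTwo_le h1)
    refine Set.mem_iUnion₂.2 ⟨(val digitOne n ω, val digitTwo n ω), ?_, hω.1, rfl, rfl⟩
    rw [hB, Finset.mem_product, Finset.mem_Icc, Finset.mem_Icc]
    simp only [x, y]
    refine ⟨⟨?_, ?_⟩, ?_, ?_⟩ <;> linarith
  refine (measure_mono hsub).trans ((measure_biUnion_finset_le _ _).trans ?_)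
  have hz : ∀ z ∈ B, m (F ∩ {ω | val digitOne n ω = z.1 ∧ val digitTwo n ω = z.2}) ≤ b := by
    intro z _
    rcases (F ∩ {ω | val digitOne n ω = z.1 ∧ val digitTwo n ω = z.2}).eq_empty_or_nonempty
      with h | ⟨ω₁, h₁, h₂⟩
    · simp [h]
    · refine (measure_mono ?_).trans (hF ω₁ h₁)
      rintro ω ⟨_, h⟩
      exact eq_of_val_eq (h.1.trans h₂.1.symm) (h.2.trans h₂.2.symm)
  refine (Finset.sum_le_card_nsmul _ _ _ hz).trans ?_
  rw [hcard, nsmul_eq_mul]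
  norm_num

/-- The words of length `n` with a given digit sum. -/
def wordsOfVal (c : Fin 3 → ℤ) (n : ℕ) (v : ℤ) : Finset (Fin n → Fin 3) :=
  Finset.univ.filter fun w => val c n (extendWord w) = v

lemma val_extendWord_pre (c : Fin 3 → ℤ) (n : ℕ) (ω : Code) :
    val c n (extendWord (pre n ω)) = val c n ω :=
  isLocal_val c n _ _ fun k hk => by rw [extendWord_of_lt _ hk, pre]

lemma card_wordsOfVal (c : Fin 3 → ℤ) (n : ℕ) (v : ℤ) :
    ((wordsOfVal c n v).card : ℝ) = 3 ^ n * mass c n v := by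
  have h : {ω | val c n ω = v} = ⋃ w ∈ wordsOfVal c n v, {ω | pre n ω = w} := by
    ext ω
    simp [wordsOfVal, val_extendWord_pre]
  have hm : ∀ w : Fin n → Fin 3, bern.real {ω | pre n ω = w} = (3 ^ n : ℝ)⁻¹ := fun w => by
    simp [measureReal_def, bern_cylinder]
  rw [mass, h, measureReal_biUnion_finset]
  · simp only [hm, Finset.sum_const, nsmul_eq_mul]
    field_simp
  · intro w _ w' _ hne
    exact Set.disjoint_left.2 fun ω (h1 : _ = _) (h2 : _ = _) => hne (h1.symm.trans h2)
  · exact fun w _ => measurable_pre n (measurableSet_singleton w)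

/-- A fibre of `code c` is covered by few sets of diameter of order `2 ^ (-n)`. -/
lemma exists_cover_fiber {c : Fin 3 → ℤ} {M : ℤ} (hc : ∀ i, 0 ≤ c i) (hM : ∀ i, c i ≤ M)
    (hM0 : 0 ≤ M) (n : ℕ) (ω₀ : Code) {r : ℝ} (hr : 2 / 2 ^ n < r) :
    ∃ F : Finset (ℝ × ℝ), (F.card : ℝ) ≤ 3 ^ n * wideMass c M n ω₀ ∧
      point '' {ω | code c ω = code c ω₀} ⊆ ⋃ x ∈ F, ball x r := by
  set W := (Finset.Icc (-M) M).biUnion fun t => wordsOfVal c n (val c n ω₀ + t)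
  refine ⟨W.image fun w => point (extendWord w), ?_, ?_⟩
  · calc ((W.image fun w => point (extendWord w)).card : ℝ) ≤ W.card := by
          exact_mod_cast Finset.card_image_le
      _ ≤ ∑ t ∈ Finset.Icc (-M) M, ((wordsOfVal c n (val c n ω₀ + t)).card : ℝ) := by
          exact_mod_cast Finset.card_biUnion_le
      _ = 3 ^ n * ∑ t ∈ Finset.Icc (-M) M, mass c n (val c n ω₀ + t) := by
          simp only [card_wordsOfVal, Finset.mul_sum]
      _ ≤ 3 ^ n * wideMass c M n ω₀ := by
          gcongr
          exact sum_near_le_wideMass hM0 n ω₀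
  · rintro _ ⟨ω, hω : code c ω = code c ω₀, rfl⟩
    have h1 : |code c ω - code c ω₀| ≤ (0 : ℤ) / 2 ^ n := by simp [hω]
    have h2 := abs_le.1 (abs_val_sub_le hc hM h1)
    refine Set.mem_iUnion₂.2 ⟨point (extendWord (pre n ω)),
      Finset.mem_image_of_mem _ (Finset.mem_biUnion.2 ⟨val c n ω - val c n ω₀, ?_, ?_⟩), ?_⟩
    · rw [Finset.mem_Icc]
      constructor <;> linarith
    · simp [wordsOfVal, val_extendWord_pre]
    · exact (dist_point_le (pre_extendWord _).symm).trans_lt hr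

/-! ### Conditional measures on the fibres -/

lemma bern_code_inter_eq (c : Fin 3 → ℤ) {n : ℕ} {w w' : Fin n → Fin 3}
    (h : val c n (extendWord w) = val c n (extendWord w')) {A : Set ℝ} (hA : MeasurableSet A) :
    bern (code c ⁻¹' A ∩ {ω | pre n ω = w}) = bern (code c ⁻¹' A ∩ {ω | pre n ω = w'}) := by
  have key : ∀ u : Fin n → Fin 3, bern (code c ⁻¹' A ∩ {ω | pre n ω = u}) = 3⁻¹ ^ n *
      bern ((fun ω => (val c n (extendWord u) + code c ω) / 2 ^ n) ⁻¹' A) := by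
    intro u
    have hm := measurable_code c
    have hB : MeasurableSet ((fun ω => (val c n (extendWord u) + code c ω) / 2 ^ n) ⁻¹' A) := by
      have : Measurable fun ω => (val c n (extendWord u) + code c ω) / 2 ^ n := by fun_prop
      exact this hA
    have hset : code c ⁻¹' A ∩ {ω | pre n ω = u} = pre n ⁻¹' {u} ∩
        shift n ⁻¹' ((fun ω => (val c n (extendWord u) + code c ω) / 2 ^ n) ⁻¹' A) := by
      ext ω
      simp only [Set.mem_inter_iff, Set.mem_preimage, Set.mem_ofPred_eq, Set.mem_singleton_iff]
      rw [and_comm]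
      refine and_congr_right fun hu => ?_
      rw [← hu, val_extendWord_pre, ← code_shift, mul_div_cancel_left₀ _ (by positivity)]
    have hind := indepFun_pre_shift n
    rw [indepFun_iff_measure_inter_preimage_eq_mul] at hind
    rw [hset, hind _ _ (measurableSet_singleton u) hB,
      (measurePreserving_shift n).measure_preimage hB.nullMeasurableSet]
    congr 1
    exact bern_cylinder u
  rw [key w, key w', h]

/-- Almost every fibre of `code c` carries a measure whose cylinder masses are controlled by the
distribution of the digit sums. -/
theorem ae_exists_fiber_measure (c : Fin 3 → ℤ) {P : Code → Prop} (hP : ∀ᵐ ω ∂bern, P ω) :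
    ∀ᵐ a ∂bern.map (code c), ∃ m : Measure Code, IsProbabilityMeasure m ∧
      (∀ᵐ ω ∂m, code c ω = a ∧ P ω) ∧
      ∀ n ω, m.real {ω' | pre n ω' = pre n ω} * (3 ^ n * mass c n (val c n ω)) ≤ 1 := by
  have hm := measurable_code c
  have hpair : Measurable fun ω : Code => (code c ω, ω) := hm.prodMk measurable_id
  set ρ : Measure (ℝ × Code) := bern.map fun ω => (code c ω, ω) with hρ
  have : IsProbabilityMeasure ρ := Measure.isProbabilityMeasure_map hpair.aemeasurable
  have hfst : ρ.fst = bern.map (code c) := by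
    rw [Measure.fst, hρ, Measure.map_map measurable_fst hpair]
    rfl
  have hdis : ρ.fst ⊗ₘ ρ.condKernel = ρ := ρ.disintegrate ρ.condKernel
  have h1 : ∀ᵐ a ∂bern.map (code c), ∀ᵐ ω ∂ρ.condKernel a, code c ω = a ∧ P ω := by
    rw [← hfst]
    have h : ∀ᵐ x ∂ρ, code c x.2 = x.1 ∧ P x.2 := by
      refine Filter.Eventually.and ?_ ?_
      · have hms : MeasurableSet {x : ℝ × Code | code c x.2 = x.1} :=
          measurableSet_eq_fun (hm.comp measurable_snd) measurable_fst
        rw [hρ]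
        exact (ae_map_iff hpair.aemeasurable hms).2 (ae_of_all _ fun ω => rfl)
      · have hq : Measure.QuasiMeasurePreserving (Prod.snd : ℝ × Code → Code) ρ bern := by
          refine ⟨measurable_snd, ?_⟩
          rw [hρ, Measure.map_map measurable_snd hpair]
          exact (Measure.map_id (μ := bern)).le.absolutelyContinuous
        exact hq.ae hP
    rw [← hdis] at h
    exact Measure.ae_ae_of_ae_compProd h
  have hcyl : ∀ (n : ℕ) (w : Fin n → Fin 3), MeasurableSet {ω : Code | pre n ω = w} :=
    fun n w => measurable_pre n (measurableSet_singleton w)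
  have hint : ∀ (n : ℕ) (w : Fin n → Fin 3) (A : Set ℝ), MeasurableSet A →
      ∫⁻ a in A, ρ.condKernel a {ω | pre n ω = w} ∂ρ.fst =
        bern (code c ⁻¹' A ∩ {ω | pre n ω = w}) := by
    intro n w A hA
    rw [← Measure.compProd_apply_prod hA (hcyl n w), hdis, hρ,
      Measure.map_apply hpair (hA.prod (hcyl n w))]
    rfl
  have h2 : ∀ᵐ a ∂bern.map (code c), ∀ (n : ℕ) (w w' : Fin n → Fin 3),
      val c n (extendWord w) = val c n (extendWord w') →
      ρ.condKernel a {ω | pre n ω = w} = ρ.condKernel a {ω | pre n ω = w'} := by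
    rw [← hfst]
    refine ae_all_iff.2 fun n => ae_all_iff.2 fun w => ae_all_iff.2 fun w' => ?_
    by_cases h : val c n (extendWord w) = val c n (extendWord w')
    · have := ae_eq_of_forall_setLIntegral_eq_of_sigmaFinite (μ := ρ.fst)
        (ρ.condKernel.measurable_coe (hcyl n w)) (ρ.condKernel.measurable_coe (hcyl n w'))
        fun A hA _ => by rw [hint n w A hA, hint n w' A hA, bern_code_inter_eq c h hA]
      filter_upwards [this] with a ha _ using ha
    · exact ae_of_all _ fun a h' => absurd h' h
  filter_upwards [h1, h2] with a ha1 ha2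
  refine ⟨ρ.condKernel a, inferInstance, ha1, fun n ω => ?_⟩
  have hsum : ∑ w ∈ wordsOfVal c n (val c n ω), (ρ.condKernel a).real {ω' | pre n ω' = w} ≤ 1 := by
    rw [← measureReal_biUnion_finset]
    · exact measureReal_le_one
    · intro w _ w' _ hne
      exact Set.disjoint_left.2 fun ω (h1 : _ = _) (h2 : _ = _) => hne (h1.symm.trans h2)
    · exact fun w _ => hcyl n w
  have heq : ∀ w ∈ wordsOfVal c n (val c n ω), (ρ.condKernel a).real {ω' | pre n ω' = w} =
      (ρ.condKernel a).real {ω' | pre n ω' = pre n ω} := by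
    intro w hw
    rw [measureReal_def, measureReal_def, ha2 n w (pre n ω)]
    rw [val_extendWord_pre]
    exact (Finset.mem_filter.1 hw).2
  rw [Finset.sum_congr rfl heq, Finset.sum_const, nsmul_eq_mul, card_wordsOfVal] at hsum
  linarith

/-! ### Dimension of typical fibres -/

lemma eventually_exists_cover_fiber {c : Fin 3 → ℤ} {M : ℤ} (hc : ∀ i, 0 ≤ c i)
    (hM : ∀ i, c i ≤ M) (hM0 : 0 ≤ M) {ω₀ : Code} {t : ℝ} (ht : 0 ≤ t)
    (h : ∀ᶠ n : ℕ in atTop, 3 ^ n * wideMass c M n ω₀ ≤ ((2 : ℝ) ^ n) ^ t) :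
    ∀ᶠ ε : ℝ in 𝓝[>] 0, ∃ F : Finset (ℝ × ℝ), (F.card : ℝ) ≤ 4 ^ t * ε ^ (-t) ∧
      point '' {ω | code c ω = code c ω₀} ⊆ ⋃ x ∈ F, ball x ε := by
  obtain ⟨N, hN⟩ := eventually_atTop.1 h
  filter_upwards [Ioc_mem_nhdsGT (show (0 : ℝ) < (1 / 2) ^ N by positivity)] with ε hε
  have hε0 : 0 < ε := hε.1
  have hle : ((1 : ℝ) / 2) ^ N ≤ 1 := pow_le_one₀ (by norm_num) (by norm_num)
  obtain ⟨n, h1, h2⟩ := exists_nat_pow_near_of_lt_one (show 0 < ε / 2 by positivity)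
    (show ε / 2 ≤ 1 by linarith [hε.2]) (show (0 : ℝ) < 1 / 2 by norm_num) (by norm_num)
  have hn : N ≤ n + 1 := by
    by_contra! hlt
    have h3 : ((1 : ℝ) / 2) ^ N ≤ (1 / 2) ^ (n + 2) :=
      pow_le_pow_of_le_one (by norm_num) (by norm_num) hlt
    have h4 : ((1 : ℝ) / 2) ^ (n + 2) = (1 / 2) ^ (n + 1) * (1 / 2) := pow_succ _ _
    have := hε.2
    linarith
  rw [div_pow, one_pow] at h1 h2
  have hr : (2 : ℝ) / 2 ^ (n + 1) < ε := by
    have : (2 : ℝ) / 2 ^ (n + 1) = 2 * (1 / 2 ^ (n + 1)) := by ring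
    linarith
  obtain ⟨F, hF, hcov⟩ := exists_cover_fiber hc hM hM0 (n + 1) ω₀ hr
  refine ⟨F, (hF.trans (hN _ hn)).trans ?_, hcov⟩
  rw [Real.rpow_neg hε0.le, ← div_eq_mul_inv, ← Real.div_rpow (by norm_num) hε0.le]
  refine Real.rpow_le_rpow (by positivity) ?_ ht
  rw [le_div_iff₀ (by positivity)] at h2 ⊢
  rw [pow_succ]
  linarith

/-- A measure on codes with small cylinders gives a Frostman measure on the gasket. -/
lemma exists_frostman_measure {m : Measure Code} [IsProbabilityMeasure m] {E : Set (ℝ × ℝ)}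
    (hE : ∀ᵐ ω ∂m, point ω ∈ E) {t : ℝ} (ht : 0 < t)
    (h : ∀ᵐ ω ∂m, ∀ᶠ n : ℕ in atTop,
      m {ω' | pre n ω' = pre n ω} ≤ ENNReal.ofReal (((2 : ℝ) ^ n) ^ t)⁻¹) :
    ∃ m' : Measure (ℝ × ℝ), IsFiniteMeasure m' ∧ m' E ≠ 0 ∧ ∃ C r₀ : ℝ, 0 < C ∧ 0 < r₀ ∧
      ∀ r, 0 < r → r ≤ r₀ → ∀ U, ediam U ≤ ENNReal.ofReal r → m' U ≤ ENNReal.ofReal (C * r ^ t) := by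
  set F : ℕ → Set Code := fun N => {ω | ∀ n ≥ N,
    m {ω' | pre n ω' = pre n ω} ≤ ENNReal.ofReal (((2 : ℝ) ^ n) ^ t)⁻¹} with hFdef
  obtain ⟨N, hN⟩ : ∃ N, m (F N) ≠ 0 := by
    by_contra! h0
    have h1 : m (⋃ N, F N) = 0 := measure_iUnion_null h0
    have h2 : ∀ᵐ ω ∂m, ω ∈ ⋃ N, F N := by
      filter_upwards [h] with ω hω
      obtain ⟨N, hN⟩ := eventually_atTop.1 hω
      exact mem_iUnion.2 ⟨N, hN⟩
    obtain ⟨ω, h3, h4⟩ := (h2.and (measure_eq_zero_iff_ae_notMem.1 h1)).exists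
    exact h4 h3
  refine ⟨(m.restrict (F N)).map point, inferInstance, ?_, 49 * 2 ^ t, (1 / 2) ^ N,
    by positivity, by positivity, fun r hr hrN U hU => ?_⟩
  · refine ne_of_gt (lt_of_lt_of_le (pos_iff_ne_zero.2 hN) ?_)
    calc m (F N) = m (point ⁻¹' E ∩ F N) := by
          refine measure_congr ?_
          filter_upwards [hE] with ω hω
          exact propext ⟨fun h => ⟨hω, h⟩, fun h => h.2⟩
      _ ≤ m.restrict (F N) (point ⁻¹' E) := Measure.le_restrict_apply _ _
      _ ≤ _ := Measure.le_map_apply measurable_point.aemeasurable _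
  · have hle : ((1 : ℝ) / 2) ^ N ≤ 1 := pow_le_one₀ (by norm_num) (by norm_num)
    obtain ⟨n, h1, h2⟩ := exists_nat_pow_near_of_lt_one hr (hrN.trans hle)
      (show (0 : ℝ) < 1 / 2 by norm_num) (by norm_num)
    have hn : N ≤ n := by
      by_contra! hlt
      have := pow_le_pow_of_le_one (show (0 : ℝ) ≤ 1 / 2 by norm_num) (by norm_num)
        (Nat.succ_le_of_lt hlt)
      exact absurd (hrN.trans this) (not_le.2 h1)
    rw [div_pow, one_pow] at h1 h2
    have hU' : ediam (closure U) ≤ ENNReal.ofReal (1 / 2 ^ n) := by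
      rw [ediam_closure]
      exact hU.trans (ENNReal.ofReal_le_ofReal h2)
    calc (m.restrict (F N)).map point U
        ≤ (m.restrict (F N)).map point (closure U) := measure_mono subset_closure
      _ = m (F N ∩ point ⁻¹' closure U) := by
          rw [Measure.map_apply measurable_point isClosed_closure.measurableSet,
            Measure.restrict_apply (measurable_point isClosed_closure.measurableSet), inter_comm]
      _ ≤ 49 * ENNReal.ofReal (((2 : ℝ) ^ n) ^ t)⁻¹ :=
          measure_inter_point_preimage_le m (fun ω (hω : ω ∈ F N) => hω n hn) hU'
      _ = ENNReal.ofReal (49 * (((2 : ℝ) ^ n) ^ t)⁻¹) := by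
          rw [ENNReal.ofReal_mul (by norm_num), ENNReal.ofReal_ofNat]
      _ ≤ _ := by
          refine ENNReal.ofReal_le_ofReal ?_
          rw [mul_assoc, ← Real.mul_rpow (by norm_num) hr.le, ← Real.inv_rpow (by positivity)]
          gcongr
          rw [div_lt_iff₀ (by positivity), pow_succ] at h1
          rw [inv_le_iff_one_le_mul₀ (by positivity)]
          linarith

lemma dim_eq_of_forall {X : Type*} [MetricSpace X] [MeasurableSpace X] [BorelSpace X] {E : Set X}
    {β : ℝ} (hβ : 0 < β)
    (hcov : ∀ t > β, ∃ C > 0, ∀ᶠ ε : ℝ in 𝓝[>] 0, ∃ F : Finset X, (F.card : ℝ) ≤ C * ε ^ (-t) ∧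
      E ⊆ ⋃ x ∈ F, ball x ε)
    (hcov' : ∀ ε > 0, ∃ F : Finset X, E ⊆ ⋃ x ∈ F, ball x ε)
    (hmeas : ∀ t, 0 < t → t < β → ∃ m : Measure X, IsFiniteMeasure m ∧ m E ≠ 0 ∧
      ∃ C r₀ : ℝ, 0 < C ∧ 0 < r₀ ∧ ∀ r, 0 < r → r ≤ r₀ → ∀ U, ediam U ≤ ENNReal.ofReal r →
        m U ≤ ENNReal.ofReal (C * r ^ t)) :
    lowerBoxDim E = β ∧ upperBoxDim E = β ∧ dimH E = ENNReal.ofReal β := by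
  have hlim : Tendsto (fun ε : ℝ => Real.log (coverNum E ε) / Real.log (1 / ε)) (𝓝[>] 0)
      (𝓝 β) := by
    rw [tendsto_order]
    refine ⟨fun a ha => ?_, fun a ha => ?_⟩
    · obtain ⟨t, ht, htβ⟩ := exists_between (max_lt ha hβ)
      obtain ⟨hat, ht0⟩ := max_lt_iff.1 ht
      obtain ⟨m, _, hmE, C, r₀, hC, hr₀, h⟩ := hmeas t ht0 htβ
      filter_upwards [eventually_le_log_coverNum hC hr₀ (half_pos (sub_pos.2 hat)) hmE hcov' h]
        with ε hε
      linarith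
    · obtain ⟨t, ht, hta⟩ := exists_between ha
      obtain ⟨C, hC, h⟩ := hcov t ht
      filter_upwards [eventually_log_coverNum_le (hβ.trans ht).le hC (half_pos (sub_pos.2 hta)) h]
        with ε hε
      linarith
  refine ⟨hlim.liminf_eq, hlim.limsup_eq, le_antisymm ?_ ?_⟩
  · have h1 : Tendsto ENNReal.ofReal (𝓝[>] β) (𝓝 (ENNReal.ofReal β)) :=
      (ENNReal.continuous_ofReal.tendsto β).mono_left nhdsWithin_le_nhds
    refine ge_of_tendsto h1 ?_
    filter_upwards [self_mem_nhdsWithin] with t (ht : β < t)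
    obtain ⟨C, -, h⟩ := hcov t ht
    exact dimH_le_of_eventually_cover (hβ.trans ht).le h
  · have h1 : Tendsto ENNReal.ofReal (𝓝[<] β) (𝓝 (ENNReal.ofReal β)) :=
      (ENNReal.continuous_ofReal.tendsto β).mono_left nhdsWithin_le_nhds
    refine le_of_tendsto h1 ?_
    filter_upwards [Ioo_mem_nhdsLT hβ] with t ht
    obtain ⟨m, _, hmE, C, r₀, hC, hr₀, h⟩ := hmeas t ht.1 ht.2
    exact le_dimH_of_measure_le ht.1 hC hr₀ hmE h

lemma three_pow_mul_le {h t : ℝ} {n : ℕ} (hn : 0 < n) {x : ℝ} (hx : 0 < x)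
    (hle : Real.log x / n ≤ -h + (t - (Real.log 3 - h) / Real.log 2) * Real.log 2) :
    3 ^ n * x ≤ ((2 : ℝ) ^ n) ^ t := by
  have hn' : (0 : ℝ) < n := by exact_mod_cast hn
  have h2 : Real.log 2 ≠ 0 := (Real.log_pos (by norm_num)).ne'
  rw [sub_mul, div_mul_cancel₀ _ h2, div_le_iff₀ hn'] at hle
  rw [← Real.log_le_log_iff (by positivity) (by positivity),
    Real.log_mul (by positivity) hx.ne', Real.log_rpow (by positivity), Real.log_pow, Real.log_pow]
  linarith

lemma le_three_pow_mul {h t : ℝ} {n : ℕ} (hn : 0 < n) {x : ℝ} (hx : 0 < x)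
    (hle : -Real.log x / n ≤ h + ((Real.log 3 - h) / Real.log 2 - t) * Real.log 2) :
    ((2 : ℝ) ^ n) ^ t ≤ 3 ^ n * x := by
  have hn' : (0 : ℝ) < n := by exact_mod_cast hn
  have h2 : Real.log 2 ≠ 0 := (Real.log_pos (by norm_num)).ne'
  rw [sub_mul, div_mul_cancel₀ _ h2, div_le_iff₀ hn'] at hle
  rw [← Real.log_le_log_iff (by positivity) (by positivity),
    Real.log_mul (by positivity) hx.ne', Real.log_rpow (by positivity), Real.log_pow, Real.log_pow]
  linarith

lemma sub_one_lt_of_entropy {c : Fin 3 → ℤ} {M : ℤ} (hc : ∀ i, 0 ≤ c i) (hM : ∀ i, c i ≤ M) :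
    Real.log 3 / Real.log 2 - 1 < (Real.log 3 - entropy c) / Real.log 2 := by
  have h2 : 0 < Real.log 2 := Real.log_pos (by norm_num)
  rw [div_sub_one h2.ne']
  gcongr
  exact entropy_lt_log_two hc hM

/-- The typical fibres of `code c` have dimension `(log 3 - entropy c) / log 2`. -/
theorem ae_dim_fiber_eq {c : Fin 3 → ℤ} {M : ℤ} (hc : ∀ i, 0 ≤ c i) (hM : ∀ i, c i ≤ M)
    (hM0 : 0 ≤ M) :
    ∀ᵐ a ∂bern.map (code c),
      lowerBoxDim (point '' {ω | code c ω = a}) = (Real.log 3 - entropy c) / Real.log 2 ∧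
      upperBoxDim (point '' {ω | code c ω = a}) = (Real.log 3 - entropy c) / Real.log 2 ∧
      dimH (point '' {ω | code c ω = a}) =
        ENNReal.ofReal ((Real.log 3 - entropy c) / Real.log 2) := by
  set β := (Real.log 3 - entropy c) / Real.log 2 with hβdef
  have hlog2 : 0 < Real.log 2 := Real.log_pos (by norm_num)
  have hβ : 0 < β := by
    refine lt_trans ?_ (sub_one_lt_of_entropy hc hM)
    rw [sub_pos, one_lt_div hlog2]
    exact Real.log_lt_log (by norm_num) (by norm_num)
  filter_upwards [ae_exists_fiber_measure c
    ((ae_eventually_info_le c).and (ae_eventually_log_wideMass_le hc hM hM0))] with a ha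
  obtain ⟨m, _, hm, hcyl⟩ := ha
  obtain ⟨ω₀, rfl, -, hwide⟩ := hm.exists
  refine dim_eq_of_forall hβ (fun t ht => ⟨4 ^ t, by positivity, ?_⟩) (fun ε hε => ?_)
    fun t ht0 ht => exists_frostman_measure (m := m) ?_ ht0 ?_
  · refine eventually_exists_cover_fiber hc hM hM0 (hβ.trans ht).le ?_
    filter_upwards [hwide ((t - β) * Real.log 2) (mul_pos (sub_pos.2 ht) hlog2),
      eventually_gt_atTop 0] with n hn hn0
    exact three_pow_mul_le hn0 (wideMass_pos hM0 n ω₀) hn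
  · obtain ⟨n, hn⟩ := ((tendsto_div_two_pow 2).eventually_lt_const hε).exists
    obtain ⟨F, -, hF⟩ := exists_cover_fiber hc hM hM0 n ω₀ hn
    exact ⟨F, hF⟩
  · filter_upwards [hm] with ω hω
    exact ⟨ω, hω.1, rfl⟩
  · filter_upwards [hm] with ω hω
    filter_upwards [hω.2.1 ((β - t) * Real.log 2) (mul_pos (sub_pos.2 ht) hlog2),
      eventually_gt_atTop 0] with n hn hn0
    have h1 := le_three_pow_mul hn0 (mass_val_pos c n ω) hn
    have h2 := hcyl n ω
    have h3 : (0 : ℝ) < ((2 : ℝ) ^ n) ^ t := by positivity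
    rw [← ofReal_measureReal]
    refine ENNReal.ofReal_le_ofReal ?_
    rw [← one_div, le_div_iff₀ h3]
    exact (mul_le_mul_of_nonneg_left h1 measureReal_nonneg).trans h2

lemma sliceSet_eq_image {Δ : Set (ℝ × ℝ)} (hΔ : IsSierpinskiGasket Δ) {p q : ℕ} (hq : 0 < q)
    {θ : ℝ} (hcos : Real.cos θ ≠ 0) (hθtan : Real.tan θ = Real.sqrt 3 * p / (2 * q + p)) (a : ℝ) :
    sliceSet Δ θ (slopeScale p q θ * a) = point '' {ω | code (slopeDigits p q) ω = a} := by
  have hκ : slopeScale p q θ ≠ 0 := fun h =>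
    hcos (by rw [cos_eq_slopeScale (p := p) hq, h, mul_zero])
  ext z
  rw [sliceSet, gasket_eq_range hΔ]
  constructor
  · rintro ⟨⟨ω, rfl⟩, h⟩
    rw [projAngle_point hq hcos hθtan] at h
    exact ⟨ω, mul_left_cancel₀ hκ h, rfl⟩
  · rintro ⟨ω, rfl, rfl⟩
    exact ⟨⟨ω, rfl⟩, projAngle_point hq hcos hθtan ω⟩

end GasketSlice

/-- **Theorem (`ν_θ`-typical slices).** If `tan θ = √3 p/(2q+p)` with `p, q` coprime
positive integers and `θ ∈ (0, π/3)`, then there is a constant `β(θ) > s - 1` such that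
for `ν_θ`-almost all `a ∈ Δ_θ` the box and Hausdorff dimensions of `E_{θ,a}` exist,
coincide and equal `β(θ)`. -/
theorem gasket_slice_measure_typical
    (Δ : Set (ℝ × ℝ)) (hΔ : IsSierpinskiGasket Δ)
    (ν : Measure (ℝ × ℝ)) (hν : IsGasketMeasure Δ ν)
    (p q : ℕ) (hp : 0 < p) (hq : 0 < q) (hpq : Nat.Coprime p q)
    (θ : ℝ) (hθ : θ ∈ Set.Ioo 0 (Real.pi / 3))
    (hθtan : Real.tan θ = Real.sqrt 3 * p / (2 * q + p)) :
    ∃ β : ℝ, Real.log 3 / Real.log 2 - 1 < β ∧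
      ∀ᵐ a ∂(ν.map (projAngle θ)),
        lowerBoxDim (sliceSet Δ θ a) = β ∧ upperBoxDim (sliceSet Δ θ a) = β ∧
        dimH (sliceSet Δ θ a) = ENNReal.ofReal β := by
  have hcos : Real.cos θ ≠ 0 :=
    (Real.cos_pos_of_mem_Ioo ⟨by linarith [hθ.1, Real.pi_pos],
      by linarith [hθ.2, Real.pi_pos]⟩).ne'
  have hκ : GasketSlice.slopeScale p q θ ≠ 0 := fun h =>
    hcos (by rw [GasketSlice.cos_eq_slopeScale (p := p) hq, h, mul_zero])
  have hd := GasketSlice.slopeDigits_nonneg p q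
  have hM := GasketSlice.slopeDigits_le p q
  refine ⟨_, GasketSlice.sub_one_lt_of_entropy hd hM, ?_⟩
  have hmap : ν.map (projAngle θ) =
      (GasketSlice.bern.map (GasketSlice.code (GasketSlice.slopeDigits p q))).map
        (MeasurableEquiv.mulLeft₀ (GasketSlice.slopeScale p q θ) hκ) := by
    rw [GasketSlice.gasketMeasure_map_projAngle hν hq hcos hθtan,
      Measure.map_map (MeasurableEquiv.measurable _) (GasketSlice.measurable_code _)]
    rfl
  rw [hmap, (MeasurableEquiv.measurableEmbedding _).ae_map_iff]
  filter_upwards [GasketSlice.ae_dim_fiber_eq hd hM (by positivity)] with a ha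
  simpa only [MeasurableEquiv.coe_mulLeft₀,
    GasketSlice.sliceSet_eq_image hΔ hq hcos hθtan] using ha

end
end

section
/- Suppose p,q are coprime positive integers and θ ∈ (0,π/3) satisfies tan θ = √3·p/(2q+p), and let β(θ) be the ν_θ-almost sure common value of the Hausdorff and box dimensions of the slices E_{θ,a}. Then the projection proj_θ satisfies the dimension conservation formula at the value β(θ): β(θ) + dim_H{a ∈ Δ_θ : dim_H E_{θ,a} ≥ β(θ)} = s, and moreover β(θ) + dim_H{a ∈ Δ_θ : dim_H E_{θ,a} = β(θ)} = s. -/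
open Filter MeasureTheory Set Metric Topology
open scoped ENNReal Classical

noncomputable section

/-! ### Combinatorics of the cylinders of the gasket -/

/-- The lattice coordinates of the `i`-th child of the cylinder with coordinates `v`. -/
def childDigit (x : (ℕ × ℕ) × Fin 3) : ℕ × ℕ :=
  (2 * x.1.1 + if x.2 = 1 then 1 else 0, 2 * x.1.2 + if x.2 = 2 then 1 else 0)

theorem childDigit_injective : Function.Injective childDigit := by
  rintro ⟨⟨a, b⟩, i⟩ ⟨⟨c, d⟩, j⟩ h
  simp only [childDigit, Prod.mk.injEq] at h ⊢
  fin_cases i <;> fin_cases j <;> simp at h ⊢ <;> omega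

/-- The lattice coordinates of the `3 ^ n` cylinders of level `n`. -/
def gasketDigits : ℕ → Finset (ℕ × ℕ)
  | 0 => {(0, 0)}
  | n + 1 => (gasketDigits n ×ˢ Finset.univ).map ⟨childDigit, childDigit_injective⟩

theorem card_gasketDigits (n : ℕ) : (gasketDigits n).card = 3 ^ n := by
  induction n with
  | zero => simp [gasketDigits]
  | succ n ih => simp [gasketDigits, ih, pow_succ]

/-- The point of the triangular lattice with coordinates `v`. -/
def latticePoint (v : ℕ × ℕ) : ℝ × ℝ := (v.1 + v.2 / 2, Real.sqrt 3 / 2 * v.2)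

/-- The contraction of ratio `2⁻ⁿ` whose image of the gasket is the cylinder with
coordinates `v`. -/
def cylinderMap (n : ℕ) (v : ℕ × ℕ) (z : ℝ × ℝ) : ℝ × ℝ :=
  ((2 : ℝ) ^ n)⁻¹ • (z + latticePoint v)

theorem cylinderMap_zero (z : ℝ × ℝ) : cylinderMap 0 (0, 0) z = z := by
  ext <;> simp [cylinderMap, latticePoint]

theorem cylinderMap_childDigit (n : ℕ) (v : ℕ × ℕ) (i : Fin 3) (z : ℝ × ℝ) :
    cylinderMap (n + 1) (childDigit (v, i)) z = cylinderMap n v (gasketMap i z) := by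
  fin_cases i <;> ext <;>
    simp [cylinderMap, latticePoint, childDigit, gasketMap, pow_succ] <;> ring

theorem continuous_cylinderMap (n : ℕ) (v : ℕ × ℕ) : Continuous (cylinderMap n v) := by
  unfold cylinderMap
  fun_prop

theorem continuous_gasketMap (i : Fin 3) : Continuous (gasketMap i) := by
  fin_cases i <;> simp only [gasketMap] <;> fun_prop

theorem IsSierpinskiGasket.gasketMap_mem {Δ : Set (ℝ × ℝ)} (hΔ : IsSierpinskiGasket Δ) (i : Fin 3)
    {z : ℝ × ℝ} (hz : z ∈ Δ) : gasketMap i z ∈ Δ := by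
  rw [hΔ.2.2]
  fin_cases i
  · exact Or.inl (Or.inl ⟨z, hz, rfl⟩)
  · exact Or.inl (Or.inr ⟨z, hz, rfl⟩)
  · exact Or.inr ⟨z, hz, rfl⟩

theorem IsSierpinskiGasket.exists_gasketMap {Δ : Set (ℝ × ℝ)} (hΔ : IsSierpinskiGasket Δ)
    {z : ℝ × ℝ} (hz : z ∈ Δ) : ∃ i, ∃ w ∈ Δ, gasketMap i w = z := by
  rw [hΔ.2.2] at hz
  rcases hz with (⟨w, hw, h⟩ | ⟨w, hw, h⟩) | ⟨w, hw, h⟩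
  exacts [⟨0, w, hw, h⟩, ⟨1, w, hw, h⟩, ⟨2, w, hw, h⟩]

theorem IsSierpinskiGasket.cylinderMap_mem {Δ : Set (ℝ × ℝ)} (hΔ : IsSierpinskiGasket Δ) {n : ℕ}
    {v : ℕ × ℕ} (hv : v ∈ gasketDigits n) {z : ℝ × ℝ} (hz : z ∈ Δ) : cylinderMap n v z ∈ Δ := by
  induction n generalizing v z with
  | zero =>
    simp only [gasketDigits, Finset.mem_singleton] at hv
    rwa [hv, cylinderMap_zero]
  | succ n ih =>
    simp only [gasketDigits, Finset.mem_map, Finset.mem_product, Finset.mem_univ, and_true,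
      Function.Embedding.coeFn_mk] at hv
    obtain ⟨⟨v, i⟩, hv, rfl⟩ := hv
    rw [cylinderMap_childDigit]
    exact ih hv (hΔ.gasketMap_mem i hz)

theorem IsSierpinskiGasket.exists_cylinderMap {Δ : Set (ℝ × ℝ)} (hΔ : IsSierpinskiGasket Δ)
    (n : ℕ) {z : ℝ × ℝ} (hz : z ∈ Δ) : ∃ v ∈ gasketDigits n, ∃ w ∈ Δ, cylinderMap n v w = z := by
  induction n with
  | zero => exact ⟨(0, 0), by simp [gasketDigits], z, hz, cylinderMap_zero z⟩
  | succ n ih =>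
    obtain ⟨v, hv, w, hw, rfl⟩ := ih
    obtain ⟨i, y, hy, rfl⟩ := hΔ.exists_gasketMap hw
    refine ⟨childDigit (v, i), ?_, y, hy, cylinderMap_childDigit n v i y⟩
    simp only [gasketDigits, Finset.mem_map, Finset.mem_product, Finset.mem_univ, and_true,
      Function.Embedding.coeFn_mk]
    exact ⟨(v, i), hv, rfl⟩

theorem IsGasketMeasure.apply_eq {Δ : Set (ℝ × ℝ)} {ν : Measure (ℝ × ℝ)}
    (hν : IsGasketMeasure Δ ν) {B : Set (ℝ × ℝ)} (hB : MeasurableSet B) :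
    ν B = 3⁻¹ * ∑ i, ν (gasketMap i ⁻¹' B) := by
  conv_lhs => rw [hν.2.2]
  simp [Measure.map_apply (continuous_gasketMap _).measurable hB, Fin.sum_univ_three, mul_add]

theorem IsGasketMeasure.apply_eq_sum_cylinderMap {Δ : Set (ℝ × ℝ)} {ν : Measure (ℝ × ℝ)}
    (hν : IsGasketMeasure Δ ν) (n : ℕ) {B : Set (ℝ × ℝ)} (hB : MeasurableSet B) :
    ν B = (3⁻¹ : ℝ≥0∞) ^ n * ∑ v ∈ gasketDigits n, ν (cylinderMap n v ⁻¹' B) := by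
  induction n with
  | zero =>
    have : cylinderMap 0 (0, 0) ⁻¹' B = B := by
      ext z
      simp only [mem_preimage, cylinderMap_zero]
    simp [gasketDigits, this]
  | succ n ih =>
    rw [ih, gasketDigits, Finset.sum_map, Finset.sum_product, pow_succ, mul_assoc,
      Finset.mul_sum (a := (3⁻¹ : ℝ≥0∞))]
    congr 1
    refine Finset.sum_congr rfl fun v _ => ?_
    rw [hν.apply_eq ((continuous_cylinderMap n v).measurable hB)]
    congr 1
    refine Finset.sum_congr rfl fun i _ => ?_
    congr 1
    ext z
    simp only [mem_preimage, Function.Embedding.coeFn_mk, cylinderMap_childDigit]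

/-! ### Dimension estimates from covers -/

theorem dimH_le_of_frequently_cover {X ι : Type*} [MetricSpace X] {s : Set X} {d : ℝ} (hd : 0 ≤ d)
    {K D : ℝ} (hD : 0 ≤ D)
    (h : ∃ᶠ n : ℕ in atTop, ∃ F : Finset ι, ∃ t : ι → Set X, s ⊆ (⋃ i ∈ F, t i) ∧
      (∀ i ∈ F, ediam (t i) ≤ ENNReal.ofReal (D / 2 ^ n)) ∧
      (F.card : ℝ) ≤ K * ((2 : ℝ) ^ n) ^ d) :
    dimH s ≤ ENNReal.ofReal d := by
  borelize X
  refine dimH_le_of_hausdorffMeasure_ne_top (d := d.toNNReal) ?_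
  rw [Real.coe_toNNReal d hd]
  set P := {n : ℕ | ∃ F : Finset ι, ∃ t : ι → Set X, s ⊆ (⋃ i ∈ F, t i) ∧
      (∀ i ∈ F, ediam (t i) ≤ ENNReal.ofReal (D / 2 ^ n)) ∧
      (F.card : ℝ) ≤ K * ((2 : ℝ) ^ n) ^ d} with hP
  choose! F t hst hdiam hcard using (fun n (hn : n ∈ P) => hn)
  have : NeBot (atTop ⊓ 𝓟 P) := frequently_mem_iff_neBot.1 h
  have hev : ∀ᶠ n in atTop ⊓ 𝓟 P, n ∈ P := mem_inf_of_right (mem_principal_self P)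
  have hlim : Tendsto (fun n : ℕ => ENNReal.ofReal (D / 2 ^ n)) (atTop ⊓ 𝓟 P) (𝓝 0) := by
    rw [← ENNReal.ofReal_zero]
    refine ENNReal.tendsto_ofReal (Tendsto.mono_left ?_ inf_le_left)
    have := tendsto_pow_atTop_nhds_zero_of_lt_one (r := (2⁻¹ : ℝ)) (by norm_num) (by norm_num)
    simpa [div_eq_mul_inv] using this.const_mul D
  have key := Measure.hausdorffMeasure_le_liminf_sum d s (fun n : ℕ => ENNReal.ofReal (D / 2 ^ n))
    hlim (fun n (i : F n) => t n i) (hev.mono fun n hn i => hdiam n hn i i.2)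
    (hev.mono fun n hn x hx => by
      obtain ⟨i, hi, hxi⟩ := mem_iUnion₂.1 (hst n hn hx)
      exact mem_iUnion.2 ⟨⟨i, hi⟩, hxi⟩)
  refine ne_top_of_le_ne_top (b := ENNReal.ofReal (K * D ^ d)) ENNReal.ofReal_ne_top
    (key.trans (liminf_le_of_frequently_le' (hev.mono fun n hn => ?_).frequently))
  calc ∑ i : F n, ediam (t n i) ^ d
      ≤ ∑ _i : F n, ENNReal.ofReal (D / 2 ^ n) ^ d :=
        Finset.sum_le_sum fun i _ => ENNReal.rpow_le_rpow (hdiam n hn i i.2) hd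
    _ = ENNReal.ofReal ((F n).card * (D / 2 ^ n) ^ d) := by
        rw [ENNReal.ofReal_rpow_of_nonneg (by positivity) hd, ENNReal.ofReal_mul (by positivity)]
        simp
    _ ≤ ENNReal.ofReal (K * D ^ d) := by
        refine ENNReal.ofReal_le_ofReal ?_
        have h2 : (0 : ℝ) < ((2 : ℝ) ^ n) ^ d := by positivity
        rw [Real.div_rpow hD (by positivity), mul_div_assoc', div_le_iff₀ h2]
        calc ((F n).card : ℝ) * D ^ d ≤ (K * ((2 : ℝ) ^ n) ^ d) * D ^ d := by
              gcongr
              exact hcard n hn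
          _ = K * D ^ d * ((2 : ℝ) ^ n) ^ d := by ring

/-! ### Projections with integral values at the vertices -/

/-- The linear functional `L` takes the values `0`, `m₁`, `m₂` at the vertices of the gasket. -/
structure IsIntegralProjection (L : ℝ × ℝ →L[ℝ] ℝ) (m₁ m₂ : ℕ) : Prop where
  map_fst : L (1, 0) = m₁
  map_snd : L (1 / 2, Real.sqrt 3 / 2) = m₂
  fst_pos : 0 < m₁
  snd_pos : 0 < m₂

/-- The left endpoint of `2 ^ n` times the projection of the cylinder with coordinates `v`. -/
def digitWeight (m₁ m₂ : ℕ) (v : ℕ × ℕ) : ℕ := m₁ * v.1 + m₂ * v.2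

/-- The number of cylinders of level `n` whose projection contains `a`. -/
def cylinderCount (m₁ m₂ n : ℕ) (a : ℝ) : ℕ :=
  ((gasketDigits n).filter fun v => (digitWeight m₁ m₂ v : ℝ) ≤ 2 ^ n * a ∧
    2 ^ n * a ≤ digitWeight m₁ m₂ v + (max m₁ m₂ : ℕ)).card

theorem two_pow_rpow_log_three_div_log_two (n : ℕ) :
    ((2 : ℝ) ^ n) ^ (Real.log 3 / Real.log 2) = 3 ^ n := by
  rw [← Real.rpow_natCast, ← Real.rpow_mul (by norm_num), mul_comm, Real.rpow_mul (by norm_num),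
    Real.rpow_natCast]
  congr 1
  rw [Real.rpow_def_of_pos (by norm_num), mul_div_cancel₀ _ (Real.log_pos (by norm_num)).ne',
    Real.exp_log (by norm_num)]

theorem cylinderCount_le (m₁ m₂ n : ℕ) (a : ℝ) : cylinderCount m₁ m₂ n a ≤ 3 ^ n :=
  (Finset.card_filter_le _ _).trans (card_gasketDigits n).le

theorem dist_cylinderMap (n : ℕ) (v : ℕ × ℕ) (x y : ℝ × ℝ) :
    dist (cylinderMap n v x) (cylinderMap n v y) = dist x y / 2 ^ n := by
  rw [cylinderMap, cylinderMap, dist_smul₀, dist_add_right]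
  simp [div_eq_inv_mul]

section IntegralProjection

variable {Δ : Set (ℝ × ℝ)} {L : ℝ × ℝ →L[ℝ] ℝ} {m₁ m₂ : ℕ}

theorem IsIntegralProjection.map_latticePoint (hL : IsIntegralProjection L m₁ m₂) (v : ℕ × ℕ) :
    L (latticePoint v) = digitWeight m₁ m₂ v := by
  have : latticePoint v = (v.1 : ℝ) • ((1, 0) : ℝ × ℝ) +
      (v.2 : ℝ) • ((1 / 2, Real.sqrt 3 / 2) : ℝ × ℝ) := by
    ext <;> simp [latticePoint] <;> ring
  rw [this, map_add, map_smul, map_smul, hL.map_fst, hL.map_snd]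
  simp [digitWeight, mul_comm]

theorem IsIntegralProjection.map_cylinderMap (hL : IsIntegralProjection L m₁ m₂) (n : ℕ)
    (v : ℕ × ℕ) (z : ℝ × ℝ) :
    L (cylinderMap n v z) = (L z + digitWeight m₁ m₂ v) / 2 ^ n := by
  rw [cylinderMap, map_smul, map_add, hL.map_latticePoint, smul_eq_mul, inv_mul_eq_div]

theorem IsIntegralProjection.map_gasketMap (hL : IsIntegralProjection L m₁ m₂) (i : Fin 3)
    (z : ℝ × ℝ) : L (gasketMap i z) = (L z + (![0, m₁, m₂] i : ℕ)) / 2 := by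
  rw [← cylinderMap_zero (gasketMap i z), ← cylinderMap_childDigit, hL.map_cylinderMap]
  fin_cases i <;> simp [childDigit, digitWeight]

theorem IsIntegralProjection.map_mem_Icc (hL : IsIntegralProjection L m₁ m₂)
    (hΔ : IsSierpinskiGasket Δ) {z : ℝ × ℝ} (hz : z ∈ Δ) :
    L z ∈ Icc (0 : ℝ) (max m₁ m₂ : ℕ) := by
  have hm : ∀ i, ![0, m₁, m₂] i ≤ max m₁ m₂ := fun i => by fin_cases i <;> simp
  constructor
  · obtain ⟨x, hx, hmin⟩ := hΔ.2.1.exists_isMinOn hΔ.1 L.continuous.continuousOn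
    obtain ⟨i, y, hy, rfl⟩ := hΔ.exists_gasketMap hx
    have h1 := isMinOn_iff.1 hmin y hy
    have h2 := isMinOn_iff.1 hmin z hz
    rw [hL.map_gasketMap] at h1 h2
    have : (0 : ℝ) ≤ (![0, m₁, m₂] i : ℕ) := by positivity
    linarith
  · obtain ⟨x, hx, hmax⟩ := hΔ.2.1.exists_isMaxOn hΔ.1 L.continuous.continuousOn
    obtain ⟨i, y, hy, rfl⟩ := hΔ.exists_gasketMap hx
    have h1 := isMaxOn_iff.1 hmax y hy
    have h2 := isMaxOn_iff.1 hmax z hz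
    rw [hL.map_gasketMap] at h1 h2
    have : ((![0, m₁, m₂] i : ℕ) : ℝ) ≤ (max m₁ m₂ : ℕ) := by exact_mod_cast hm i
    linarith

theorem IsIntegralProjection.exists_map_eq (hL : IsIntegralProjection L m₁ m₂)
    (hΔ : IsSierpinskiGasket Δ) {x : ℝ} (hx : x ∈ Icc (0 : ℝ) (max m₁ m₂ : ℕ)) :
    ∃ z ∈ Δ, L z = x := by
  set M : ℕ := max m₁ m₂ with hM
  obtain ⟨i, hi⟩ : ∃ i, ![0, m₁, m₂] i = M := by
    rcases le_total m₁ m₂ with h | h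
    · exact ⟨2, by simp [hM, h]⟩
    · exact ⟨1, by simp [hM, h]⟩
  have key : ∀ n : ℕ, ∀ x ∈ Icc (0 : ℝ) M, ∃ y ∈ L '' Δ, |x - y| ≤ M / 2 ^ n := by
    intro n
    induction n with
    | zero =>
      intro x hx
      obtain ⟨z, hz⟩ := hΔ.1
      have := hL.map_mem_Icc hΔ hz
      refine ⟨L z, ⟨z, hz, rfl⟩, ?_⟩
      rw [abs_le, pow_zero, div_one]
      constructor <;> linarith [this.1, this.2, hx.1, hx.2]
    | succ n ih =>
      intro x hx
      obtain ⟨j, hj⟩ : ∃ j, 2 * x - (![0, m₁, m₂] j : ℕ) ∈ Icc (0 : ℝ) M := by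
        rcases le_total x (M / 2) with h | h
        · exact ⟨0, by simp; constructor <;> linarith [hx.1]⟩
        · refine ⟨i, ?_⟩
          rw [hi]
          constructor <;> linarith [hx.2]
      obtain ⟨_, ⟨z, hz, rfl⟩, h⟩ := ih _ hj
      refine ⟨_, ⟨gasketMap j z, hΔ.gasketMap_mem j hz, rfl⟩, ?_⟩
      rw [hL.map_gasketMap]
      calc |x - (L z + (![0, m₁, m₂] j : ℕ)) / 2|
          = |2 * x - (![0, m₁, m₂] j : ℕ) - L z| / 2 := by
            rw [eq_div_iff (by norm_num : (2 : ℝ) ≠ 0), ← abs_of_pos (by norm_num : (0 : ℝ) < 2),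
              ← abs_mul, abs_of_pos (by norm_num : (0 : ℝ) < 2)]
            congr 1
            ring
        _ ≤ M / 2 ^ n / 2 := by gcongr
        _ = M / 2 ^ (n + 1) := by rw [pow_succ, div_div]
  have hclosed : IsClosed (L '' Δ) := (hΔ.2.1.image L.continuous).isClosed
  have hlim : Tendsto (fun n : ℕ => (M : ℝ) / 2 ^ n) atTop (𝓝 0) := by
    have := tendsto_pow_atTop_nhds_zero_of_lt_one (r := (2⁻¹ : ℝ)) (by norm_num) (by norm_num)
    simpa [div_eq_mul_inv] using this.const_mul (M : ℝ)
  suffices x ∈ closure (L '' Δ) by rwa [hclosed.closure_eq] at this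
  rw [Metric.mem_closure_iff]
  intro ε hε
  obtain ⟨n, hn⟩ := (hlim.eventually_lt_const hε).exists
  obtain ⟨y, hy, h⟩ := key n x hx
  exact ⟨y, hy, by rw [Real.dist_eq]; linarith⟩

theorem IsIntegralProjection.dimH_slice_le (hL : IsIntegralProjection L m₁ m₂)
    (hΔ : IsSierpinskiGasket Δ) {a t K : ℝ} (ht : 0 ≤ t)
    (h : ∃ᶠ n in atTop, (cylinderCount m₁ m₂ n a : ℝ) ≤ K * ((2 : ℝ) ^ n) ^ t) :
    dimH {z ∈ Δ | L z = a} ≤ ENNReal.ofReal t := by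
  refine dimH_le_of_frequently_cover (D := Metric.diam Δ) (K := K) ht Metric.diam_nonneg
    (h.mono fun n hn => ⟨_, fun v => cylinderMap n v '' Δ, ?_, ?_, hn⟩)
  · rintro _ ⟨hz, ha⟩
    obtain ⟨v, hv, w, hw, rfl⟩ := hΔ.exists_cylinderMap n hz
    have hI := hL.map_mem_Icc hΔ hw
    have h2 : (2 : ℝ) ^ n * a = L w + digitWeight m₁ m₂ v := by
      rw [← ha, hL.map_cylinderMap, mul_div_cancel₀ _ (by positivity)]
    refine mem_iUnion₂.2 ⟨v, Finset.mem_filter.2 ⟨hv, ?_, ?_⟩, w, hw, rfl⟩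
    · linarith [hI.1]
    · linarith [hI.2]
  · intro v _
    refine Metric.ediam_le ?_
    rintro _ ⟨x, hx, rfl⟩ _ ⟨y, hy, rfl⟩
    rw [edist_dist, dist_cylinderMap]
    refine ENNReal.ofReal_le_ofReal ?_
    gcongr
    exact Metric.dist_le_diam_of_mem hΔ.2.1.isBounded hx hy

theorem IsIntegralProjection.eventually_lt_cylinderCount (hL : IsIntegralProjection L m₁ m₂)
    (hΔ : IsSierpinskiGasket Δ) {a t b : ℝ} (ht : 0 ≤ t) (htb : t < b)
    (h : ENNReal.ofReal b ≤ dimH {z ∈ Δ | L z = a}) :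
    ∀ᶠ n in atTop, ((2 : ℝ) ^ n) ^ t < cylinderCount m₁ m₂ n a := by
  by_contra hcon
  have hfreq : ∃ᶠ n in atTop, (cylinderCount m₁ m₂ n a : ℝ) ≤ 1 * ((2 : ℝ) ^ n) ^ t :=
    (not_eventually.1 hcon).mono fun n hn => by simpa using hn
  exact absurd (h.trans (hL.dimH_slice_le hΔ ht hfreq))
    (not_le.2 ((ENNReal.ofReal_lt_ofReal_iff (ht.trans_lt htb)).2 htb))

end IntegralProjection

theorem dimH_setOf_forall_lt_cylinderCount_le (m₁ m₂ k : ℕ) {t : ℝ}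
    (ht : t ≤ Real.log 3 / Real.log 2) :
    dimH {a : ℝ | ∀ n ≥ k, ((2 : ℝ) ^ n) ^ t < cylinderCount m₁ m₂ n a} ≤
      ENNReal.ofReal (Real.log 3 / Real.log 2 - t) := by
  set M := max m₁ m₂ with hM
  let r : ℕ × ℕ → ℤ → Prop := fun v j => j ∈ Finset.Icc (digitWeight m₁ m₂ v : ℤ)
    (digitWeight m₁ m₂ v + M : ℤ)
  refine dimH_le_of_frequently_cover (ι := ℤ) (D := 1) (K := M + 1) (sub_nonneg.2 ht) zero_le_one
    ((eventually_ge_atTop k).frequently.mono fun n hn => ?_)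
  let T : Finset ℤ := ((gasketDigits n).biUnion fun v => Finset.Icc (digitWeight m₁ m₂ v : ℤ)
    (digitWeight m₁ m₂ v + M : ℤ)).filter fun j =>
      ((2 : ℝ) ^ n) ^ t < ((gasketDigits n).filter fun v => r v j).card
  refine ⟨T, fun j => Icc ((j : ℝ) / 2 ^ n) ((j + 1 : ℝ) / 2 ^ n), fun a ha => ?_, fun j _ => ?_, ?_⟩
  · have ha := ha n hn
    have hsub : ((gasketDigits n).filter fun v => (digitWeight m₁ m₂ v : ℝ) ≤ 2 ^ n * a ∧
        2 ^ n * a ≤ digitWeight m₁ m₂ v + (max m₁ m₂ : ℕ)) ⊆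
        (gasketDigits n).filter fun v => r v ⌊2 ^ n * a⌋ := by
      intro v hv
      simp only [Finset.mem_filter, r, Finset.mem_Icc] at hv ⊢
      refine ⟨hv.1, Int.le_floor.2 (by exact_mod_cast hv.2.1), ?_⟩
      have := (Int.floor_le (2 ^ n * a)).trans hv.2.2
      exact_mod_cast this
    have hlt : ((2 : ℝ) ^ n) ^ t < ((gasketDigits n).filter fun v => r v ⌊2 ^ n * a⌋).card :=
      ha.trans_le (Nat.cast_le.2 (Finset.card_le_card hsub))
    have hpos : 0 < ((gasketDigits n).filter fun v => r v ⌊2 ^ n * a⌋).card := by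
      have : (0 : ℝ) < ((2 : ℝ) ^ n) ^ t := by positivity
      exact_mod_cast this.trans hlt
    obtain ⟨v, hv⟩ := Finset.card_pos.1 hpos
    rw [Finset.mem_filter] at hv
    refine mem_iUnion₂.2 ⟨⌊2 ^ n * a⌋, Finset.mem_filter.2
      ⟨Finset.mem_biUnion.2 ⟨v, hv.1, hv.2⟩, hlt⟩, ?_, ?_⟩
    · rw [div_le_iff₀' (by positivity)]
      exact Int.floor_le _
    · rw [le_div_iff₀' (by positivity)]
      exact (Int.lt_floor_add_one _).le
  · rw [Real.ediam_Icc]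
    refine ENNReal.ofReal_le_ofReal (le_of_eq ?_)
    ring
  · have hcount : (T.card : ℝ) * ((2 : ℝ) ^ n) ^ t ≤ (M + 1) * 3 ^ n := by
      calc (T.card : ℝ) * ((2 : ℝ) ^ n) ^ t = ∑ _j ∈ T, ((2 : ℝ) ^ n) ^ t := by simp
        _ ≤ ∑ j ∈ T, (((gasketDigits n).filter fun v => r v j).card : ℝ) :=
            Finset.sum_le_sum fun j hj => (Finset.mem_filter.1 hj).2.le
        _ = ∑ v ∈ gasketDigits n, ((T.filter fun j => r v j).card : ℝ) := by
            have := Finset.sum_card_bipartiteAbove_eq_sum_card_bipartiteBelow (s := gasketDigits n)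
              (t := T) r
            simp only [Finset.bipartiteAbove, Finset.bipartiteBelow] at this
            exact_mod_cast this.symm
        _ ≤ ∑ _v ∈ gasketDigits n, (M + 1 : ℝ) := by
            refine Finset.sum_le_sum fun v _ => ?_
            have h1 : (T.filter fun j => r v j) ⊆ Finset.Icc (digitWeight m₁ m₂ v : ℤ)
                (digitWeight m₁ m₂ v + M : ℤ) := fun j hj => (Finset.mem_filter.1 hj).2
            have h2 := Finset.card_le_card h1
            rw [Int.card_Icc, show ((digitWeight m₁ m₂ v : ℤ) + M + 1 - digitWeight m₁ m₂ v).toNat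
              = M + 1 by omega] at h2
            exact_mod_cast h2
        _ = (M + 1) * 3 ^ n := by
            rw [Finset.sum_const, card_gasketDigits, nsmul_eq_mul]
            push_cast
            ring
    rw [Real.rpow_sub (by positivity), two_pow_rpow_log_three_div_log_two, mul_div_assoc',
      le_div_iff₀ (by positivity)]
    exact hcount

/-! ### The projected measure -/

section ProjectedMeasure

variable {Δ : Set (ℝ × ℝ)} {ν : Measure (ℝ × ℝ)} {L : ℝ × ℝ →L[ℝ] ℝ} {m₁ m₂ : ℕ}

theorem IsIntegralProjection.measure_fiber_eq (hL : IsIntegralProjection L m₁ m₂)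
    (hν : IsGasketMeasure Δ ν) (x : ℝ) :
    (ν (L ⁻¹' {x})).toReal = ((ν (L ⁻¹' {2 * x})).toReal + (ν (L ⁻¹' {2 * x - m₁})).toReal +
      (ν (L ⁻¹' {2 * x - m₂})).toReal) / 3 := by
  have := hν.1
  have hpre : ∀ i, gasketMap i ⁻¹' (L ⁻¹' {x}) = L ⁻¹' {2 * x - (![0, m₁, m₂] i : ℕ)} := by
    intro i
    ext z
    simp only [mem_preimage, mem_singleton_iff, hL.map_gasketMap]
    constructor <;> intro h <;> linarith
  rw [hν.apply_eq (L.continuous.measurable (measurableSet_singleton x))]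
  simp only [hpre, Fin.sum_univ_three, ENNReal.toReal_mul]
  rw [ENNReal.toReal_add (by simp) (by simp), ENNReal.toReal_add (by simp) (by simp)]
  simp [div_eq_inv_mul]

theorem IsIntegralProjection.measure_fiber_le (hL : IsIntegralProjection L m₁ m₂)
    (hΔ : IsSierpinskiGasket Δ) (hν : IsGasketMeasure Δ ν) (n : ℕ) (x : ℝ) :
    (ν (L ⁻¹' {x})).toReal ≤ (2 / 3) ^ n := by
  have := hν.1
  set F : ℝ → ℝ := fun x => (ν (L ⁻¹' {x})).toReal with hF
  have hrec : ∀ x, F x = (F (2 * x) + F (2 * x - m₁) + F (2 * x - m₂)) / 3 :=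
    hL.measure_fiber_eq hν
  have hout : ∀ y, y ∉ Icc (0 : ℝ) (max m₁ m₂ : ℕ) → F y = 0 := by
    intro y hy
    have : ν (L ⁻¹' {y}) = 0 := by
      refine measure_mono_null (t := Δᶜ) (fun z hz hzΔ => hy ?_) hν.2.1
      rw [← (mem_singleton_iff.1 hz)]
      exact hL.map_mem_Icc hΔ hzΔ
    simp [hF, this]
  have h1 : (0 : ℝ) < m₁ := by exact_mod_cast hL.fst_pos
  have h2 : (0 : ℝ) < m₂ := by exact_mod_cast hL.snd_pos
  have hneg : ∀ y < 0, F y = 0 := fun y hy => hout y fun h => absurd h.1 (not_le.2 hy)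
  have hzero : ∀ y ≤ 0, F y = 0 := by
    intro y hy
    rcases hy.lt_or_eq with hy | rfl
    · exact hneg y hy
    · have := hrec 0
      rw [hneg (2 * 0 - m₁) (by linarith), hneg (2 * 0 - m₂) (by linarith), mul_zero] at this
      linarith
  change F x ≤ _
  induction n generalizing x with
  | zero =>
    simp only [hF, pow_zero]
    exact ENNReal.toReal_le_of_le_ofReal zero_le_one (by simpa using prob_le_one)
  | succ n ih =>
    have e0 := ih (2 * x)
    have e1 := ih (2 * x - m₁)
    have e2 := ih (2 * x - m₂)
    have hp : (0 : ℝ) ≤ (2 / 3) ^ n := by positivity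
    rw [hrec x, pow_succ]
    rcases le_or_gt x ((max m₁ m₂ : ℕ) / 2) with hx | hx
    · rcases le_total m₁ m₂ with h | h
      · rw [max_eq_right h] at hx
        rw [hzero (2 * x - m₂) (by linarith)]
        linarith
      · rw [max_eq_left h] at hx
        rw [hzero (2 * x - m₁) (by linarith)]
        linarith
    · rw [hout (2 * x) fun h => by linarith [h.2]]
      linarith

theorem IsIntegralProjection.nullSingletonClass_map (hL : IsIntegralProjection L m₁ m₂)
    (hΔ : IsSierpinskiGasket Δ) (hν : IsGasketMeasure Δ ν) : NullSingletonClass (ν.map L) := by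
  have := hν.1
  refine ⟨fun x => ?_⟩
  rw [Measure.map_apply L.continuous.measurable (measurableSet_singleton x)]
  have hle : (ν (L ⁻¹' {x})).toReal ≤ 0 :=
    ge_of_tendsto' (tendsto_pow_atTop_nhds_zero_of_lt_one (r := (2 / 3 : ℝ)) (by norm_num)
      (by norm_num)) fun n => hL.measure_fiber_le hΔ hν n x
  exact ((ENNReal.toReal_eq_zero_iff _).1 (hle.antisymm ENNReal.toReal_nonneg)).resolve_right
    (measure_ne_top _ _)

theorem IsIntegralProjection.map_Ioo_le (hL : IsIntegralProjection L m₁ m₂)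
    (hΔ : IsSierpinskiGasket Δ) (hν : IsGasketMeasure Δ ν) (n : ℕ) (j : ℤ) {a : ℝ}
    (ha : a ∈ Ioo ((j : ℝ) / 2 ^ n) ((j + 1 : ℝ) / 2 ^ n)) :
    ν.map L (Ioo ((j : ℝ) / 2 ^ n) ((j + 1 : ℝ) / 2 ^ n)) ≤
      (3⁻¹ : ℝ≥0∞) ^ n * cylinderCount m₁ m₂ n a := by
  have := hν.1
  rw [Measure.map_apply L.continuous.measurable measurableSet_Ioo,
    hν.apply_eq_sum_cylinderMap n (L.continuous.measurable measurableSet_Ioo), cylinderCount,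
    Finset.card_filter, Nat.cast_sum]
  gcongr with v hv
  split_ifs with h
  · simpa using prob_le_one
  · rw [Nat.cast_zero, nonpos_iff_eq_zero]
    refine measure_mono_null (t := Δᶜ) (fun z hz hzΔ => h ?_) hν.2.1
    have h2 : (0 : ℝ) < 2 ^ n := by positivity
    simp only [mem_preimage, hL.map_cylinderMap, mem_Ioo, div_lt_div_iff_of_pos_right h2] at hz
    rw [mem_Ioo, div_lt_iff₀' h2, lt_div_iff₀' h2] at ha
    have hI := hL.map_mem_Icc hΔ hzΔ
    have k1 : (digitWeight m₁ m₂ v : ℤ) < j + 1 := by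
      have : (digitWeight m₁ m₂ v : ℝ) < j + 1 := by linarith [hI.1]
      exact_mod_cast this
    have k2 : j < (digitWeight m₁ m₂ v : ℤ) + (max m₁ m₂ : ℕ) := by
      have : (j : ℝ) < (digitWeight m₁ m₂ v : ℝ) + (max m₁ m₂ : ℕ) := by linarith [hI.2]
      exact_mod_cast this
    have k1' : (digitWeight m₁ m₂ v : ℝ) ≤ j := by exact_mod_cast Int.lt_add_one_iff.1 k1
    have k2' : (j : ℝ) + 1 ≤ (digitWeight m₁ m₂ v : ℝ) + (max m₁ m₂ : ℕ) := by
      exact_mod_cast Int.add_one_le_iff.2 k2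
    constructor <;> linarith [ha.1, ha.2]

end ProjectedMeasure

/-! ### Covering numbers of the slices -/

theorem exists_card_eq_coverNum {X : Type*} [PseudoMetricSpace X] {E : Set X}
    (hE : TotallyBounded E) {ε : ℝ} (hε : 0 < ε) :
    ∃ F : Finset X, F.card = coverNum E ε ∧ E ⊆ ⋃ x ∈ F, Metric.ball x ε := by
  refine Nat.sInf_mem (s := {n : ℕ | ∃ F : Finset X, F.card = n ∧ E ⊆ ⋃ x ∈ F, Metric.ball x ε}) ?_
  obtain ⟨t, ht, hcov⟩ := Metric.totallyBounded_iff.1 hE ε hε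
  exact ⟨_, ht.toFinset, rfl, by simpa using hcov⟩

theorem coverNum_le_card {X : Type*} [PseudoMetricSpace X] {E : Set X} {ε : ℝ} {F : Finset X}
    (h : E ⊆ ⋃ x ∈ F, Metric.ball x ε) : coverNum E ε ≤ F.card :=
  Nat.sInf_le ⟨F, rfl, h⟩

theorem upperBoxDim_nonneg {X : Type*} [PseudoMetricSpace X] (E : Set X) : 0 ≤ upperBoxDim E := by
  refine Real.sInf_nonneg fun b (hb : ∀ᶠ ε : ℝ in 𝓝[>] 0,
    Real.log (coverNum E ε) / Real.log (1 / ε) ≤ b) => ?_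
  have hlt : ∀ᶠ ε : ℝ in 𝓝[>] 0, ε < 1 := mem_nhdsWithin_of_mem_nhds (Iio_mem_nhds one_pos)
  obtain ⟨ε, h1, h2, h3⟩ := (hb.and (hlt.and self_mem_nhdsWithin)).exists
  refine le_trans (div_nonneg (Real.log_natCast_nonneg _) (Real.log_nonneg ?_)) h1
  rw [le_div_iff₀ h3]
  linarith

theorem abs_sub_le_of_dist_latticePoint_le {v w : ℕ × ℕ} {R : ℝ}
    (h : dist (latticePoint v) (latticePoint w) ≤ R) :
    |(v.1 : ℝ) - w.1| ≤ 2 * R ∧ |(v.2 : ℝ) - w.2| ≤ 2 * R := by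
  rw [Prod.dist_eq, max_le_iff, Real.dist_eq, Real.dist_eq] at h
  simp only [latticePoint] at h
  have hs : 1 ≤ Real.sqrt 3 := Real.one_le_sqrt.2 (by norm_num)
  have h2 : |(v.2 : ℝ) - w.2| ≤ 2 * R := by
    have : |Real.sqrt 3 / 2 * v.2 - Real.sqrt 3 / 2 * w.2| =
        Real.sqrt 3 / 2 * |(v.2 : ℝ) - w.2| := by
      rw [← mul_sub, abs_mul, abs_of_pos (by positivity)]
    nlinarith [abs_nonneg ((v.2 : ℝ) - w.2), h.2]
  refine ⟨?_, h2⟩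
  have h1 := abs_le.1 h.1
  have h2' := abs_le.1 h2
  rw [abs_le]
  constructor <;> linarith [h1.1, h1.2, h2'.1, h2'.2]

theorem IsIntegralProjection.exists_cylinderCount_le_mul_coverNum {Δ : Set (ℝ × ℝ)}
    {L : ℝ × ℝ →L[ℝ] ℝ} {m₁ m₂ : ℕ} (hL : IsIntegralProjection L m₁ m₂)
    (hΔ : IsSierpinskiGasket Δ) :
    ∃ C : ℕ, 0 < C ∧ ∀ n a,
      cylinderCount m₁ m₂ n a ≤ C * coverNum {z ∈ Δ | L z = a} (1 / 2 ^ n) := by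
  set k : ℕ := ⌈2 * (2 + Metric.diam Δ)⌉₊ with hk
  refine ⟨(2 * k + 1) * (2 * k + 1), by positivity, fun n a => ?_⟩
  have h2 : (0 : ℝ) < 2 ^ n := by positivity
  obtain ⟨F, hF, hcov⟩ := exists_card_eq_coverNum (E := {z ∈ Δ | L z = a}) (ε := 1 / 2 ^ n)
    (hΔ.2.1.totallyBounded.subset (sep_subset _ _)) (by positivity)
  have hpt : ∀ v ∈ (gasketDigits n).filter fun v => (digitWeight m₁ m₂ v : ℝ) ≤ 2 ^ n * a ∧
      2 ^ n * a ≤ digitWeight m₁ m₂ v + (max m₁ m₂ : ℕ),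
      ∃ x ∈ F, ∃ z ∈ Δ, dist (cylinderMap n v z) x < 1 / 2 ^ n := by
    intro v hv
    rw [Finset.mem_filter] at hv
    obtain ⟨z, hz, hLz⟩ := hL.exists_map_eq hΔ (x := 2 ^ n * a - digitWeight m₁ m₂ v)
      ⟨by linarith [hv.2.1], by linarith [hv.2.2]⟩
    have hmem : cylinderMap n v z ∈ {z ∈ Δ | L z = a} := by
      refine ⟨hΔ.cylinderMap_mem hv.1 hz, ?_⟩
      rw [hL.map_cylinderMap, hLz, sub_add_cancel, mul_div_cancel_left₀ _ h2.ne']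
    obtain ⟨x, hx, hball⟩ := mem_iUnion₂.1 (hcov hmem)
    exact ⟨x, hx, z, hz, hball⟩
  choose! c hcF z hz hdist using hpt
  rw [← hF]
  refine Finset.card_le_mul_card_image_of_maps_to hcF _ fun x _ => ?_
  rcases Finset.eq_empty_or_nonempty (Finset.filter (fun v => c v = x) ((gasketDigits n).filter
    fun v => (digitWeight m₁ m₂ v : ℝ) ≤ 2 ^ n * a ∧
      2 ^ n * a ≤ digitWeight m₁ m₂ v + (max m₁ m₂ : ℕ))) with h | ⟨w, hw⟩
  · rw [h]
    simp
  have hsub : Finset.filter (fun v => c v = x) ((gasketDigits n).filter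
    fun v => (digitWeight m₁ m₂ v : ℝ) ≤ 2 ^ n * a ∧
      2 ^ n * a ≤ digitWeight m₁ m₂ v + (max m₁ m₂ : ℕ)) ⊆
      Finset.Icc (w.1 - k) (w.1 + k) ×ˢ Finset.Icc (w.2 - k) (w.2 + k) := by
    intro v hv
    rw [Finset.mem_filter] at hv hw
    have hd : dist (cylinderMap n v (z v)) (cylinderMap n w (z w)) ≤ 2 / 2 ^ n := by
      have e1 := hdist v hv.1
      have e2 := hdist w hw.1
      rw [hv.2] at e1
      rw [hw.2] at e2
      calc _ ≤ _ := dist_triangle_right _ _ x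
        _ ≤ 1 / 2 ^ n + 1 / 2 ^ n := add_le_add e1.le e2.le
        _ = 2 / 2 ^ n := by ring
    rw [cylinderMap, cylinderMap, dist_smul₀, Real.norm_of_nonneg (by positivity), inv_mul_eq_div,
      div_le_div_iff_of_pos_right h2] at hd
    have hlat : dist (latticePoint v) (latticePoint w) ≤ 2 + Metric.diam Δ := by
      have e3 : dist (z v) (z w) ≤ Metric.diam Δ :=
        Metric.dist_le_diam_of_mem hΔ.2.1.isBounded (hz v hv.1) (hz w hw.1)
      rw [dist_eq_norm] at hd e3 ⊢
      have : latticePoint v - latticePoint w =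
        (z v + latticePoint v - (z w + latticePoint w)) - (z v - z w) := by abel
      rw [this]
      exact (norm_sub_le _ _).trans (add_le_add hd e3)
    obtain ⟨a1, a2⟩ := abs_sub_le_of_dist_latticePoint_le hlat
    have hkc : 2 * (2 + Metric.diam Δ) ≤ k := Nat.le_ceil _
    have b1 := abs_le.1 (a1.trans hkc)
    have b2 := abs_le.1 (a2.trans hkc)
    have c1 : v.1 ≤ w.1 + k := by
      have : (v.1 : ℝ) ≤ w.1 + k := by linarith [b1.2]
      exact_mod_cast this
    have c2 : w.1 ≤ v.1 + k := by
      have : (w.1 : ℝ) ≤ v.1 + k := by linarith [b1.1]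
      exact_mod_cast this
    have c3 : v.2 ≤ w.2 + k := by
      have : (v.2 : ℝ) ≤ w.2 + k := by linarith [b2.2]
      exact_mod_cast this
    have c4 : w.2 ≤ v.2 + k := by
      have : (w.2 : ℝ) ≤ v.2 + k := by linarith [b2.1]
      exact_mod_cast this
    simp only [Finset.mem_product, Finset.mem_Icc]
    omega
  refine (Finset.card_le_card hsub).trans ?_
  rw [Finset.card_product, Nat.card_Icc, Nat.card_Icc]
  exact Nat.mul_le_mul (by omega) (by omega)

theorem IsSierpinskiGasket.eventually_log_coverNum_div_le {Δ E : Set (ℝ × ℝ)}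
    (hΔ : IsSierpinskiGasket Δ) (hE : E ⊆ Δ) :
    ∀ᶠ ε : ℝ in 𝓝[>] 0, Real.log (coverNum E ε) / Real.log (1 / ε) ≤ 3 := by
  obtain ⟨R, hR1, hR⟩ : ∃ R : ℝ, 1 ≤ R ∧ Δ ⊆ Metric.ball 0 R := by
    obtain ⟨R, hR⟩ := hΔ.2.1.isBounded.subset_ball 0
    exact ⟨max 1 R, le_max_left _ _, hR.trans (Metric.ball_subset_ball (le_max_right _ _))⟩
  have hsmall : ∀ᶠ ε : ℝ in 𝓝[>] 0, ε < 1 / (2 * R) ^ 2 :=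
    mem_nhdsWithin_of_mem_nhds (Iio_mem_nhds (by positivity))
  filter_upwards [hsmall, self_mem_nhdsWithin] with ε hε1 hε0
  rw [mem_Ioi] at hε0
  have hRε : (2 * R) ^ 2 ≤ 1 / ε := by
    rw [le_div_iff₀ hε0]
    rw [lt_div_iff₀ (by positivity)] at hε1
    linarith
  have hone : 1 < 1 / ε := by nlinarith
  have hlog : 0 < Real.log (1 / ε) := Real.log_pos hone
  rw [div_le_iff₀ hlog]
  obtain ⟨n, hn1, hn2⟩ := exists_nat_pow_near (x := R / ε) (y := (2 : ℝ))
    (by rw [le_div_iff₀ hε0]; rw [lt_div_iff₀ hε0] at hone; linarith) (by norm_num)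
  have h2 : (0 : ℝ) < 2 ^ (n + 1) := by positivity
  have hcov : E ⊆ ⋃ x ∈ (gasketDigits (n + 1)).image fun v => cylinderMap (n + 1) v 0,
      Metric.ball x ε := by
    intro z hz
    obtain ⟨v, hv, w, hw, rfl⟩ := hΔ.exists_cylinderMap (n + 1) (hE hz)
    refine mem_iUnion₂.2 ⟨_, Finset.mem_image_of_mem _ hv, ?_⟩
    rw [Metric.mem_ball, dist_cylinderMap, div_lt_iff₀ h2]
    rw [div_lt_iff₀ hε0] at hn2
    linarith [Metric.mem_ball.1 (hR hw)]
  have hcard : (coverNum E ε : ℝ) ≤ (1 / ε) ^ 3 := by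
    calc (coverNum E ε : ℝ) ≤ (3 : ℝ) ^ (n + 1) := by
          exact_mod_cast (coverNum_le_card hcov).trans
            (Finset.card_image_le.trans (card_gasketDigits _).le)
      _ ≤ (4 : ℝ) ^ (n + 1) := by gcongr; norm_num
      _ = (2 * 2 ^ n) ^ 2 := by
          rw [← pow_succ', ← pow_mul, mul_comm, pow_mul]
          norm_num
      _ ≤ (2 * (R / ε)) ^ 2 := by gcongr
      _ = (2 * R) ^ 2 * (1 / ε) ^ 2 := by ring
      _ ≤ (1 / ε) * (1 / ε) ^ 2 := by gcongr
      _ = (1 / ε) ^ 3 := by ring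
  rcases Nat.eq_zero_or_pos (coverNum E ε) with h0 | h0
  · rw [h0]
    simp only [Nat.cast_zero, Real.log_zero]
    positivity
  · calc Real.log (coverNum E ε) ≤ Real.log ((1 / ε) ^ 3) :=
          Real.log_le_log (by exact_mod_cast h0) hcard
      _ = 3 * Real.log (1 / ε) := by rw [Real.log_pow]; norm_num

theorem IsSierpinskiGasket.eventually_coverNum_le {Δ E : Set (ℝ × ℝ)}
    (hΔ : IsSierpinskiGasket Δ) (hE : E ⊆ Δ) {b : ℝ} (hb : upperBoxDim E < b) :
    ∀ᶠ n : ℕ in atTop, (coverNum E (1 / 2 ^ n) : ℝ) ≤ ((2 : ℝ) ^ n) ^ b := by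
  have hev := eventually_lt_of_limsup_lt hb ⟨3, eventually_map.2
    (hΔ.eventually_log_coverNum_div_le hE)⟩
  have hlim : Tendsto (fun n : ℕ => (1 : ℝ) / 2 ^ n) atTop (𝓝[>] 0) := by
    refine tendsto_nhdsWithin_iff.2 ⟨?_, Eventually.of_forall fun n => mem_Ioi.2 (by positivity)⟩
    simpa using tendsto_pow_atTop_nhds_zero_of_lt_one (r := (2⁻¹ : ℝ)) (by norm_num) (by norm_num)
  filter_upwards [hlim.eventually hev, eventually_ge_atTop 1] with n hn hn1
  have h2 : (0 : ℝ) < 2 ^ n := by positivity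
  rcases Nat.eq_zero_or_pos (coverNum E (1 / 2 ^ n)) with h0 | h0
  · rw [h0, Nat.cast_zero]
    positivity
  · rw [one_div_one_div, div_lt_iff₀ (Real.log_pos (one_lt_pow₀ (by norm_num) (by omega))),
      ← Real.log_rpow h2] at hn
    exact ((Real.log_lt_log_iff (by exact_mod_cast h0) (by positivity)).1 hn).le

/-! ### The mass distribution principle -/

theorem le_dimH_of_measure_inter_Icc_le {μ : Measure ℝ} [NullSingletonClass μ] {G : Set ℝ}
    (hG : μ G ≠ 0) {d K : ℝ} (hd : 0 ≤ d) (hK : 0 < K) (k : ℕ)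
    (h : ∀ n ≥ k, ∀ j : ℤ, μ (G ∩ Icc ((j : ℝ) / 2 ^ n) ((j + 1 : ℝ) / 2 ^ n)) ≤
      ENNReal.ofReal (K / ((2 : ℝ) ^ n) ^ d)) :
    ENNReal.ofReal d ≤ dimH G := by
  set C : ℝ≥0∞ := ENNReal.ofReal (3 * K * 2 ^ d) with hC
  have hC0 : C ≠ 0 := (ENNReal.ofReal_pos.2 (by positivity)).ne'
  have hCtop : C ≠ ∞ := ENNReal.ofReal_ne_top
  have key : C⁻¹ • μ.restrict G ≤ μH[d] := by
    refine Measure.le_hausdorffMeasure d _ (ENNReal.ofReal (1 / 2 ^ k))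
      (ENNReal.ofReal_pos.2 (by positivity)) fun s hs => ?_
    rw [Measure.smul_apply, smul_eq_mul, ENNReal.inv_mul_le_iff hC0 hCtop]
    rcases Set.subsingleton_or_nontrivial s with hsub | hnt
    · rw [(hsub.measure_zero (μ.restrict G))]
      exact zero_le
    obtain ⟨x, hx⟩ := hnt.nonempty
    have hfin : ediam s ≠ ∞ := ne_top_of_le_ne_top ENNReal.ofReal_ne_top hs
    set δ : ℝ := Metric.diam s with hδ
    have hδ0 : 0 < δ := ENNReal.toReal_pos (ediam_pos_iff.2 hnt).ne' hfin
    have hδs : ediam s = ENNReal.ofReal δ := (ENNReal.ofReal_toReal hfin).symm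
    have hδk : δ ≤ 1 / 2 ^ k := ENNReal.toReal_le_of_le_ofReal (by positivity) hs
    have hk1 : (2 : ℝ) ^ k ≤ 1 / δ := by
      rw [le_div_iff₀ hδ0]
      rw [le_div_iff₀ (by positivity)] at hδk
      linarith
    obtain ⟨n, hn1, hn2⟩ := exists_nat_pow_near (x := 1 / δ) (y := (2 : ℝ))
      ((one_le_pow₀ (by norm_num)).trans hk1) (by norm_num)
    have hkn : k ≤ n := Nat.lt_succ_iff.1
      ((pow_lt_pow_iff_right₀ (by norm_num : (1 : ℝ) < 2)).1 (hk1.trans_lt hn2))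
    have h2 : (0 : ℝ) < 2 ^ n := by positivity
    rw [le_div_iff₀ hδ0] at hn1
    rw [div_lt_iff₀ hδ0, pow_succ] at hn2
    set j : ℤ := ⌊2 ^ n * x⌋ with hj
    have hcov : s ⊆ ⋃ i ∈ Finset.Icc (j - 1) (j + 1),
        Icc ((i : ℝ) / 2 ^ n) ((i + 1 : ℝ) / 2 ^ n) := by
      intro y hy
      have hxy : |2 ^ n * y - 2 ^ n * x| ≤ 1 := by
        rw [← mul_sub, abs_mul, abs_of_pos h2]
        have : |y - x| ≤ δ := Metric.dist_le_diam_of_mem' hfin hy hx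
        nlinarith
      have hxy := abs_le.1 hxy
      have f1 := Int.floor_le (2 ^ n * x)
      have f2 := Int.lt_floor_add_one (2 ^ n * x)
      have f3 := Int.floor_le (2 ^ n * y)
      have f4 := Int.lt_floor_add_one (2 ^ n * y)
      have g1 : j - 1 ≤ ⌊2 ^ n * y⌋ := Int.le_floor.2 (by push_cast; linarith [hxy.1])
      have g2 : ⌊2 ^ n * y⌋ < j + 1 + 1 := Int.floor_lt.2 (by push_cast; linarith [hxy.2])
      refine mem_iUnion₂.2 ⟨⌊2 ^ n * y⌋, Finset.mem_Icc.2 ⟨g1, by omega⟩, ?_, ?_⟩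
      · rw [div_le_iff₀' h2]
        exact f3
      · rw [le_div_iff₀' h2]
        exact f4.le
    have hpow : K / ((2 : ℝ) ^ n) ^ d ≤ K * 2 ^ d * δ ^ d := by
      rw [div_le_iff₀ (by positivity), mul_assoc, mul_assoc,
        ← Real.mul_rpow hδ0.le h2.le, ← Real.mul_rpow (by norm_num) (by positivity)]
      refine le_mul_of_one_le_right hK.le (Real.one_le_rpow ?_ hd)
      linarith
    calc μ.restrict G s
        ≤ ∑ i ∈ Finset.Icc (j - 1) (j + 1),
            μ.restrict G (Icc ((i : ℝ) / 2 ^ n) ((i + 1 : ℝ) / 2 ^ n)) :=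
          (measure_mono hcov).trans (measure_biUnion_finset_le _ _)
      _ ≤ ∑ _i ∈ Finset.Icc (j - 1) (j + 1), ENNReal.ofReal (K * 2 ^ d * δ ^ d) := by
          refine Finset.sum_le_sum fun i _ => ?_
          rw [Measure.restrict_apply measurableSet_Icc, inter_comm]
          exact (h n hkn i).trans (ENNReal.ofReal_le_ofReal hpow)
      _ = C * ediam s ^ d := by
          rw [Finset.sum_const, Int.card_Icc, hδs, ENNReal.ofReal_rpow_of_pos hδ0, hC,
            ← ENNReal.ofReal_mul (by positivity), show (j + 1 + 1 - (j - 1)).toNat = 3 by omega,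
            nsmul_eq_mul, ← ENNReal.ofReal_natCast, ← ENNReal.ofReal_mul (by positivity)]
          congr 1
          push_cast
          ring
  refine le_dimH_of_hausdorffMeasure_ne_zero (d := d.toNNReal) fun h0 => ?_
  rw [Real.coe_toNNReal d hd] at h0
  have := key G
  rw [h0, Measure.smul_apply, Measure.restrict_apply_self, smul_eq_mul, nonpos_iff_eq_zero,
    mul_eq_zero, ENNReal.inv_eq_zero] at this
  exact this.elim hCtop hG

/-! ### Dimension conservation -/

section DimensionConservation

variable {Δ : Set (ℝ × ℝ)} {ν : Measure (ℝ × ℝ)} {L : ℝ × ℝ →L[ℝ] ℝ} {m₁ m₂ : ℕ} {β : ℝ}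

theorem IsIntegralProjection.dimH_setOf_le_dimH_slice_le (hL : IsIntegralProjection L m₁ m₂)
    (hΔ : IsSierpinskiGasket Δ) (hβ0 : 0 ≤ β) (hβs : β ≤ Real.log 3 / Real.log 2) :
    dimH {a : ℝ | ENNReal.ofReal β ≤ dimH {z ∈ Δ | L z = a}} ≤
      ENNReal.ofReal (Real.log 3 / Real.log 2 - β) := by
  rcases hβ0.eq_or_lt with rfl | hβ
  · refine (dimH_mono (subset_univ _)).trans ?_
    rw [Real.dimH_univ, sub_zero, ← ENNReal.ofReal_one]
    refine ENNReal.ofReal_le_ofReal ((one_le_div (Real.log_pos (by norm_num))).2 ?_)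
    exact Real.log_le_log (by norm_num) (by norm_num)
  have hlim : Tendsto (fun t => ENNReal.ofReal (Real.log 3 / Real.log 2 - t)) (𝓝[<] β)
      (𝓝 (ENNReal.ofReal (Real.log 3 / Real.log 2 - β))) :=
    ENNReal.tendsto_ofReal (tendsto_nhdsWithin_of_tendsto_nhds (by
      exact (continuous_const.sub continuous_id).tendsto β))
  refine ge_of_tendsto hlim ?_
  filter_upwards [self_mem_nhdsWithin, mem_nhdsWithin_of_mem_nhds (Ioi_mem_nhds hβ)] with t ht1 ht0
  calc dimH {a : ℝ | ENNReal.ofReal β ≤ dimH {z ∈ Δ | L z = a}}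
      ≤ dimH (⋃ k : ℕ, {a : ℝ | ∀ n ≥ k, ((2 : ℝ) ^ n) ^ t < cylinderCount m₁ m₂ n a}) := by
        refine dimH_mono fun a ha => mem_iUnion.2 ?_
        exact eventually_atTop.1 (hL.eventually_lt_cylinderCount hΔ (le_of_lt ht0) ht1 ha)
    _ ≤ ENNReal.ofReal (Real.log 3 / Real.log 2 - t) := by
        rw [dimH_iUnion]
        exact iSup_le fun k => dimH_setOf_forall_lt_cylinderCount_le m₁ m₂ k
          ((le_of_lt ht1).trans hβs)

theorem IsIntegralProjection.le_of_ofReal_le_dimH_slice (hL : IsIntegralProjection L m₁ m₂)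
    (hΔ : IsSierpinskiGasket Δ) {a : ℝ} (h : ENNReal.ofReal β ≤ dimH {z ∈ Δ | L z = a}) :
    β ≤ Real.log 3 / Real.log 2 := by
  by_contra! hlt
  obtain ⟨n, hn⟩ := (hL.eventually_lt_cylinderCount hΔ (by positivity) hlt h).exists
  rw [two_pow_rpow_log_three_div_log_two] at hn
  exact absurd (cylinderCount_le m₁ m₂ n a) (not_le.2 (by exact_mod_cast hn))

theorem IsIntegralProjection.le_dimH_setOf_dimH_slice_eq (hL : IsIntegralProjection L m₁ m₂)
    (hΔ : IsSierpinskiGasket Δ) (hν : IsGasketMeasure Δ ν)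
    (hβ : ∀ᵐ a ∂ν.map L, upperBoxDim {z ∈ Δ | L z = a} = β ∧
      dimH {z ∈ Δ | L z = a} = ENNReal.ofReal β) :
    ENNReal.ofReal (Real.log 3 / Real.log 2 - β) ≤
      dimH {a : ℝ | a ∈ L '' Δ ∧ dimH {z ∈ Δ | L z = a} = ENNReal.ofReal β} := by
  have := hν.1
  have := hL.nullSingletonClass_map hΔ hν
  have := Measure.isProbabilityMeasure_map (μ := ν) L.continuous.aemeasurable
  have himage : ∀ᵐ a ∂ν.map L, a ∈ L '' Δ := by
    refine (ae_map_iff (p := (· ∈ L '' Δ)) L.continuous.aemeasurable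
      (hΔ.2.1.image L.continuous).measurableSet).2 ?_
    filter_upwards [measure_eq_zero_iff_ae_notMem.1 hν.2.1] with z hz
    exact ⟨z, not_not.1 hz, rfl⟩
  have hlim : Tendsto (fun t => ENNReal.ofReal (Real.log 3 / Real.log 2 - t)) (𝓝[>] β)
      (𝓝 (ENNReal.ofReal (Real.log 3 / Real.log 2 - β))) :=
    ENNReal.tendsto_ofReal (tendsto_nhdsWithin_of_tendsto_nhds (by
      exact (continuous_const.sub continuous_id).tendsto β))
  refine le_of_tendsto hlim ?_
  filter_upwards [self_mem_nhdsWithin] with t ht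
  rcases le_total (Real.log 3 / Real.log 2 - t) 0 with hd | hd
  · rw [ENNReal.ofReal_of_nonpos hd]
    exact zero_le
  obtain ⟨C, hC0, hC⟩ := hL.exists_cylinderCount_le_mul_coverNum hΔ
  set G : ℕ → Set ℝ := fun k => {a | (a ∈ L '' Δ ∧ dimH {z ∈ Δ | L z = a} = ENNReal.ofReal β) ∧
    ∀ n ≥ k, (cylinderCount m₁ m₂ n a : ℝ) ≤ C * ((2 : ℝ) ^ n) ^ t} with hG
  have hunion : ∀ᵐ a ∂ν.map L, a ∈ ⋃ k, G k := by
    filter_upwards [hβ, himage] with a ha hI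
    have hev := hΔ.eventually_coverNum_le (E := {z ∈ Δ | L z = a}) (sep_subset _ _)
      (b := t) (by rw [ha.1]; exact ht)
    obtain ⟨k, hk⟩ := eventually_atTop.1 hev
    refine mem_iUnion.2 ⟨k, ⟨hI, ha.2⟩, fun n hn => ?_⟩
    calc (cylinderCount m₁ m₂ n a : ℝ)
        ≤ C * coverNum {z ∈ Δ | L z = a} (1 / 2 ^ n) := by exact_mod_cast hC n a
      _ ≤ C * ((2 : ℝ) ^ n) ^ t := by gcongr; exact hk n hn
  obtain ⟨k, hk⟩ : ∃ k, ν.map L (G k) ≠ 0 := by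
    by_contra! h0
    have hnull := measure_iUnion_null h0
    obtain ⟨a, ha1, ha2⟩ := (hunion.and (measure_eq_zero_iff_ae_notMem.1 hnull)).exists
    exact ha2 ha1
  refine le_trans ?_ (dimH_mono (s := G k) fun a ha => ha.1)
  refine le_dimH_of_measure_inter_Icc_le hk hd (Nat.cast_pos.2 hC0) k fun n hn j => ?_
  have hae : (G k ∩ Icc ((j : ℝ) / 2 ^ n) ((j + 1 : ℝ) / 2 ^ n) : Set ℝ) =ᵐ[ν.map L]
      (G k ∩ Ioo ((j : ℝ) / 2 ^ n) ((j + 1 : ℝ) / 2 ^ n) : Set ℝ) :=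
    (ae_eq_refl _).inter Ioo_ae_eq_Icc.symm
  rw [measure_congr hae]
  rcases (G k ∩ Ioo ((j : ℝ) / 2 ^ n) ((j + 1 : ℝ) / 2 ^ n)).eq_empty_or_nonempty with h0 | ⟨a, ha⟩
  · rw [h0, measure_empty]
    exact zero_le
  calc ν.map L (G k ∩ Ioo ((j : ℝ) / 2 ^ n) ((j + 1 : ℝ) / 2 ^ n))
      ≤ ν.map L (Ioo ((j : ℝ) / 2 ^ n) ((j + 1 : ℝ) / 2 ^ n)) := measure_mono inter_subset_right
    _ ≤ (3⁻¹ : ℝ≥0∞) ^ n * cylinderCount m₁ m₂ n a := hL.map_Ioo_le hΔ hν n j ha.2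
    _ = ENNReal.ofReal (cylinderCount m₁ m₂ n a / 3 ^ n) := by
        rw [ENNReal.ofReal_div_of_pos (by positivity), ENNReal.ofReal_natCast,
          ENNReal.ofReal_pow (by norm_num), ENNReal.ofReal_ofNat, ← ENNReal.inv_pow, mul_comm,
          div_eq_mul_inv]
    _ ≤ ENNReal.ofReal (C / ((2 : ℝ) ^ n) ^ (Real.log 3 / Real.log 2 - t)) := by
        refine ENNReal.ofReal_le_ofReal ?_
        rw [Real.rpow_sub (by positivity), two_pow_rpow_log_three_div_log_two, div_div_eq_mul_div]
        gcongr
        exact ha.1.2 n hn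

theorem IsIntegralProjection.dimH_setOf_dimH_slice (hL : IsIntegralProjection L m₁ m₂)
    (hΔ : IsSierpinskiGasket Δ) (hν : IsGasketMeasure Δ ν)
    (hβ : ∀ᵐ a ∂ν.map L, upperBoxDim {z ∈ Δ | L z = a} = β ∧
      dimH {z ∈ Δ | L z = a} = ENNReal.ofReal β) :
    β ≤ Real.log 3 / Real.log 2 ∧
      dimH {a : ℝ | a ∈ L '' Δ ∧ ENNReal.ofReal β ≤ dimH {z ∈ Δ | L z = a}} =
        ENNReal.ofReal (Real.log 3 / Real.log 2 - β) ∧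
      dimH {a : ℝ | a ∈ L '' Δ ∧ dimH {z ∈ Δ | L z = a} = ENNReal.ofReal β} =
        ENNReal.ofReal (Real.log 3 / Real.log 2 - β) := by
  have := hν.1
  have := Measure.isProbabilityMeasure_map (μ := ν) L.continuous.aemeasurable
  obtain ⟨a, ha, ha'⟩ := hβ.exists
  have hβ0 : 0 ≤ β := ha ▸ upperBoxDim_nonneg _
  have hβs := hL.le_of_ofReal_le_dimH_slice hΔ ha'.ge
  have hlow := hL.le_dimH_setOf_dimH_slice_eq hΔ hν hβ
  have hup := hL.dimH_setOf_le_dimH_slice_le hΔ hβ0 hβs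
  exact ⟨hβs, ((dimH_mono fun x hx => hx.2).trans hup).antisymm
      (hlow.trans (dimH_mono fun x hx => ⟨hx.1, hx.2.ge⟩)),
    ((dimH_mono fun x hx => hx.2.ge).trans hup).antisymm hlow⟩

end DimensionConservation

/-- The projection in direction `θ`, in units of `u`. -/
def scaledProj (θ u : ℝ) : ℝ × ℝ →L[ℝ] ℝ :=
  (Real.cos θ / u) • ContinuousLinearMap.fst ℝ ℝ ℝ +
    (Real.sin θ / u) • ContinuousLinearMap.snd ℝ ℝ ℝ

theorem projAngle_eq_mul_scaledProj (θ : ℝ) {u : ℝ} (hu : u ≠ 0) (z : ℝ × ℝ) :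
    projAngle θ z = u * scaledProj θ u z := by
  simp only [projAngle, scaledProj, add_apply, smul_apply, ContinuousLinearMap.coe_fst',
    ContinuousLinearMap.coe_snd', smul_eq_mul]
  field_simp

theorem sliceSet_mul (Δ : Set (ℝ × ℝ)) (θ : ℝ) {u : ℝ} (hu : u ≠ 0) (b : ℝ) :
    sliceSet Δ θ (u * b) = {z ∈ Δ | scaledProj θ u z = b} := by
  ext z
  simp [sliceSet, projAngle_eq_mul_scaledProj θ hu, hu]

theorem dimH_setOf_sliceSet (Δ : Set (ℝ × ℝ)) (θ : ℝ) {u : ℝ} (hu : u ≠ 0)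
    (P : Set (ℝ × ℝ) → Prop) :
    dimH {a : ℝ | a ∈ projAngle θ '' Δ ∧ P (sliceSet Δ θ a)} =
      dimH {b : ℝ | b ∈ scaledProj θ u '' Δ ∧ P {z ∈ Δ | scaledProj θ u z = b}} := by
  rw [← (ContinuousLinearEquiv.smulLeft (R₁ := ℝ) (M₁ := ℝ) (Units.mk0 u hu)).dimH_preimage]
  congr 1
  ext b
  simp [Units.smul_def, sliceSet_mul Δ θ hu, projAngle_eq_mul_scaledProj θ hu, hu]

theorem isIntegralProjection_scaledProj {p q : ℕ} (hp : 0 < p) (hq : 0 < q) {θ : ℝ}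
    (hcos : 0 < Real.cos θ) (htan : Real.tan θ = Real.sqrt 3 * p / (2 * q + p)) :
    IsIntegralProjection (scaledProj θ (Real.cos θ / (2 * q + p))) (2 * q + p) (q + 2 * p) := by
  have hq' : (0 : ℝ) < q := by exact_mod_cast hq
  have hD : (0 : ℝ) < 2 * q + p := by positivity
  have hsin : Real.sin θ = Real.sqrt 3 * p / (2 * q + p) * Real.cos θ := by
    rw [← htan, Real.tan_mul_cos hcos.ne']
  have h3 : Real.sqrt 3 * Real.sqrt 3 = 3 := Real.mul_self_sqrt (by norm_num)
  refine ⟨?_, ?_, by positivity, by positivity⟩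
  · simp only [scaledProj, add_apply, smul_apply,
      ContinuousLinearMap.coe_fst', ContinuousLinearMap.coe_snd', smul_eq_mul]
    push_cast
    field_simp
    ring
  · simp only [scaledProj, add_apply, smul_apply,
      ContinuousLinearMap.coe_fst', ContinuousLinearMap.coe_snd', smul_eq_mul, hsin]
    push_cast
    field_simp
    linear_combination (p : ℝ) * h3

/-- **Corollary (Furstenberg's dimension conservation).** If `tan θ = √3 p/(2q+p)` with
`p, q` coprime positive integers, `θ ∈ (0, π/3)`, and `β(θ)` is the `ν_θ`-almost sure
common value of the Hausdorff and box dimensions of the slices, then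
`β(θ) + dim_H {a ∈ Δ_θ : dim_H E_{θ,a} ≥ β(θ)} = s` and
`β(θ) + dim_H {a ∈ Δ_θ : dim_H E_{θ,a} = β(θ)} = s`. -/
theorem gasket_slice_dimension_conservation_formula
    (Δ : Set (ℝ × ℝ)) (hΔ : IsSierpinskiGasket Δ)
    (ν : Measure (ℝ × ℝ)) (hν : IsGasketMeasure Δ ν)
    (p q : ℕ) (hp : 0 < p) (hq : 0 < q) (hpq : Nat.Coprime p q)
    (θ : ℝ) (hθ : θ ∈ Set.Ioo 0 (Real.pi / 3))
    (hθtan : Real.tan θ = Real.sqrt 3 * p / (2 * q + p))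
    (β : ℝ)
    (hβ : ∀ᵐ a ∂(ν.map (projAngle θ)),
      lowerBoxDim (sliceSet Δ θ a) = β ∧ upperBoxDim (sliceSet Δ θ a) = β ∧
      dimH (sliceSet Δ θ a) = ENNReal.ofReal β) :
    β + (dimH {a : ℝ | a ∈ projAngle θ '' Δ ∧
          ENNReal.ofReal β ≤ dimH (sliceSet Δ θ a)}).toReal
        = Real.log 3 / Real.log 2 ∧
      β + (dimH {a : ℝ | a ∈ projAngle θ '' Δ ∧
          dimH (sliceSet Δ θ a) = ENNReal.ofReal β}).toReal
        = Real.log 3 / Real.log 2 := by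
  have hcos : 0 < Real.cos θ :=
    Real.cos_pos_of_mem_Ioo ⟨by linarith [hθ.1, Real.pi_pos], by linarith [hθ.2, Real.pi_pos]⟩
  have hL := isIntegralProjection_scaledProj hp hq hcos hθtan
  set u : ℝ := Real.cos θ / (2 * q + p) with hu_def
  have hu : u ≠ 0 := by
    have : (0 : ℝ) < q := by exact_mod_cast hq
    positivity
  have hmap : ν.map (projAngle θ) = (ν.map (scaledProj θ u)).map (u * ·) := by
    rw [Measure.map_map (measurable_const_mul u) (scaledProj θ u).continuous.measurable]
    congr 1
    ext z
    exact projAngle_eq_mul_scaledProj θ hu z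
  have hae : ∀ᵐ b ∂ν.map (scaledProj θ u),
      upperBoxDim {z ∈ Δ | scaledProj θ u z = b} = β ∧
        dimH {z ∈ Δ | scaledProj θ u z = b} = ENNReal.ofReal β := by
    rw [hmap] at hβ
    filter_upwards [ae_of_ae_map (measurable_const_mul u).aemeasurable hβ] with b hb
    rw [sliceSet_mul Δ θ hu] at hb
    exact hb.2
  obtain ⟨hβs, hge, heq⟩ := hL.dimH_setOf_dimH_slice hΔ hν hae
  rw [dimH_setOf_sliceSet Δ θ hu fun E => ENNReal.ofReal β ≤ dimH E,
    dimH_setOf_sliceSet Δ θ hu fun E => dimH E = ENNReal.ofReal β, hge, heq,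
    ENNReal.toReal_ofReal (sub_nonneg.2 hβs)]
  constructor <;> ring

end
end
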